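/- Let B be a finite set. Let (ϖ_n) be a sequence of probability vectors on B with n·ϖ_n(a) ∈ ℕ for all a ∈ B, and let (ω_n) be a sequence of symmetric finite nonnegative vectors on B×B with n·ω_n(a,b)/(1+𝟙{a=b}) ∈ ℕ for all a,b ∈ B, such that ϖ_n → ϖ and ω_n → ω pointwise, where ϖ(a) > 0 for all a ∈ B. For each n, let X be the random typed graph on n vertices constructed as follows: the n vertices receive types by drawing uniformly at random without replacement from a pool containing exactly n·ϖ_n(a) copies of each type a ∈ B; then, independently for each unordered pair of types {a,b}, exactly m_n(a,b) edges are drawn uniformly at random without replacement from the set of all potential edges joining a vertex of type a to a vertex of type b, where m_n(a,b) = n·ω_n(a,b) if a ≠ b and m_n(a,b) = (n/2)·ω_n(a,b) if a = b. Then the empirical locality measures M_X satisfy a large deviation principle on 𝒫(B×ℕ^B), equipped with the weak topology, at speed n with good rate function J(ℓ) = H(ℓ ∥ Q_poi) if ℓ₁ = ϖ and Σ_σ σ(b)·ℓ(a,σ) = ω(a,b) for all a,b ∈ B, and J(ℓ) = ∞ otherwise, where Q_poi(a,σ) = ϖ(a)·∏_{b∈B} e^{−ω(a,b)/ϖ(a)}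 (ω(a,b)/ϖ(a))^{σ(b)}/σ(b)!. -/

import Mathlib

open MeasureTheory Filter Topology Finset
open scoped ENNReal NNReal

/-- A rate function is good if all its sublevel sets (at finite levels) are compact. -/
def GoodRate {X : Type*} [TopologicalSpace X] (I : X → ℝ≥0∞) : Prop :=
  ∀ c : ℝ≥0, IsCompact {x | I x ≤ (c : ℝ≥0∞)}

/-- Large deviation principle at speed `n`, with good rate function `I`, for a sequence of
laws given as set functions `μ n : Set X → ℝ≥0∞` (the probability of each event):
compact sublevel sets, upper bound on closed sets, lower bound on open sets. -/
def IsLDP {X : Type*} [TopologicalSpace X] (μ : ℕ → Set X → ℝ≥0∞) (I : X → ℝ≥0∞) : Prop :=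
  GoodRate I ∧
  (∀ F : Set X, IsClosed F →
    limsup (fun n : ℕ => ((n : ℝ)⁻¹ : EReal) * ENNReal.log (μ n F)) atTop
      ≤ -(⨅ x ∈ F, (I x : EReal))) ∧
  (∀ O : Set X, IsOpen O →
    -(⨅ x ∈ O, (I x : EReal))
      ≤ liminf (fun n : ℕ => ((n : ℝ)⁻¹ : EReal) * ENNReal.log (μ n O)) atTop)

/-- The uniform probability distribution on a finite set of configurations. -/
noncomputable def uniformOn {α : Type*} [MeasurableSpace α] (s : Finset α) : Measure α :=
  ((s.card : ℝ≥0∞))⁻¹ • ∑ x ∈ s, Measure.dirac x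

/-- Relative entropy `H(p ∥ q)` of measures on a countable discrete space, with the
conventions `0 log 0 = 0` and `H(p ∥ q) = ∞` if `p ⋬ q`. -/
noncomputable def relEnt {α : Type*} [MeasurableSpace α] [Countable α]
    (p q : Measure α) : ℝ≥0∞ := by
  classical
  exact if ∀ x : α, q {x} = 0 → p {x} = 0 then
    (∑' x : α, ENNReal.ofReal ((p {x}).toReal * Real.log ((p {x}).toReal / (q {x}).toReal)
      - (p {x}).toReal + (q {x}).toReal))
  else ⊤

variable {B : Type*} [Fintype B] [DecidableEq B] [MeasurableSpace B]

/-- A typed-graph configuration on `n` vertices: a type map `Fin n → B` together with an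
edge set (a set of unordered pairs of vertices). -/
abbrev TConf (B : Type*) (n : ℕ) : Type _ := (Fin n → B) × Finset (Sym2 (Fin n))

instance {B : Type*} {n : ℕ} : MeasurableSpace (TConf B n) := ⊤

/-- `σ_v(b)`: the number of vertices of type `b` linked to vertex `v`. -/
def nbr {n : ℕ} (c : TConf B n) (v : Fin n) (b : B) : ℕ :=
  (univ.filter fun u => c.1 u = b ∧ s(u, v) ∈ c.2).card

/-- The configurations on `n` vertices which are simple graphs (no loops), have exactly
`n·ϖₙ(a)` vertices of each type `a`, and exactly `m_n(a,b)` edges linking types `a` and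
`b`, where `m_n(a,b) = n·ωₙ(a,b)` for `a ≠ b` and `m_n(a,a) = (n/2)·ωₙ(a,a)`.  The typed
random geometric graph conditioned on its empirical type measure `ϖₙ` and empirical pair
measure `ωₙ` is exactly the uniform distribution on this set. -/
noncomputable def admissible (ϖ : B → ℝ) (ω : B → B → ℝ) (n : ℕ) : Finset (TConf B n) := by
  classical
  exact univ.filter fun c =>
    (∀ e ∈ c.2, ¬ e.IsDiag) ∧
    (∀ a : B, (((univ.filter fun v => c.1 v = a).card : ℝ)) = n * ϖ a) ∧
    (∀ a b : B, (((c.2.filter fun e => Sym2.map c.1 e = s(a, b)).card : ℝ))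
        = if a = b then n * ω a b / 2 else n * ω a b)

/-- The measure `Q_poi` on `B × ℕ^B`:
`Q_poi(a,σ) = ϖ(a)·∏_b e^{−ω(a,b)/ϖ(a)} (ω(a,b)/ϖ(a))^{σ(b)} / σ(b)!`. -/
noncomputable def Qpoi (ϖ : B → ℝ) (ω : B → B → ℝ) : Measure (B × (B → ℕ)) :=
  Measure.sum fun x : B × (B → ℕ) =>
    ENNReal.ofReal (ϖ x.1 * ∏ b : B,
        Real.exp (-(ω x.1 b / ϖ x.1)) * (ω x.1 b / ϖ x.1) ^ (x.2 b) / (Nat.factorial (x.2 b)))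
      • Measure.dirac x

/-- The rate function: `J(ℓ) = H(ℓ ∥ Q_poi)` if the `B`-marginal of `ℓ` is `ϖ` and
`∑_σ σ(b)·ℓ(a,σ) = ω(a,b)` for all `a, b` (consistency), and `J(ℓ) = ∞` otherwise. -/
noncomputable def locRate (ϖ : B → ℝ) (ω : B → B → ℝ)
    (ℓ : ProbabilityMeasure (B × (B → ℕ))) : ℝ≥0∞ := by
  classical
  exact if (∀ a : B, (ℓ : Measure (B × (B → ℕ))) {x | x.1 = a} = ENNReal.ofReal (ϖ a)) ∧
      (∀ a b : B, (∑' σ : B → ℕ, (σ b : ℝ≥0∞) * (ℓ : Measure (B × (B → ℕ))) {(a, σ)})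
        = ENNReal.ofReal (ω a b))
    then relEnt (ℓ : Measure (B × (B → ℕ))) (Qpoi ϖ ω)
  else ⊤


set_option linter.all false
/-! ### Part 1 -/

theorem card_perm_comp {P X : Type*} [Fintype P] [DecidableEq P] [Fintype X] [DecidableEq X]
    (f : P → X) : #{π : Equiv.Perm P | f ∘ π = f} = ∏ x, (#{p | f p = x}).factorial := by
  have := DomMulAct.stabilizer_card f
  rw [Fintype.card_subtype] at this
  rw [this]
  refine Finset.prod_congr rfl fun x _ => ?_
  rw [Fintype.card_subtype]

theorem exists_equiv_of_fiber {P Y X : Type*} [Fintype P] [Fintype Y] [DecidableEq X]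
    (f : P → X) (g : Y → X) (h : ∀ x, #{p | f p = x} = #{y | g y = x}) :
    ∃ E : Y ≃ P, f ∘ E = g := by
  have e' : ∀ r, Nonempty ({p // g p = r} ≃ {p // f p = r}) := fun r => by
    rw [← Fintype.card_eq, Fintype.card_subtype, Fintype.card_subtype, h r]
  refine ⟨(Equiv.sigmaFiberEquiv g).symm.trans
    ((Equiv.sigmaCongrRight fun r => (e' r).some).trans (Equiv.sigmaFiberEquiv f)), ?_⟩
  funext p
  exact ((e' (g p)).some ⟨p, rfl⟩).2

theorem count_fun {P R S : Type*} [Fintype P] [DecidableEq P] [Fintype R] [DecidableEq R]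
    [Fintype S] [DecidableEq S] (ρ : R → S) (ψ : P → S) (m : R → ℕ)
    (hm : ∀ s, #{p | ψ p = s} = ∑ r with ρ r = s, m r) :
    #{φ : P → R | (∀ p, ρ (φ p) = ψ p) ∧ ∀ r, #{p | φ p = r} = m r} * ∏ r, (m r).factorial =
      ∏ s, (#{p | ψ p = s}).factorial := by
  classical
  -- existence
  have hex : ∃ φ₀ : P → R, (∀ p, ρ (φ₀ p) = ψ p) ∧ ∀ r, #{p | φ₀ p = r} = m r := by
    obtain ⟨E, hE⟩ := exists_equiv_of_fiber (fun y : (Σ r, Fin (m r)) => ρ y.1) ψ (by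
      intro s
      rw [hm s, Finset.card_filter, Fintype.sum_sigma, Finset.sum_filter]
      refine Finset.sum_congr rfl fun r _ => ?_
      split_ifs <;> simp)
    refine ⟨fun p => (E p).1, fun p => congrFun hE p, fun r => ?_⟩
    have : #{p | (E p).1 = r} = #{y : (Σ r, Fin (m r)) | y.1 = r} := by
      refine Finset.card_bij' (fun p _ => E p) (fun p _ => E.symm p) ?_ ?_ ?_ ?_ <;> simp
    rw [this, Finset.card_filter, Fintype.sum_sigma, Finset.sum_eq_single r] <;>
      simp +contextual
  obtain ⟨φ₀, h1, h2⟩ := hex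
  rw [← card_perm_comp ψ]
  rw [Finset.card_eq_sum_card_fiberwise (f := fun π : Equiv.Perm P => φ₀ ∘ π)
    (t := {φ : P → R | (∀ p, ρ (φ p) = ψ p) ∧ ∀ r, #{p | φ p = r} = m r})]
  · rw [Finset.sum_const_nat (m := ∏ r, (m r).factorial)]
    intro φ hφ
    obtain ⟨hφ1, hφ2⟩ := (Finset.mem_filter.1 hφ).2
    obtain ⟨π₁, hπ₁⟩ := exists_equiv_of_fiber φ₀ φ (fun r => by rw [h2, hφ2])
    have : ∏ r, (m r).factorial = #{π : Equiv.Perm P | φ₀ ∘ π = φ₀} := by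
      rw [card_perm_comp φ₀]; simp [h2]
    rw [this]
    refine Finset.card_bij' (fun π _ => π * π₁⁻¹) (fun π _ => π * π₁) ?_ ?_ ?_ ?_
    · intro π hπ
      simp only [Finset.mem_filter, Finset.mem_univ, true_and] at hπ ⊢
      funext p
      have := congrFun hπ.2 (π₁⁻¹ p)
      have h3 := congrFun hπ₁ (π₁⁻¹ p)
      simp at this h3
      simp [this, ← h3]
    · intro π hπ
      simp only [Finset.mem_filter, Finset.mem_univ, true_and] at hπ ⊢
      have h5 : φ₀ ∘ ⇑(π * π₁) = φ := by
        funext p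
        have := congrFun hπ (π₁ p)
        have h3 := congrFun hπ₁ p
        simp at this h3
        simp [this, h3]
      refine ⟨?_, h5⟩
      funext p
      have := congrFun h5 p
      simp only [Function.comp_apply] at this ⊢
      rw [← h1, this, hφ1]
    · intro π _; simp
    · intro π _; simp
  · intro π hπ
    simp only [Finset.coe_filter, Finset.mem_univ, true_and, Set.mem_ofPred_eq] at hπ ⊢
    refine ⟨fun p => ?_, fun r => ?_⟩
    · simp only [Function.comp_apply]
      rw [h1]; exact congrFun hπ p
    · rw [← h2 r]
      refine Finset.card_bij' (fun p _ => π p) (fun p _ => π⁻¹ p) ?_ ?_ ?_ ?_ <;> simp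

/-! ### Part 2 -/

/-- typed degree profile of a vertex in a stub configuration -/
def prof {B V D : Type*} [Fintype D] [DecidableEq V] [DecidableEq B] (β : D → B) (z : V → B)
    (f : D → V) (v : V) : B × (B → ℕ) :=
  (z v, fun b => #{d | f d = v ∧ β d = b})

/-- number of stubs in class `(a,b)` -/
def kk {B D : Type*} [Fintype D] [DecidableEq B] (α β : D → B) (a b : B) : ℕ :=
  #{d | α d = a ∧ β d = b}

/-- all stub configurations with prescribed type counts -/
def stubConf {B D : Type*} (V : Type*) [Fintype B] [Fintype V] [DecidableEq V] [Fintype D]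
    [DecidableEq D] [DecidableEq B]
    (α : D → B) (N : B → ℕ) : Finset ((V → B) × (D → V)) :=
  {zf | (∀ a, #{v | zf.1 v = a} = N a) ∧ ∀ d, zf.1 (zf.2 d) = α d}

section counts
variable {V D : Type*} [Fintype V] [DecidableEq V] [Fintype D] [DecidableEq D]

theorem prof_sum (α β : D → B) (z : V → B) (f : D → V) (h : ∀ d, z (f d) = α d) (a b : B) :
    ∑ v with z v = a, (prof β z f v).2 b = kk α β a b := by
  unfold kk prof
  rw [Finset.card_eq_sum_card_fiberwise (f := f) (t := {v | z v = a})]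
  · refine Finset.sum_congr rfl fun v hv => ?_
    have hv := (Finset.mem_filter.1 hv).2
    simp only
    congr 1
    ext d
    simp only [Finset.mem_filter, Finset.mem_univ, true_and]
    constructor
    · rintro ⟨h1, h2⟩
      exact ⟨⟨by rw [← h, h1, hv], h2⟩, h1⟩
    · rintro ⟨⟨h1, h2⟩, h3⟩
      exact ⟨h3, h2⟩
  · intro d hd
    simp only [Finset.coe_filter, Finset.mem_univ, true_and, Set.mem_ofPred_eq] at hd ⊢
    rw [h, hd.1]

theorem count_f (α β : D → B) (x : V → B × (B → ℕ))
    (hx : ∀ a b, ∑ v with (x v).1 = a, (x v).2 b = kk α β a b) :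
    #{f : D → V | (∀ d, (x (f d)).1 = α d) ∧ ∀ v, prof β (fun v => (x v).1) f v = x v} *
      ∏ v, ∏ b, ((x v).2 b).factorial = ∏ a, ∏ b, (kk α β a b).factorial := by
  have key := count_fun (P := D) (R := V × B) (S := B × B) (fun r => ((x r.1).1, r.2))
    (fun d => (α d, β d)) (fun r => (x r.1).2 r.2) (by
      rintro ⟨a, b⟩
      have h1 : #{d | (α d, β d) = (a, b)} = kk α β a b := by
        unfold kk; simp [Prod.ext_iff]
      rw [h1, ← hx a b, Finset.sum_filter, Finset.sum_filter, Fintype.sum_prod_type]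
      refine Finset.sum_congr rfl fun v _ => ?_
      simp only [Prod.mk.injEq]
      by_cases hv : (x v).1 = a <;> simp [hv])
  rw [Fintype.prod_prod_type, Fintype.prod_prod_type] at key
  have h2 : ∀ a b, #{d | (α d, β d) = (a, b)} = kk α β a b := by
    intro a b; unfold kk; simp [Prod.ext_iff]
  simp only [h2] at key
  rw [← key]
  congr 1
  refine Finset.card_bij' (fun f _ => fun d => (f d, β d)) (fun φ _ => fun d => (φ d).1) ?_ ?_ ?_ ?_
  · intro f hf
    simp only [Finset.mem_filter, Finset.mem_univ, true_and] at hf ⊢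
    refine ⟨fun d => by rw [hf.1], ?_⟩
    rintro ⟨v, b⟩
    have := congrFun (congrArg Prod.snd (hf.2 v)) b
    simp only [prof] at this
    simpa [Prod.ext_iff] using this
  · intro φ hφ
    simp only [Finset.mem_filter, Finset.mem_univ, true_and] at hφ ⊢
    refine ⟨fun d => congrArg Prod.fst (hφ.1 d), fun v => ?_⟩
    unfold prof
    refine Prod.ext rfl ?_
    funext b
    have := hφ.2 (v, b)
    simp only [← this]
    congr 1
    ext d
    have h3 := congrArg Prod.snd (hφ.1 d)
    simp only at h3
    simp [Prod.ext_iff, h3]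
  · intro f _; rfl
  · intro φ hφ
    simp only [Finset.mem_filter, Finset.mem_univ, true_and] at hφ
    funext d
    exact Prod.ext rfl (congrArg Prod.snd (hφ.1 d)).symm

theorem prod_types (g : B → ℝ) (z : V → B) (N : B → ℕ) (hz : ∀ a, #{v | z v = a} = N a) :
    ∏ v, g (z v) = ∏ a, g a ^ N a := by
  rw [← Finset.prod_fiberwise (s := univ) (g := z)]
  refine Finset.prod_congr rfl fun a _ => ?_
  rw [← hz a, ← Finset.prod_const]
  refine Finset.prod_congr rfl fun v hv => ?_
  rw [(Finset.mem_filter.1 hv).2]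

theorem card_stubConf (α β : D → B) (N : B → ℕ) (hN : ∑ a, N a = Fintype.card V) :
    #(stubConf V α N) * ∏ a, (N a).factorial =
      (Fintype.card V).factorial * ∏ a, ∏ b, N a ^ kk α β a b := by
  classical
  have key := count_fun (P := V) (R := B) (S := Unit) (fun _ => ()) (fun _ => ()) N
    (by intro s; simp [hN])
  simp only [implies_true, true_and, Fintype.univ_unit, prod_singleton, filter_true,
    card_univ] at key
  rw [← key]
  rw [Finset.card_eq_sum_card_fiberwise (f := Prod.fst) (t := {z : V → B | ∀ a, #{v | z v = a} = N a})]
  · rw [Finset.sum_const_nat (m := ∏ a, ∏ b, N a ^ kk α β a b)]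
    · ring
    intro z hz
    have hz := (Finset.mem_filter.1 hz).2
    have h1 : #{zf ∈ stubConf V α N | zf.1 = z} =
        #(Fintype.piFinset fun d => ({v | z v = α d} : Finset V)) := by
      refine Finset.card_bij' (fun zf _ => zf.2) (fun f _ => (z, f)) ?_ ?_ ?_ ?_
      · rintro ⟨z', f⟩ h
        simp only [stubConf, Finset.mem_filter, Finset.mem_univ, true_and] at h
        obtain ⟨⟨h1, h2⟩, rfl⟩ := h
        simpa using h2
      · intro f hf
        simp only [stubConf, Finset.mem_filter, Finset.mem_univ, true_and, Fintype.mem_piFinset] at hf ⊢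
        exact ⟨⟨hz, hf⟩, trivial⟩
      · rintro ⟨z', f⟩ h
        simp only [stubConf, Finset.mem_filter, Finset.mem_univ, true_and] at h
        obtain ⟨⟨h1, h2⟩, rfl⟩ := h
        rfl
      · intro f _; rfl
    rw [h1, Fintype.card_piFinset]
    simp only [hz]
    rw [← Finset.prod_fiberwise (s := univ) (g := fun d => (α d, β d)), Fintype.prod_prod_type]
    refine Finset.prod_congr rfl fun a _ => Finset.prod_congr rfl fun b _ => ?_
    have h2 : #{d | (α d, β d) = (a, b)} = kk α β a b := by unfold kk; simp [Prod.ext_iff]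
    rw [← h2, ← Finset.prod_const]
    refine Finset.prod_congr rfl fun d hd => ?_
    have := congrArg Prod.fst (Finset.mem_filter.1 hd).2
    simp only at this
    rw [this]
  · intro zf hzf
    simp only [stubConf, Finset.coe_filter, Finset.mem_univ, true_and, Set.mem_ofPred_eq] at hzf ⊢
    exact hzf.1

theorem prof_fiber (α β : D → B) (N : B → ℕ) (x : V → B × (B → ℕ))
    (hN : ∀ a, #{v | (x v).1 = a} = N a) :
    #{zf ∈ stubConf V α N | prof β zf.1 zf.2 = x} =
     #{f : D → V | (∀ d, (x (f d)).1 = α d) ∧ ∀ v, prof β (fun v => (x v).1) f v = x v} := by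
  refine Finset.card_bij' (fun zf _ => zf.2) (fun f _ => (fun v => (x v).1, f)) ?_ ?_ ?_ ?_
  · rintro ⟨z, f⟩ h
    simp only [stubConf, Finset.mem_filter, Finset.mem_univ, true_and] at h ⊢
    obtain ⟨⟨h1, h2⟩, h3⟩ := h
    subst h3
    exact ⟨h2, fun v => rfl⟩
  · intro f hf
    simp only [stubConf, Finset.mem_filter, Finset.mem_univ, true_and] at hf ⊢
    exact ⟨⟨hN, hf.1⟩, funext hf.2⟩
  · rintro ⟨z, f⟩ h
    simp only [stubConf, Finset.mem_filter, Finset.mem_univ, true_and] at h ⊢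
    obtain ⟨⟨h1, h2⟩, h3⟩ := h
    subst h3
    rfl
  · intro f hf; rfl

/-- generating function bound -/
theorem gen_bound (α β : D → B) (N : B → ℕ) (p : B → ℝ) (s : B → B → ℝ)
    (w : B × (B → ℕ) → ℝ) (hp : ∀ a, 0 ≤ p a) (hs : ∀ a b, 0 ≤ s a b) (hw : ∀ x, 0 ≤ w x)
    (hsum : Summable fun x : B × (B → ℕ) =>
      p x.1 * (∏ b, (s x.1 b ^ x.2 b / (x.2 b).factorial)) * w x) :
    (∏ a, p a ^ N a) * (∏ a, ∏ b, s a b ^ kk α β a b) *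
      (∑ zf ∈ stubConf V α N, ∏ v, w (prof β zf.1 zf.2 v)) ≤
    (∏ a, ∏ b, ((kk α β a b).factorial : ℝ)) *
      (∑' x : B × (B → ℕ), p x.1 * (∏ b, (s x.1 b ^ x.2 b / (x.2 b).factorial)) * w x)
        ^ Fintype.card V := by
  classical
  set u : B × (B → ℕ) → ℝ := fun x => p x.1 * (∏ b, (s x.1 b ^ x.2 b / (x.2 b).factorial)) * w x
    with hu
  have hu0 : ∀ x, 0 ≤ u x := fun x => by
    refine mul_nonneg (mul_nonneg (hp _) (Finset.prod_nonneg fun b _ => ?_)) (hw x)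
    have := hs x.1 b
    positivity
  rw [Finset.sum_comp (fun x : V → B × (B → ℕ) => ∏ v, w (x v))
    (fun zf : (V → B) × (D → V) => prof β zf.1 zf.2), Finset.mul_sum]
  set T := (stubConf V α N).image (fun zf : (V → B) × (D → V) => prof β zf.1 zf.2) with hT
  have hterm : ∀ x ∈ T, (∏ a, p a ^ N a) * (∏ a, ∏ b, s a b ^ kk α β a b) *
      (#{zf ∈ stubConf V α N | prof β zf.1 zf.2 = x} • ∏ v, w (x v)) =
      (∏ a, ∏ b, ((kk α β a b).factorial : ℝ)) * ∏ v, u (x v) := by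
    intro x hx
    obtain ⟨⟨z, f⟩, hzf, hx⟩ := Finset.mem_image.1 hx
    simp only [stubConf, Finset.mem_filter, Finset.mem_univ, true_and] at hzf
    have hxz : ∀ v, (x v).1 = z v := fun v => by rw [← hx]; rfl
    have hN : ∀ a, #{v | (x v).1 = a} = N a := by simpa [hxz] using hzf.1
    have hk : ∀ a b, ∑ v with (x v).1 = a, (x v).2 b = kk α β a b := by
      intro a b
      have := prof_sum α β z f hzf.2 a b
      simp only [hxz]
      rw [← this]
      refine Finset.sum_congr rfl fun v _ => ?_
      rw [← hx]
    have hc := count_f α β x hk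
    rw [prof_fiber α β N x hN, nsmul_eq_mul]
    have hc' : (#{f : D → V | (∀ d, (x (f d)).1 = α d) ∧
        ∀ v, prof β (fun v => (x v).1) f v = x v} : ℝ) *
      ∏ v, ∏ b, (((x v).2 b).factorial : ℝ) = ∏ a, ∏ b, ((kk α β a b).factorial : ℝ) := by
      exact_mod_cast hc
    rw [← hc', ← prod_types p _ N hN]
    have h3 : ∏ a, ∏ b, s a b ^ kk α β a b = ∏ v, ∏ b, s (x v).1 b ^ (x v).2 b := by
      rw [← Finset.prod_fiberwise (s := univ) (g := fun v => (x v).1)]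
      refine Finset.prod_congr rfl fun a _ => ?_
      rw [Finset.prod_comm]
      refine Finset.prod_congr rfl fun b _ => ?_
      rw [← hk a b, ← Finset.prod_pow_eq_pow_sum]
      refine Finset.prod_congr rfl fun v hv => ?_
      rw [(Finset.mem_filter.1 hv).2]
    rw [h3]
    have h4 : ∏ v, u (x v) = (∏ v, p (x v).1) * (∏ v, ∏ b, s (x v).1 b ^ (x v).2 b) /
        (∏ v, ∏ b, (((x v).2 b).factorial : ℝ)) * ∏ v, w (x v) := by
      rw [hu]
      simp only [Finset.prod_mul_distrib, Finset.prod_div_distrib]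
      ring
    have h5 : (∏ v, ∏ b, (((x v).2 b).factorial : ℝ)) ≠ 0 :=
      Finset.prod_ne_zero_iff.2 fun v _ => Finset.prod_ne_zero_iff.2 fun b _ => by positivity
    rw [h4]
    field_simp
  rw [Finset.sum_congr rfl hterm, ← Finset.mul_sum]
  refine mul_le_mul_of_nonneg_left ?_
    (Finset.prod_nonneg fun a _ => Finset.prod_nonneg fun b _ => by positivity)
  set X : Finset (B × (B → ℕ)) := T.biUnion fun x => univ.image x with hX
  calc ∑ x ∈ T, ∏ v, u (x v) ≤ ∑ x ∈ Fintype.piFinset (fun _ : V => X), ∏ v, u (x v) := by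
        refine Finset.sum_le_sum_of_subset_of_nonneg ?_ fun x _ _ => Finset.prod_nonneg fun v _ => hu0 _
        intro x hx
        rw [Fintype.mem_piFinset]
        intro v
        exact Finset.mem_biUnion.2 ⟨x, hx, Finset.mem_image_of_mem _ (Finset.mem_univ v)⟩
    _ = (∑ x ∈ X, u x) ^ Fintype.card V := by
        rw [← Finset.prod_univ_sum, Finset.prod_const, Finset.card_univ]
    _ ≤ _ := by
        gcongr
        · exact Finset.sum_nonneg fun x _ => hu0 x
        · exact hsum.sum_le_tsum X fun x _ => hu0 x

/-- configurations whose profile has prescribed counts -/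
theorem card_typeClass (α β : D → B) (N : B → ℕ) (X : Finset (B × (B → ℕ)))
    (c : B × (B → ℕ) → ℕ) (hc : ∑ x ∈ X, c x = Fintype.card V)
    (hcN : ∀ a, ∑ x ∈ X with x.1 = a, c x = N a)
    (hck : ∀ a b, ∑ x ∈ X with x.1 = a, x.2 b * c x = kk α β a b) :
    #{zf ∈ stubConf V α N | (∀ v, prof β zf.1 zf.2 v ∈ X) ∧
        ∀ x ∈ X, #{v | prof β zf.1 zf.2 v = x} = c x} *
      ((∏ x ∈ X, (c x).factorial) * ∏ x ∈ X, (∏ b, (x.2 b).factorial) ^ c x) =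
      (Fintype.card V).factorial * ∏ a, ∏ b, (kk α β a b).factorial := by
  classical
  have key := count_fun (P := V) (R := X) (S := Unit) (fun _ => ()) (fun _ => ()) (fun r => c r.1)
    (by intro s; simp only [filter_true, card_univ]; rw [← hc]; exact (Finset.sum_coe_sort X c).symm)
  simp only [implies_true, true_and, Fintype.univ_unit, prod_singleton, filter_true,
    card_univ] at key
  rw [← key]
  set Y : Finset (V → X) := {y | ∀ r : X, #{v | y v = r} = c r.1} with hY
  set T : Finset (V → B × (B → ℕ)) := Y.image (fun y v => (y v).1) with hT
  have hTc : #T = #Y := Finset.card_image_of_injective _ (by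
    intro y y' h
    funext v
    exact Subtype.ext (congrFun h v))
  have hTmem : ∀ x : V → B × (B → ℕ), x ∈ T ↔ (∀ v, x v ∈ X) ∧ ∀ r ∈ X, #{v | x v = r} = c r := by
    intro x
    rw [hT, Finset.mem_image]
    constructor
    · rintro ⟨y, hy, rfl⟩
      refine ⟨fun v => (y v).2, fun r hr => ?_⟩
      rw [← (Finset.mem_filter.1 hy).2 ⟨r, hr⟩]
      simp [Subtype.ext_iff]
    · rintro ⟨h1, h2⟩
      refine ⟨fun v => ⟨x v, h1 v⟩, Finset.mem_filter.2 ⟨Finset.mem_univ _, fun r => ?_⟩, rfl⟩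
      rw [← h2 r.1 r.2]
      simp [Subtype.ext_iff]
  have hprod : ∏ r : X, (c r.1).factorial = ∏ x ∈ X, (c x).factorial :=
    Finset.prod_coe_sort X fun x => (c x).factorial
  rw [hprod, ← hTc, Finset.card_eq_sum_card_fiberwise
    (f := fun zf : (V → B) × (D → V) => prof β zf.1 zf.2) (t := T)]
  · have hsumT : ∀ x ∈ T, ∀ g : B × (B → ℕ) → ℕ, ∑ v, g (x v) = ∑ r ∈ X, c r * g r := by
      intro x hx g
      obtain ⟨h1, h2⟩ := (hTmem x).1 hx
      rw [← Finset.sum_fiberwise_of_maps_to (s := univ) (t := X) (g := x) (fun v _ => h1 v)]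
      refine Finset.sum_congr rfl fun r hr => ?_
      rw [← h2 r hr, ← smul_eq_mul, ← Finset.sum_const]
      refine Finset.sum_congr rfl fun v hv => ?_
      rw [(Finset.mem_filter.1 hv).2]
    have hterm : ∀ x ∈ T, #{zf ∈ {zf ∈ stubConf V α N | (∀ v, prof β zf.1 zf.2 v ∈ X) ∧
        ∀ x ∈ X, #{v | prof β zf.1 zf.2 v = x} = c x} | prof β zf.1 zf.2 = x} *
        ∏ x ∈ X, (∏ b, (x.2 b).factorial) ^ c x = ∏ a, ∏ b, (kk α β a b).factorial := by
      intro x hx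
      obtain ⟨h1, h2⟩ := (hTmem x).1 hx
      have hN : ∀ a, #{v | (x v).1 = a} = N a := by
        intro a
        have := hsumT x hx (fun r => if r.1 = a then 1 else 0)
        rw [← hcN a, Finset.sum_filter, Finset.card_filter, this]
        simp
      have hk : ∀ a b, ∑ v with (x v).1 = a, (x v).2 b = kk α β a b := by
        intro a b
        have := hsumT x hx (fun r => if r.1 = a then r.2 b else 0)
        rw [← hck a b, Finset.sum_filter, Finset.sum_filter, this]
        refine Finset.sum_congr rfl fun r _ => ?_
        split_ifs <;> ring
      have e1 : ({zf ∈ {zf ∈ stubConf V α N | (∀ v, prof β zf.1 zf.2 v ∈ X) ∧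
        ∀ x ∈ X, #{v | prof β zf.1 zf.2 v = x} = c x} | prof β zf.1 zf.2 = x} :
          Finset ((V → B) × (D → V))) = {zf ∈ stubConf V α N | prof β zf.1 zf.2 = x} := by
        ext zf
        simp only [Finset.mem_filter]
        constructor
        · rintro ⟨⟨h3, h4⟩, h5⟩; exact ⟨h3, h5⟩
        · rintro ⟨h3, h5⟩
          refine ⟨⟨h3, ?_⟩, h5⟩
          rw [h5]; exact ⟨h1, h2⟩
      rw [e1, prof_fiber α β N x hN, ← count_f α β x hk]
      congr 1
      rw [← Finset.prod_fiberwise_of_maps_to (s := univ) (t := X) (g := x) (fun v _ => h1 v)]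
      refine Finset.prod_congr rfl fun r hr => ?_
      rw [← h2 r hr, ← Finset.prod_const]
      refine Finset.prod_congr rfl fun v hv => ?_
      rw [(Finset.mem_filter.1 hv).2]
    rw [mul_comm (∏ x ∈ X, (c x).factorial), ← mul_assoc, Finset.sum_mul,
      Finset.sum_congr rfl hterm, Finset.sum_const, smul_eq_mul]
    ring
  · intro zf hzf
    have := (Finset.mem_filter.1 hzf).2
    exact (hTmem _).2 this
end counts

/-! ### Part 3 -/

section swaps
variable {V D : Type*} [Fintype V] [DecidableEq V] [Fintype D] [DecidableEq D]

/-- ordered endpoints of the edge carried by stub `d` -/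
def FF (τ : D → D) (f : D → V) (d : D) : V × V := (f d, f (τ d))

/-- stubs involved in loops or multiple edges -/
def Bad (τ : D → D) (f : D → V) : Finset D := {d | ∃ d', d' ≠ d ∧ FF τ f d' = FF τ f d}

/-- stubs in the same class as `d` -/
def cls (α β : D → B) (d : D) : Finset D := {e | α e = α d ∧ β e = β d}

theorem swap_bound {Z : Type*} [DecidableEq Z] (P : Z → (D → V) → Prop) [∀ z f, Decidable (P z f)]
    (Q : Z → (D → V) → D → Prop) [∀ z f d, Decidable (Q z f d)]
    (S : Finset (Z × (D → V))) (E ex : Finset D) (d0 : D)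
    (hS : ∀ zf ∈ S, ∀ e ∈ E, (zf.1, zf.2 ∘ Equiv.swap d0 e) ∈ S)
    (hPQ : ∀ zf ∈ S, ∀ e ∈ E, e ∉ ex → P zf.1 zf.2 → Q zf.1 (zf.2 ∘ Equiv.swap d0 e) e) :
    #E * #{zf ∈ S | P zf.1 zf.2} ≤ (∑ zf ∈ S, #{e ∈ E | Q zf.1 zf.2 e})
      + #ex * #{zf ∈ S | P zf.1 zf.2} := by
  have h1 : #(E \ ex) * #{zf ∈ S | P zf.1 zf.2} ≤ ∑ zf ∈ S, #{e ∈ E | Q zf.1 zf.2 e} := by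
    rw [← Finset.card_product, ← Finset.card_sigma]
    refine Finset.card_le_card_of_injOn
      (fun x => ⟨(x.2.1, x.2.2 ∘ Equiv.swap d0 x.1), x.1⟩) ?_ ?_
    · rintro ⟨e, z, f⟩ h
      simp only [coe_product, coe_sdiff, Set.mem_prod, Set.mem_sdiff, mem_coe, mem_filter] at h
      obtain ⟨⟨he, hex⟩, hzf, hP⟩ := h
      simp only [coe_sigma, Set.mem_sigma_iff, mem_coe, mem_filter]
      exact ⟨hS _ hzf e he, he, hPQ _ hzf e he hex hP⟩
    · rintro ⟨e, z, f⟩ h ⟨e', z', f'⟩ h' heq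
      simp only [Sigma.mk.injEq, Prod.mk.injEq, heq_eq_eq] at heq
      obtain ⟨⟨h1, h2⟩, h3⟩ := heq
      subst h3; subst h1
      have : f = f' := by
        funext d
        have := congrFun h2 (Equiv.swap d0 e d)
        simpa using this
      rw [this]
  have h2 : #E ≤ #(E \ ex) + #ex := by
    have := Finset.le_card_sdiff ex E
    omega
  calc #E * #{zf ∈ S | P zf.1 zf.2} ≤ (#(E \ ex) + #ex) * #{zf ∈ S | P zf.1 zf.2} := by gcongr
    _ ≤ _ := by rw [add_mul]; gcongr

theorem bad_one (τ : D → D) (hτ : ∀ d, τ (τ d) = d) (hτ' : ∀ d, τ d ≠ d) (α β : D → B)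
    (hβ : ∀ d, β d = α (τ d))
    (S : Finset ((V → B) × (D → V))) (K : ℕ)
    (hval : ∀ zf ∈ S, ∀ d, zf.1 (zf.2 d) = α d)
    (hS : ∀ zf ∈ S, ∀ d, ∀ e ∈ cls α β d, (zf.1, zf.2 ∘ Equiv.swap d e) ∈ S)
    (hK : ∀ zf ∈ S, ∀ d, #{e ∈ cls α β d | zf.2 e = zf.2 d} ≤ K) (d : D) :
    #(cls α β d) * #{zf ∈ S | d ∈ Bad τ zf.2} ≤ (K * K + 5 * K + 2) * #S := by
  have hαβ : ∀ d, α d = β (τ d) := fun d => by rw [hβ, hτ]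
  have hcard : #(cls α β (τ d)) = #(cls α β d) := by
    refine Finset.card_bij' (fun e _ => τ e) (fun e _ => τ e) ?_ ?_ ?_ ?_
    · intro e he
      simp only [cls, mem_filter, mem_univ, true_and] at he ⊢
      rw [← hβ, ← hαβ, he.2, he.1, ← hαβ, ← hβ]; simp
    · intro e he
      simp only [cls, mem_filter, mem_univ, true_and] at he ⊢
      rw [← hβ, ← hαβ, he.2, he.1, ← hαβ, ← hβ]; simp
    · intro e he; simp [hτ]
    · intro e he; simp [hτ]
  -- loops
  have hloop : #(cls α β d) * #{zf ∈ S | zf.2 d = zf.2 (τ d)} ≤ K * #S + 2 * #S := by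
    have := swap_bound (fun z f => f d = f (τ d)) (fun z f e => f e = f d) S (cls α β (τ d))
      {d, τ d} (τ d) (fun zf h e he => hS zf h _ e he) (by
        intro zf hzf e he hex hP
        simp only [mem_insert, mem_singleton, not_or] at hex
        simp only [Function.comp]
        rw [Equiv.swap_apply_right, Equiv.swap_apply_of_ne_of_ne (hτ' d).symm (Ne.symm hex.1)]
        exact hP.symm)
    rw [hcard] at this
    refine this.trans (add_le_add ?_ ?_)
    · rw [mul_comm, ← smul_eq_mul]
      refine Finset.sum_le_card_nsmul _ _ _ fun zf hzf => ?_
      by_cases hh : α (τ d) = α d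
      · have hc : cls α β (τ d) = cls α β d := by
          unfold cls; rw [← hαβ, ← hβ, hβ, hh]
        rw [hc]; exact hK zf hzf d
      · rw [Finset.filter_false_of_mem, card_empty]; omega
        intro e he h
        simp only [cls, mem_filter, mem_univ, true_and] at he
        apply hh
        rw [← he.1, ← hval zf hzf, ← hval zf hzf d, h]
    · exact Nat.mul_le_mul (Finset.card_le_two) (Finset.card_filter_le _ _)
  -- multi-edges
  have hmul : ∑ d' ∈ (cls α β d).erase d |>.erase (τ d), #(cls α β d) * #{zf ∈ S | FF τ zf.2 d' = FF τ zf.2 d}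
      ≤ K * K * #S + 4 * K * #S := by
    have h1 : ∀ d' ∈ (cls α β d).erase d |>.erase (τ d),
        #(cls α β d) * #{zf ∈ S | FF τ zf.2 d' = FF τ zf.2 d} ≤
        (∑ zf ∈ S, #{e ∈ cls α β (τ d) | zf.2 d' = zf.2 d ∧ zf.2 e = zf.2 (τ d)})
         + 4 * #{zf ∈ S | zf.2 d' = zf.2 d} := by
      intro d' hd'
      simp only [mem_erase, cls, mem_filter, mem_univ, true_and] at hd'
      obtain ⟨hd1, hd2, hd3, hd4⟩ := hd'
      have h5 : τ d' ≠ τ d := fun h => hd2 (by rw [← hτ d', h, hτ])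
      have h6 : τ d' ≠ d := fun h => hd1 (by rw [← h, hτ])
      have hc : cls α β (τ d') = cls α β (τ d) := by
        unfold cls; rw [← hαβ, ← hβ, ← hαβ, ← hβ, hd3, hd4]
      have := swap_bound (fun z f => FF τ f d' = FF τ f d) (fun z f e => f d' = f d ∧ f e = f (τ d))
        S (cls α β (τ d)) {τ d', d, d', τ d} (τ d')
        (fun zf h e he => hS zf h _ e (by rw [hc]; exact he)) (by
          intro zf hzf e he hex hP
          simp only [mem_insert, mem_singleton, not_or] at hex
          obtain ⟨e1, e2, e3, e4⟩ := hex
          simp only [FF, Prod.mk.injEq] at hP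
          simp only [Function.comp]
          rw [Equiv.swap_apply_right, Equiv.swap_apply_of_ne_of_ne (Ne.symm h6) (Ne.symm e2),
            Equiv.swap_apply_of_ne_of_ne (hτ' d').symm (Ne.symm e3),
            Equiv.swap_apply_of_ne_of_ne (Ne.symm h5) (Ne.symm e4)]
          exact hP)
      rw [hcard] at this
      refine this.trans (add_le_add le_rfl ?_)
      refine Nat.mul_le_mul (Finset.card_le_four) (Finset.card_le_card ?_)
      intro zf
      simp only [mem_filter, FF, Prod.mk.injEq]
      tauto
    refine (Finset.sum_le_sum h1).trans ?_
    rw [Finset.sum_add_distrib]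
    refine add_le_add ?_ ?_
    · rw [Finset.sum_comm, mul_comm _ (#S), ← smul_eq_mul]
      refine Finset.sum_le_card_nsmul _ _ _ fun zf hzf => ?_
      calc _ = ∑ d' ∈ (cls α β d).erase d |>.erase (τ d), if zf.2 d' = zf.2 d then #{e ∈ cls α β (τ d) | zf.2 e = zf.2 (τ d)} else 0 := by
            refine Finset.sum_congr rfl fun d' _ => ?_
            split_ifs with h <;> simp [h]
        _ ≤ ∑ d' ∈ cls α β d, if zf.2 d' = zf.2 d then #{e ∈ cls α β (τ d) | zf.2 e = zf.2 (τ d)} else 0 := by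
            refine Finset.sum_le_sum_of_subset ?_
            exact (Finset.erase_subset _ _).trans (Finset.erase_subset _ _)
        _ = #{d' ∈ cls α β d | zf.2 d' = zf.2 d} * #{e ∈ cls α β (τ d) | zf.2 e = zf.2 (τ d)} := by
            rw [← Finset.sum_filter]; simp
        _ ≤ K * K := Nat.mul_le_mul (hK _ hzf _) (hK _ hzf _)
    · rw [← Finset.mul_sum, mul_assoc]
      refine Nat.mul_le_mul le_rfl ?_
      calc _ ≤ ∑ d' ∈ cls α β d, #{zf ∈ S | zf.2 d' = zf.2 d} := by
            refine Finset.sum_le_sum_of_subset ?_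
            exact (Finset.erase_subset _ _).trans (Finset.erase_subset _ _)
        _ = ∑ zf ∈ S, #{d' ∈ cls α β d | zf.2 d' = zf.2 d} := by
            simp only [Finset.card_filter]; rw [Finset.sum_comm]
        _ ≤ _ := by
            rw [mul_comm, ← smul_eq_mul]
            exact Finset.sum_le_card_nsmul _ _ _ fun zf hzf => hK zf hzf d
  have hsub : #{zf ∈ S | d ∈ Bad τ zf.2} ≤ #{zf ∈ S | zf.2 d = zf.2 (τ d)} +
      ∑ d' ∈ (cls α β d).erase d |>.erase (τ d), #{zf ∈ S | FF τ zf.2 d' = FF τ zf.2 d} := by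
    refine le_trans ?_ (add_le_add le_rfl Finset.card_biUnion_le)
    refine le_trans (Finset.card_le_card ?_) (Finset.card_union_le _ _)
    rintro ⟨z, f⟩
    simp only [Bad, mem_filter, mem_univ, true_and, mem_union, mem_biUnion, mem_erase, cls]
    rintro ⟨hzf, d', hne, hd'⟩
    have hd'2 := hd'
    simp only [FF, Prod.mk.injEq] at hd'2
    by_cases h : d' = τ d
    · left; subst h; exact ⟨hzf, hd'2.1.symm⟩
    · right
      refine ⟨d', ⟨h, hne, ?_, ?_⟩, hzf, hd'⟩
      · rw [← hval _ hzf, ← hval _ hzf d]; simp [hd'2.1]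
      · rw [hβ, hβ, ← hval _ hzf, ← hval _ hzf (τ d)]; simp [hd'2.2]
  rw [← Finset.mul_sum] at hmul
  calc _ ≤ #(cls α β d) * (#{zf ∈ S | zf.2 d = zf.2 (τ d)} +
      ∑ d' ∈ (cls α β d).erase d |>.erase (τ d), #{zf ∈ S | FF τ zf.2 d' = FF τ zf.2 d}) := by gcongr
    _ ≤ (K * #S + 2 * #S) + (K * K * #S + 4 * K * #S) := by rw [mul_add]; exact add_le_add hloop hmul
    _ = _ := by ring

theorem bad_sum (τ : D → D) (hτ : ∀ d, τ (τ d) = d) (hτ' : ∀ d, τ d ≠ d) (α β : D → B)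
    (hβ : ∀ d, β d = α (τ d))
    (S : Finset ((V → B) × (D → V))) (K : ℕ)
    (hval : ∀ zf ∈ S, ∀ d, zf.1 (zf.2 d) = α d)
    (hS : ∀ zf ∈ S, ∀ d, ∀ e ∈ cls α β d, (zf.1, zf.2 ∘ Equiv.swap d e) ∈ S)
    (hK : ∀ zf ∈ S, ∀ d, #{e ∈ cls α β d | zf.2 e = zf.2 d} ≤ K) :
    ∑ zf ∈ S, #(Bad τ zf.2) ≤ Fintype.card B ^ 2 * (K * K + 5 * K + 2) * #S := by
  have h1 : ∑ zf ∈ S, #(Bad τ zf.2) = ∑ d, #{zf ∈ S | d ∈ Bad τ zf.2} := by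
    simp only [Finset.card_filter]
    rw [Finset.sum_comm]
    refine Finset.sum_congr rfl fun zf _ => ?_
    simp
  rw [h1, ← Finset.sum_fiberwise (s := univ) (g := fun d => (α d, β d))]
  have h2 : ∀ ab : B × B, ∑ d with (α d, β d) = ab, #{zf ∈ S | d ∈ Bad τ zf.2} ≤ (K * K + 5 * K + 2) * #S := by
    intro ab
    rcases Finset.eq_empty_or_nonempty ({d | (α d, β d) = ab} : Finset D) with he | ⟨d0, hd0⟩
    · rw [he]; simp
    simp only [mem_filter, mem_univ, true_and] at hd0
    have hcl : ∀ d ∈ ({d | (α d, β d) = ab} : Finset D), cls α β d = ({d | (α d, β d) = ab} : Finset D) := by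
      intro d hd
      simp only [mem_filter, mem_univ, true_and] at hd
      unfold cls
      ext e
      rw [← hd]
      simp
    have hpos : 0 < #({d | (α d, β d) = ab} : Finset D) := Finset.card_pos.2 ⟨d0, by simp [hd0]⟩
    refine Nat.le_of_mul_le_mul_left ?_ hpos
    rw [Finset.mul_sum]
    rw [← smul_eq_mul (a := #({d | (α d, β d) = ab} : Finset D)) (b := (K * K + 5 * K + 2) * #S)]
    refine Finset.sum_le_card_nsmul _ _ _ fun d hd => ?_
    have := bad_one τ hτ hτ' α β hβ S K hval hS hK d
    rwa [hcl d hd] at this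
  refine (Finset.sum_le_sum fun ab _ => h2 ab).trans ?_
  simp only [sum_const, card_univ, Fintype.card_prod, smul_eq_mul]
  apply le_of_eq; ring

theorem bad_markov (τ : D → D) (hτ : ∀ d, τ (τ d) = d) (hτ' : ∀ d, τ d ≠ d) (α β : D → B)
    (hβ : ∀ d, β d = α (τ d))
    (S : Finset ((V → B) × (D → V))) (K : ℕ)
    (hval : ∀ zf ∈ S, ∀ d, zf.1 (zf.2 d) = α d)
    (hS : ∀ zf ∈ S, ∀ d, ∀ e ∈ cls α β d, (zf.1, zf.2 ∘ Equiv.swap d e) ∈ S)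
    (hK : ∀ zf ∈ S, ∀ d, #{e ∈ cls α β d | zf.2 e = zf.2 d} ≤ K) :
    #S ≤ 2 * #{zf ∈ S | #(Bad τ zf.2) ≤ 2 * (Fintype.card B ^ 2 * (K * K + 5 * K + 2))} := by
  have h := bad_sum τ hτ hτ' α β hβ S K hval hS hK
  set C := Fintype.card B ^ 2 * (K * K + 5 * K + 2)
  have h1 := Finset.card_filter_add_card_filter_not (s := S) (p := fun zf : (V → B) × (D → V) => #(Bad τ zf.2) ≤ 2 * C)
  have h2 : (2 * C + 1) * #{zf ∈ S | ¬ #(Bad τ zf.2) ≤ 2 * C} ≤ C * #S := by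
    refine le_trans ?_ h
    refine le_trans ?_ (Finset.sum_le_sum_of_subset (Finset.filter_subset (fun zf : (V → B) × (D → V) => ¬ #(Bad τ zf.2) ≤ 2 * C) S))
    rw [mul_comm, ← smul_eq_mul]
    refine Finset.card_nsmul_le_sum _ _ _ fun zf hzf => ?_
    have := (Finset.mem_filter.1 hzf).2
    omega
  nlinarith

theorem FF_tau (τ : D → D) (hτ : ∀ d, τ (τ d) = d) (f : D → V) (d : D) :
    FF τ f (τ d) = (FF τ f d).swap := by simp [FF, hτ]

theorem repair (τ : D → D) (hτ : ∀ d, τ (τ d) = d) (hτ' : ∀ d, τ d ≠ d) (α : D → B)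
    (z : V → B) (N : B → ℕ) (hz : ∀ a, #{v | z v = a} = N a)
    (hN : ∀ a b, N a + Fintype.card D < N a * N b) :
    ∀ (m : ℕ) (G : Finset D) (f : D → V), #(Gᶜ) ≤ m → (∀ d ∈ G, τ d ∈ G) →
      (∀ d, z (f d) = α d) → Set.InjOn (FF τ f) G →
      ∃ f' : D → V, (∀ d, z (f' d) = α d) ∧ Function.Injective (FF τ f') ∧ ∀ d ∈ G, f' d = f d := by
  intro m
  induction m with
  | zero =>
    intro G f hG hGτ hf hinj
    have : G = univ := by
      rw [← Finset.compl_eq_empty_iff, ← Finset.card_eq_zero]; omega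
    subst this
    exact ⟨f, hf, by simpa [Set.injOn_univ] using hinj, fun _ _ => rfl⟩
  | succ m ih =>
    intro G f hG hGτ hf hinj
    by_cases hGu : G = univ
    · exact ih G f (by rw [hGu]; simp) hGτ hf hinj
    obtain ⟨d, hd⟩ : ∃ d, d ∉ G := by
      by_contra hcon
      push Not at hcon
      exact hGu (Finset.eq_univ_iff_forall.2 hcon)
    have hτd : τ d ∉ G := fun h => hd (by rw [← hτ d]; exact hGτ _ h)
    -- choose the pair
    obtain ⟨v, w, hv, hw, hvw, hnot⟩ : ∃ v w, z v = α d ∧ z w = α (τ d) ∧ v ≠ w ∧ ∀ e ∈ G, FF τ f e ≠ (v, w) := by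
      by_contra hcon
      push Not at hcon
      have hsub : ({v | z v = α d} : Finset V) ×ˢ ({v | z v = α (τ d)} : Finset V) ⊆
          (({v | z v = α d} : Finset V).image fun v => (v, v)) ∪ univ.image (FF τ f) := by
        rintro ⟨v, w⟩ hvw
        simp only [mem_product, mem_filter, mem_univ, true_and] at hvw
        simp only [mem_union, mem_image, mem_filter, mem_univ, true_and, Prod.mk.injEq]
        by_cases hh : v = w
        · left; exact ⟨v, hvw.1, rfl, hh⟩
        · right
          obtain ⟨e, _, he⟩ := hcon v w hvw.1 hvw.2 hh
          exact ⟨e, he⟩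
      have h1 := (Finset.card_le_card hsub).trans (Finset.card_union_le _ _)
      rw [Finset.card_product, hz, hz] at h1
      have h2 : #(({v | z v = α d} : Finset V).image fun v => (v, v)) ≤ N (α d) :=
        Finset.card_image_le.trans (hz _).le
      have h3 : #(univ.image (FF τ f)) ≤ Fintype.card D := Finset.card_image_le.trans (by simp)
      have := hN (α d) (α (τ d))
      omega
    set f1 : D → V := Function.update (Function.update f d v) (τ d) w with hf1
    have f1d : f1 d = v := by simp [hf1, Function.update_of_ne (hτ' d).symm]
    have f1t : f1 (τ d) = w := by simp [hf1]
    have f1o : ∀ e, e ≠ d → e ≠ τ d → f1 e = f e := by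
      intro e h1 h2; simp [hf1, h1, h2]
    have f1G : ∀ e ∈ G, f1 e = f e := fun e he =>
      f1o e (fun h => hd (h ▸ he)) (fun h => hτd (h ▸ he))
    have FFG : ∀ e ∈ G, FF τ f1 e = FF τ f e := by
      intro e he; simp [FF, f1G e he, f1G _ (hGτ e he)]
    have FFd : FF τ f1 d = (v, w) := by simp [FF, f1d, f1t]
    have FFt : FF τ f1 (τ d) = (w, v) := by simp [FF_tau τ hτ, FFd]
    have hnot' : ∀ e ∈ G, FF τ f e ≠ (w, v) := by
      intro e he h
      apply hnot (τ e) (hGτ e he)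
      rw [FF_tau τ hτ, h]; rfl
    obtain ⟨f', h1, h2, h3⟩ := ih (insert d (insert (τ d) G)) f1 (by
        have h1 : #((insert d (insert (τ d) G))ᶜ) < #(Gᶜ) := by
          apply Finset.card_lt_card
          rw [Finset.ssubset_iff_of_subset]
          · exact ⟨d, by simp [hd], by simp⟩
          · intro e; simp +contextual
        omega) (by
        intro e he
        simp only [mem_insert] at he ⊢
        rcases he with rfl | rfl | he
        · simp
        · simp [hτ]
        · right; right; exact hGτ e he) (by
        intro e
        by_cases h1 : e = d
        · subst h1; rw [f1d, hv]
        by_cases h2 : e = τ d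
        · subst h2; rw [f1t, hw]
        · rw [f1o e h1 h2, hf]) (by
        intro e he e' he' heq
        simp only [coe_insert, Set.mem_insert_iff, mem_coe] at he he'
        rcases he with rfl | rfl | he <;> rcases he' with rfl | rfl | he'
        · rfl
        · rw [FFd, FFt] at heq; simp at heq; exact absurd heq.1 hvw
        · rw [FFd, FFG _ he'] at heq; exact absurd heq.symm (hnot _ he')
        · rw [FFd, FFt] at heq; simp at heq; exact absurd heq.2 hvw
        · rfl
        · rw [FFt, FFG _ he'] at heq; exact absurd heq.symm (hnot' _ he')
        · rw [FFd, FFG _ he] at heq; exact absurd heq (hnot _ he)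
        · rw [FFt, FFG _ he] at heq; exact absurd heq (hnot' _ he)
        · rw [FFG _ he, FFG _ he'] at heq; exact hinj he he' heq)
    refine ⟨f', h1, h2, fun e he => ?_⟩
    rw [h3 e (by simp [he]), f1G e he]

theorem hamming_ball (g : D → V) (C : ℕ) :
    #{f : D → V | hammingDist f g ≤ C} ≤ (1 + Fintype.card D * Fintype.card V) ^ C := by
  induction C with
  | zero => simp [Finset.filter_eq']
  | succ C ih =>
    have hsub : ({f : D → V | hammingDist f g ≤ C + 1} : Finset (D → V)) ⊆
        ({f : D → V | hammingDist f g ≤ C} : Finset (D → V)).biUnion fun h =>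
          insert h (univ.image fun dv : D × V => Function.update h dv.1 dv.2) := by
      intro f hf
      simp only [mem_filter, mem_univ, true_and, mem_biUnion, mem_insert, mem_image] at hf ⊢
      by_cases hfg : f = g
      · exact ⟨f, by rw [hfg]; simp, Or.inl rfl⟩
      obtain ⟨d, hd⟩ := Function.ne_iff.1 hfg
      refine ⟨Function.update f d (g d), ?_, Or.inr ⟨(d, f d), by simp⟩⟩
      have : hammingDist (Function.update f d (g d)) g < hammingDist f g := by
        unfold hammingDist
        apply Finset.card_lt_card
        rw [Finset.ssubset_iff_of_subset]
        · exact ⟨d, by simp [hd], by simp⟩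
        · intro e
          simp only [mem_filter, mem_univ, true_and]
          by_cases he : e = d
          · subst he; simp
          · simp [he]
      omega
    refine (Finset.card_le_card hsub).trans ?_
    refine (Finset.card_biUnion_le_card_mul _ _ (1 + Fintype.card D * Fintype.card V) ?_).trans ?_
    · intro h _
      refine (Finset.card_insert_le _ _).trans ?_
      have := Finset.card_image_le (s := (univ : Finset (D × V))) (f := fun dv : D × V => Function.update h dv.1 dv.2)
      simp at this
      omega
    · rw [pow_succ]; gcongr

open Classical in
theorem simple_lower (τ : D → D) (hτ : ∀ d, τ (τ d) = d) (hτ' : ∀ d, τ d ≠ d) (α β : D → B)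
    (hβ : ∀ d, β d = α (τ d)) (N : B → ℕ)
    (hN : ∀ a b, N a + Fintype.card D < N a * N b)
    (S : Finset ((V → B) × (D → V))) (K : ℕ) (hSsub : S ⊆ stubConf V α N)
    (hS : ∀ zf ∈ S, ∀ d, ∀ e ∈ cls α β d, (zf.1, zf.2 ∘ Equiv.swap d e) ∈ S)
    (hK : ∀ zf ∈ S, ∀ d, #{e ∈ cls α β d | zf.2 e = zf.2 d} ≤ K) (C : ℕ)
    (hC : C = 2 * (Fintype.card B ^ 2 * (K * K + 5 * K + 2))) :
    #S ≤ 2 * ((1 + Fintype.card D * Fintype.card V) ^ C *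
      #{zf ∈ stubConf V α N | Function.Injective (FF τ zf.2) ∧
        ∃ f, (zf.1, f) ∈ S ∧ hammingDist f zf.2 ≤ C}) := by
  have hval : ∀ zf ∈ S, ∀ d, zf.1 (zf.2 d) = α d := fun zf h => by
    have := hSsub h
    simp only [stubConf, mem_filter, mem_univ, true_and] at this
    exact this.2
  refine (bad_markov τ hτ hτ' α β hβ S K hval hS hK).trans (Nat.mul_le_mul le_rfl ?_)
  rw [← hC]
  have key : ∀ zf ∈ S, #(Bad τ zf.2) ≤ C → ∃ f' : D → V, (∀ d, zf.1 (f' d) = α d) ∧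
      Function.Injective (FF τ f') ∧ hammingDist zf.2 f' ≤ C := by
    intro zf hzf hbad
    have hz : ∀ a, #{v | zf.1 v = a} = N a := by
      have := hSsub hzf
      simp only [stubConf, mem_filter, mem_univ, true_and] at this
      exact this.1
    obtain ⟨f', h1, h2, h3⟩ := repair τ hτ hτ' α zf.1 N hz hN _ (Bad τ zf.2)ᶜ zf.2 le_rfl (by
      intro d hd
      simp only [Bad, mem_compl, mem_filter, mem_univ, true_and, not_exists, not_and] at hd ⊢
      intro d' hne heq
      apply hd (τ d')
      · rintro rfl; rw [hτ] at hne; exact hne rfl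
      · rw [FF_tau τ hτ, heq, FF_tau τ hτ]; simp) (hval zf hzf) (by
      intro d hd d' hd' heq
      simp only [Bad, coe_compl, Set.mem_compl_iff, mem_coe, mem_filter, mem_univ, true_and, not_exists, not_and] at hd
      by_contra hne
      exact hd d' (Ne.symm hne) heq.symm)
    refine ⟨f', h1, h2, le_trans (Finset.card_le_card ?_) hbad⟩
    intro d
    simp only [mem_filter, mem_univ, true_and]
    intro hne
    by_contra hd
    exact hne (h3 d (by simp [hd])).symm
  set T := ({zf ∈ stubConf V α N | Function.Injective (FF τ zf.2) ∧
        ∃ f, (zf.1, f) ∈ S ∧ hammingDist f zf.2 ≤ C} : Finset _)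
  have hsub : ({zf ∈ S | #(Bad τ zf.2) ≤ C} : Finset _) ⊆ T.biUnion fun zf =>
      ({f : D → V | hammingDist f zf.2 ≤ C} : Finset _).image fun f => (zf.1, f) := by
    rintro ⟨z, f⟩ h
    simp only [mem_filter] at h
    obtain ⟨f', h1, h2, h3⟩ := key _ h.1 h.2
    simp only [mem_biUnion, mem_image, mem_filter, mem_univ, true_and, T]
    refine ⟨(z, f'), ⟨?_, h2, f, h.1, h3⟩, f, h3, rfl⟩
    have := hSsub h.1
    simp only [stubConf, mem_filter, mem_univ, true_and] at this ⊢
    exact ⟨this.1, h1⟩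
  refine (Finset.card_le_card hsub).trans ?_
  rw [mul_comm]
  refine Finset.card_biUnion_le_card_mul _ _ _ fun zf _ => ?_
  exact Finset.card_image_le.trans (hamming_ball _ _)

theorem prof_hamming (β : D → B) (z : V → B) (f f' : D → V) (C : ℕ) (h : hammingDist f f' ≤ C) :
    #{v | prof β z f v ≠ prof β z f' v} ≤ 2 * C := by
  have hsub : ({v | prof β z f v ≠ prof β z f' v} : Finset V) ⊆
      ({d | f d ≠ f' d} : Finset D).image f ∪ ({d | f d ≠ f' d} : Finset D).image f' := by
    intro v hv
    simp only [mem_filter, mem_univ, true_and] at hv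
    by_contra hcon
    simp only [mem_union, mem_image, mem_filter, mem_univ, true_and, not_or, not_exists, not_and] at hcon
    apply hv
    unfold prof
    refine Prod.ext rfl (funext fun b => ?_)
    simp only
    congr 1
    ext d
    simp only [mem_filter, mem_univ, true_and, and_congr_left_iff]
    intro _
    by_cases hd : f d = f' d
    · rw [hd]
    · exact ⟨fun h => absurd h (hcon.1 d hd), fun h => absurd h (hcon.2 d hd)⟩
  refine (Finset.card_le_card hsub).trans ((Finset.card_union_le _ _).trans ?_)
  have h1 := Finset.card_image_le (s := ({d | f d ≠ f' d} : Finset D)) (f := f)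
  have h2 := Finset.card_image_le (s := ({d | f d ≠ f' d} : Finset D)) (f := f')
  have : #({d | f d ≠ f' d} : Finset D) ≤ C := h
  omega

end swaps

/-! ### Part 4 -/

section stubs

/-- stubs: for each unordered pair of types `p`, `m p` edges with two ends each -/
abbrev Stub {B : Type*} (m : Sym2 B → ℕ) : Type _ := (Σ p : Sym2 B, Fin (m p)) × Bool

def stubτ {B : Type*} (m : Sym2 B → ℕ) (d : Stub m) : Stub m := (d.1, !d.2)

noncomputable def ori {B : Type*} (p : Sym2 B) : B × B := Quot.out p

theorem ori_eq {B : Type*} (p : Sym2 B) : s((ori p).1, (ori p).2) = p := Quot.out_eq p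

noncomputable def stubα {B : Type*} (m : Sym2 B → ℕ) (d : Stub m) : B :=
  if d.2 then (ori d.1.1).2 else (ori d.1.1).1

noncomputable def stubβ {B : Type*} (m : Sym2 B → ℕ) (d : Stub m) : B := stubα m (stubτ m d)

theorem stubτ_τ {B : Type*} (m : Sym2 B → ℕ) (d : Stub m) : stubτ m (stubτ m d) = d := by
  simp [stubτ]

theorem stubτ_ne {B : Type*} (m : Sym2 B → ℕ) (d : Stub m) : stubτ m d ≠ d := by
  intro h
  have := congrArg Prod.snd h
  simp [stubτ] at this

theorem stub_pair {B : Type*} (m : Sym2 B → ℕ) (d : Stub m) : s(stubα m d, stubβ m d) = d.1.1 := by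
  obtain ⟨i, b⟩ := d
  cases b
  · simp [stubα, stubβ, stubτ, ori_eq]
  · simp [stubα, stubβ, stubτ]; rw [Sym2.eq_swap, ori_eq]

theorem kk_stub (m : Sym2 B → ℕ) (a b : B) :
    kk (stubα m) (stubβ m) a b = if a = b then 2 * m s(a, b) else m s(a, b) := by
  classical
  unfold kk
  have hcard : ∀ p : Sym2 B, #{i : Σ p : Sym2 B, Fin (m p) | i.1 = p} = m p := by
    intro p
    have : ({i : Σ p : Sym2 B, Fin (m p) | i.1 = p} : Finset _) = (univ : Finset (Fin (m p))).map ⟨fun j => ⟨p, j⟩, fun i j h => by simpa using h⟩ := by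
      ext ⟨q, j⟩
      simp only [mem_filter, mem_univ, true_and, Finset.mem_map, Function.Embedding.coeFn_mk]
      constructor
      · rintro rfl; exact ⟨j, rfl⟩
      · rintro ⟨j', h⟩; exact (congrArg Sigma.fst h).symm
    rw [this, card_map]; simp
  split_ifs with hab
  · subst hab
    have : ({d : Stub m | stubα m d = a ∧ stubβ m d = a} : Finset _) =
        ({i : Σ p : Sym2 B, Fin (m p) | i.1 = s(a, a)} : Finset _) ×ˢ (univ : Finset Bool) := by
      ext ⟨i, b⟩
      simp only [mem_filter, mem_univ, true_and, mem_product, and_true]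
      rw [← stub_pair m (i, b)]
      simp only [Sym2.eq_iff, or_self]
    rw [this, card_product, hcard]; simp [mul_comm]
  · rw [← hcard s(a, b)]
    refine Finset.card_bij (fun d _ => d.1) ?_ ?_ ?_
    · rintro d hd
      simp only [mem_filter, mem_univ, true_and] at hd ⊢
      rw [← stub_pair m d, hd.1, hd.2]
    · rintro ⟨i, x⟩ hd ⟨j, y⟩ hd' h
      simp only at h
      subst h
      simp only [mem_filter, mem_univ, true_and] at hd hd'
      by_contra hne
      have hxy : y = !x := by cases x <;> cases y <;> simp_all
      subst hxy
      have : stubβ m (i, x) = stubα m (i, !x) := rfl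
      rw [hd.2, hd'.1] at this
      exact hab this.symm
    · rintro i hi
      simp only [mem_filter, mem_univ, true_and] at hi
      have h1 := stub_pair m (i, false)
      simp only [hi, Sym2.eq_iff] at h1
      rcases h1 with h1 | h1
      · exact ⟨(i, false), by simpa using h1, rfl⟩
      · refine ⟨(i, true), ?_, rfl⟩
        simp only [mem_filter, mem_univ, true_and]
        exact ⟨h1.2, h1.1⟩

variable {V : Type*} [Fintype V] [DecidableEq V]

/-- the edge set of a stub configuration -/
def edges {D V : Type*} [Fintype D] [DecidableEq V] (τ : D → D) (f : D → V) : Finset (Sym2 V) :=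
  univ.image fun d => s(f d, f (τ d))

theorem mem_edges {D : Type*} [Fintype D] (τ : D → D) (hτ : ∀ d, τ (τ d) = d) (f : D → V) (u v : V) :
    s(u, v) ∈ edges τ f ↔ ∃ d, FF τ f d = (u, v) := by
  simp only [edges, mem_image, mem_univ, true_and, FF, Prod.mk.injEq, Sym2.eq_iff]
  constructor
  · rintro ⟨d, h | h⟩
    · exact ⟨d, h⟩
    · exact ⟨τ d, h.2, by rw [hτ]; exact h.1⟩
  · rintro ⟨d, h⟩; exact ⟨d, Or.inl h⟩

theorem nbr_edges {n : ℕ} {D : Type*} [Fintype D] (τ : D → D) (hτ : ∀ d, τ (τ d) = d) (α β : D → B) (hβ : ∀ d, β d = α (τ d))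
    (z : Fin n → B) (f : D → Fin n) (hval : ∀ d, z (f d) = α d) (hinj : Function.Injective (FF τ f)) (v : Fin n) :
    (z v, nbr (z, edges τ f) v) = prof β z f v := by
  unfold prof nbr
  refine Prod.ext rfl (funext fun b => ?_)
  simp only
  symm
  refine Finset.card_bij (fun d _ => f (τ d)) ?_ ?_ ?_
  · intro d hd
    simp only [mem_filter, mem_univ, true_and] at hd ⊢
    refine ⟨by rw [hval, ← hβ, hd.2], ?_⟩
    rw [mem_edges τ hτ]
    exact ⟨τ d, by rw [FF, hτ, hd.1]⟩
  · intro d hd d' hd' h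
    simp only [mem_filter, mem_univ, true_and] at hd hd'
    apply hinj
    simp only [FF, h, hd.1, hd'.1]
  · intro u hu
    simp only [mem_filter, mem_univ, true_and] at hu
    obtain ⟨d, hd⟩ := (mem_edges τ hτ f u v).1 hu.2
    simp only [FF, Prod.mk.injEq] at hd
    refine ⟨τ d, ?_, by rw [hτ, hd.1]⟩
    simp only [mem_filter, mem_univ, true_and]
    exact ⟨hd.2, by rw [hβ, hτ, ← hval, hd.1, hu.1]⟩

/-- admissible combinatorial graphs -/
def admP {V : Type*} [Fintype V] [DecidableEq V] (N : B → ℕ) (m : Sym2 B → ℕ) (c : (V → B) × Finset (Sym2 V)) : Prop :=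
  (∀ e ∈ c.2, ¬ e.IsDiag) ∧ (∀ a, #{v | c.1 v = a} = N a) ∧
    ∀ p, #{e ∈ c.2 | Sym2.map c.1 e = p} = m p

theorem edges_adm (N : B → ℕ) (m : Sym2 B → ℕ) (z : V → B) (f : Stub m → V) (h : (z, f) ∈ stubConf V (stubα m) N)
    (hinj : Function.Injective (FF (stubτ m) f)) : admP N m (z, edges (stubτ m) f) := by
  classical
  simp only [stubConf, mem_filter, mem_univ, true_and] at h
  refine ⟨?_, h.1, ?_⟩
  · intro e he hd
    simp only [edges, mem_image, mem_univ, true_and] at he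
    obtain ⟨d, rfl⟩ := he
    simp only [Sym2.mk_isDiag_iff] at hd
    apply stubτ_ne m d
    apply hinj
    rw [FF_tau _ (stubτ_τ m)]
    simp [FF, hd]
  · intro p
    have hmap : ∀ d, Sym2.map z s(f d, f (stubτ m d)) = d.1.1 := by
      intro d
      rw [Sym2.map_mk, h.2, h.2]
      exact stub_pair m d
    have : ({e ∈ edges (stubτ m) f | Sym2.map z e = p} : Finset _) = (univ : Finset (Fin (m p))).map
        ⟨fun j => s(f (⟨p, j⟩, false), f (⟨p, j⟩, true)), by
          intro i j hij
          simp only [Sym2.eq_iff] at hij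
          rcases hij with hij | hij
          · have : FF (stubτ m) f (⟨p, i⟩, false) = FF (stubτ m) f (⟨p, j⟩, false) := by
              simp [FF, stubτ, hij]
            simpa using hinj this
          · have : FF (stubτ m) f (⟨p, i⟩, false) = FF (stubτ m) f (⟨p, j⟩, true) := by
              simp [FF, stubτ, hij]
            simpa using hinj this⟩ := by
      ext e
      simp only [mem_filter, edges, mem_image, mem_univ, true_and, Finset.mem_map, Function.Embedding.coeFn_mk]
      constructor
      · rintro ⟨⟨⟨⟨q, j⟩, b⟩, rfl⟩, h2⟩
        rw [hmap] at h2
        simp only at h2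
        subst h2
        refine ⟨j, ?_⟩
        cases b
        · rfl
        · rw [Sym2.eq_swap]; rfl
      · rintro ⟨j, rfl⟩
        exact ⟨⟨(⟨p, j⟩, false), rfl⟩, hmap (⟨p, j⟩, false)⟩
    rw [this, card_map]; simp

theorem exists_stub (N : B → ℕ) (m : Sym2 B → ℕ) (c : (V → B) × Finset (Sym2 V)) (h : admP N m c) :
    ∃ f : Stub m → V, (∀ d, c.1 (f d) = stubα m d) ∧ Function.Injective (FF (stubτ m) f) ∧ edges (stubτ m) f = c.2 := by
  classical
  obtain ⟨z, E⟩ := c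
  obtain ⟨hd, hN, hm⟩ := h
  simp only at hd hN hm ⊢
  have he : ∀ p, ∃ g : Fin (m p) ≃ {e // e ∈ E.filter fun e => Sym2.map z e = p}, True := by
    intro p
    exact ⟨(Finset.equivFinOfCardEq (hm p)).symm, trivial⟩
  choose g _ using he
  have hori : ∀ e : Sym2 V, ∃ vw : V × V, s(vw.1, vw.2) = e ∧ (z vw.1, z vw.2) = ori (Sym2.map z e) := by
    intro e
    induction e using Sym2.ind with
    | _ x y =>
      have h1 := ori_eq (Sym2.map z s(x, y))
      rw [Sym2.map_mk, Sym2.eq_iff] at h1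
      rcases h1 with h1 | h1
      · refine ⟨(x, y), rfl, ?_⟩
        rw [Sym2.map_mk]; exact Prod.ext h1.1.symm h1.2.symm
      · refine ⟨(y, x), Sym2.eq_swap, ?_⟩
        rw [Sym2.map_mk]; exact Prod.ext h1.1.symm h1.2.symm
  choose o ho1 ho2 using hori
  let ee : (Σ p : Sym2 B, Fin (m p)) → Sym2 V := fun i => (g i.1 i.2 : Sym2 V)
  have eeE : ∀ i, ee i ∈ E := fun i => (Finset.mem_filter.1 (g i.1 i.2).2).1
  have eem : ∀ i, Sym2.map z (ee i) = i.1 := fun i => (Finset.mem_filter.1 (g i.1 i.2).2).2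
  have eeinj : Function.Injective ee := by
    rintro ⟨p, i⟩ ⟨q, j⟩ hij
    have h1 := eem ⟨p, i⟩
    rw [hij, eem] at h1
    simp only at h1
    subst h1
    have : g q i = g q j := Subtype.ext hij
    rw [(g q).injective this]
  let f : Stub m → V := fun d => if d.2 then (o (ee d.1)).2 else (o (ee d.1)).1
  have hs : ∀ d, s(f d, f (stubτ m d)) = ee d.1 := by
    rintro ⟨i, b⟩
    cases b
    · simp [f, stubτ, ho1]
    · simp only [f, stubτ]; rw [Sym2.eq_swap]; simp [ho1]
  refine ⟨f, ?_, ?_, ?_⟩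
  · rintro ⟨i, b⟩
    have h := ho2 (ee i)
    rw [eem] at h
    cases b
    · simp only [f, stubα]; simpa using congrArg Prod.fst h
    · simp only [f, stubα]; simpa using congrArg Prod.snd h
  · intro d d' hdd
    have h1 : d.1 = d'.1 := by
      apply eeinj
      rw [← hs, ← hs]
      simp only [FF, Prod.mk.injEq] at hdd
      rw [hdd.1, hdd.2]
    by_contra hne
    have h2 : d' = stubτ m d := by
      obtain ⟨i, b⟩ := d
      obtain ⟨j, b'⟩ := d'
      simp only at h1
      subst h1
      simp only [stubτ]
      cases b <;> cases b' <;> simp_all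
    subst h2
    rw [FF_tau _ (stubτ_τ m)] at hdd
    have h3 : f d = f (stubτ m d) := congrArg Prod.fst hdd
    apply hd _ (eeE d.1)
    rw [← hs d, h3]; simp
  · ext e
    simp only [edges, mem_image, mem_univ, true_and]
    constructor
    · rintro ⟨d, rfl⟩; rw [hs]; exact eeE _
    · intro he
      have : e ∈ E.filter fun e' => Sym2.map z e' = Sym2.map z e := by simp [he]
      refine ⟨(⟨Sym2.map z e, (g _).symm ⟨e, this⟩⟩, false), ?_⟩
      rw [hs]
      simp [ee]

/-- symmetries of the stubs -/
def stubG (m : Sym2 B → ℕ) (π : Equiv.Perm (Stub m)) : Prop :=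
  (∀ d, π (stubτ m d) = stubτ m (π d)) ∧ ∀ d, stubα m (π d) = stubα m d

open Classical in
theorem fiber_card (N : B → ℕ) (m : Sym2 B → ℕ) (c : (V → B) × Finset (Sym2 V)) (h : admP N m c) :
    #{f : Stub m → V | (∀ d, c.1 (f d) = stubα m d) ∧ Function.Injective (FF (stubτ m) f) ∧ edges (stubτ m) f = c.2}
      = Nat.card {π // stubG m π} := by
  obtain ⟨f0, h1, h2, h3⟩ := exists_stub N m c h
  have hG : Nat.card {π // stubG m π} = #{π : Equiv.Perm (Stub m) | stubG m π} := by
    rw [Nat.card_eq_fintype_card, Fintype.card_subtype]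
  rw [hG]
  symm
  refine Finset.card_bij (fun π _ => f0 ∘ π) ?_ ?_ ?_
  · intro π hπ
    rw [Finset.mem_filter] at hπ
    replace hπ := hπ.2
    unfold stubG at hπ
    simp only [mem_filter, mem_univ, true_and]
    have hF : FF (stubτ m) (f0 ∘ π) = FF (stubτ m) f0 ∘ π := by
      funext d; simp [FF, hπ.1]
    refine ⟨fun d => by simp [h1, hπ.2], ?_, ?_⟩
    · rw [hF]; exact h2.comp π.injective
    · rw [← h3]
      ext e
      induction e using Sym2.ind with
      | _ x y =>
        rw [mem_edges _ (stubτ_τ m), mem_edges _ (stubτ_τ m), hF]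
        constructor
        · rintro ⟨d, hd⟩; exact ⟨π d, hd⟩
        · rintro ⟨d, hd⟩; exact ⟨π.symm d, by simpa using hd⟩
  · intro π hπ π' hπ' heq
    rw [Finset.mem_filter] at hπ hπ'
    replace hπ := hπ.2
    replace hπ' := hπ'.2
    unfold stubG at hπ hπ'
    ext1 d
    apply h2
    have e1 := congrFun heq d
    have e2 := congrFun heq (stubτ m d)
    simp only [Function.comp, hπ.1, hπ'.1] at e1 e2
    simp [FF, e1, e2]
  · intro f hf
    simp only [mem_filter, mem_univ, true_and] at hf
    obtain ⟨k1, k2, k3⟩ := hf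
    have hex : ∀ d, ∃ d', FF (stubτ m) f0 d' = FF (stubτ m) f d := by
      intro d
      have : s((FF (stubτ m) f d).1, (FF (stubτ m) f d).2) ∈ edges (stubτ m) f :=
        (mem_edges _ (stubτ_τ m) _ _ _).2 ⟨d, rfl⟩
      rw [k3, ← h3] at this
      exact (mem_edges _ (stubτ_τ m) _ _ _).1 this
    choose π hπ using hex
    have hinj : Function.Injective π := by
      intro d d' hdd
      apply k2
      rw [← hπ, ← hπ, hdd]
    refine ⟨Equiv.ofBijective π (Finite.injective_iff_bijective.1 hinj), ?_, ?_⟩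
    · rw [Finset.mem_filter]
      refine ⟨mem_univ _, ?_⟩
      unfold stubG
      simp only [Equiv.ofBijective_apply]
      constructor
      · intro d
        apply h2
        rw [hπ, FF_tau _ (stubτ_τ m), FF_tau _ (stubτ_τ m), hπ]
      · intro d
        rw [← h1, ← k1]
        exact congrArg c.1 (congrArg Prod.fst (hπ d))
    · funext d
      exact congrArg Prod.fst (hπ d)

theorem stubG_pos (m : Sym2 B → ℕ) : 0 < Nat.card {π // stubG m π} := by
  rw [Nat.card_pos_iff]
  exact ⟨⟨⟨1, by simp [stubG]⟩⟩, inferInstance⟩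

open Classical in
theorem link (N : B → ℕ) (m : Sym2 B → ℕ) (A : (V → B) × Finset (Sym2 V) → Prop) :
    #{zf ∈ stubConf V (stubα m) N | Function.Injective (FF (stubτ m) zf.2) ∧ A (zf.1, edges (stubτ m) zf.2)}
      = Nat.card {π // stubG m π} * #{c : (V → B) × Finset (Sym2 V) | admP N m c ∧ A c} := by
  rw [Finset.card_eq_sum_card_fiberwise (f := fun zf => (zf.1, edges (stubτ m) zf.2))
    (t := {c : (V → B) × Finset (Sym2 V) | admP N m c ∧ A c})]
  · rw [mul_comm, ← smul_eq_mul, ← Finset.sum_const]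
    refine Finset.sum_congr rfl fun c hc => ?_
    simp only [mem_filter, mem_univ, true_and] at hc
    rw [← fiber_card N m c hc.1]
    refine Finset.card_bij (fun zf _ => zf.2) ?_ ?_ ?_
    · rintro ⟨z, f⟩ h
      simp only [mem_filter, mem_univ, true_and, stubConf] at h ⊢
      obtain ⟨⟨⟨h1, h2⟩, h3, h4⟩, rfl⟩ := h
      exact ⟨h2, h3, rfl⟩
    · rintro ⟨z, f⟩ h ⟨z', f'⟩ h' heq
      simp only [mem_filter, mem_univ, true_and] at h h'
      have e1 : z = c.1 := congrArg Prod.fst h.2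
      have e2 : z' = c.1 := congrArg Prod.fst h'.2
      rw [e1, e2]; exact congrArg _ heq
    · intro f hf
      simp only [mem_filter, mem_univ, true_and] at hf
      refine ⟨(c.1, f), ?_, rfl⟩
      simp only [mem_filter, mem_univ, true_and, stubConf]
      rw [hf.2.2]
      exact ⟨⟨⟨hc.1.2.1, hf.1⟩, hf.2.1, hc.2⟩, rfl⟩
  · rintro ⟨z, f⟩ h
    simp only [coe_filter, Set.mem_ofPred_eq, mem_univ, true_and] at h ⊢
    exact ⟨edges_adm N m z f h.1 h.2.1, h.2.2⟩

end stubs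

/-! ### Part 5 -/

section topo
variable {X : Type*} [MeasurableSpace X]

/-- point masses of a probability measure -/
noncomputable def pm (μ : ProbabilityMeasure X) (x : X) : ℝ := ((μ : Measure X) {x}).toReal

theorem pm_nonneg (μ : ProbabilityMeasure X) (x : X) : 0 ≤ pm μ x := ENNReal.toReal_nonneg

theorem pm_ofReal (μ : ProbabilityMeasure X) (x : X) : ENNReal.ofReal (pm μ x) = (μ : Measure X) {x} :=
  ENNReal.ofReal_toReal (measure_ne_top _ _)

theorem pm_eq_nn (μ : ProbabilityMeasure X) (x : X) : pm μ x = ((μ {x} : ℝ≥0) : ℝ) := rfl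

variable [Countable X] [MeasurableSingletonClass X]

theorem measure_set_pm (μ : ProbabilityMeasure X) (s : Set X) :
    (μ : Measure X) s = ∑' x, ENNReal.ofReal (s.indicator (pm μ) x) := by
  classical
  rw [← Measure.tsum_indicator_apply_singleton (μ : Measure X) s (Set.to_countable s).measurableSet]
  refine tsum_congr fun x => ?_
  by_cases hx : x ∈ s
  · simp [hx, pm_ofReal]
  · simp [hx]

theorem summable_pm (μ : ProbabilityMeasure X) : Summable (pm μ) := by
  have h : ∑' x, (μ : Measure X) {x} ≠ ⊤ := by
    have := measure_set_pm μ Set.univ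
    simp only [Set.indicator_univ, pm_ofReal] at this
    rw [← this]; exact measure_ne_top _ _
  exact ENNReal.summable_toReal h

theorem tsum_pm (μ : ProbabilityMeasure X) : ∑' x, pm μ x = 1 := by
  have := measure_set_pm μ Set.univ
  simp only [Set.indicator_univ] at this
  rw [← ENNReal.ofReal_tsum_of_nonneg (pm_nonneg μ) (summable_pm μ)] at this
  simp only [measure_univ] at this
  have h := congrArg ENNReal.toReal this
  rw [ENNReal.toReal_ofReal (tsum_nonneg (pm_nonneg μ))] at h
  simpa using h.symm

theorem pm_le_one (μ : ProbabilityMeasure X) (x : X) : pm μ x ≤ 1 := by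
  rw [← tsum_pm μ]; exact (summable_pm μ).le_tsum x fun _ _ => pm_nonneg μ _

theorem real_set_pm (μ : ProbabilityMeasure X) (s : Set X) :
    ((μ : Measure X) s).toReal = ∑' x, s.indicator (pm μ) x := by
  rw [measure_set_pm, ← ENNReal.ofReal_tsum_of_nonneg _ ((summable_pm μ).indicator s)]
  · rw [ENNReal.toReal_ofReal]
    exact tsum_nonneg fun x => Set.indicator_nonneg (fun x _ => pm_nonneg μ x) x
  · exact fun x => Set.indicator_nonneg (fun x _ => pm_nonneg μ x) x

/-- probability measure from a point mass function -/
theorem exists_pm (p : X → ℝ) (h0 : ∀ x, 0 ≤ p x) (hs : HasSum p 1) :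
    ∃ μ : ProbabilityMeasure X, ∀ x, pm μ x = p x := by
  let m : Measure X := Measure.sum fun x => ENNReal.ofReal (p x) • Measure.dirac x
  have hm : ∀ x, m {x} = ENNReal.ofReal (p x) := fun x =>
    Measure.sum_smul_dirac_singleton
  have : IsProbabilityMeasure m := by
    constructor
    simp only [m, Measure.sum_apply _ MeasurableSet.univ, Measure.smul_apply, measure_univ, smul_eq_mul, mul_one]
    rw [← ENNReal.ofReal_tsum_of_nonneg h0 hs.summable, hs.tsum_eq]; simp
  refine ⟨⟨m, this⟩, fun x => ?_⟩
  exact (congrArg ENNReal.toReal (hm x)).trans (ENNReal.toReal_ofReal (h0 x))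

variable [TopologicalSpace X] [DiscreteTopology X] [BorelSpace X]

theorem continuous_pm (x : X) : Continuous fun μ : ProbabilityMeasure X => pm μ x := by
  rw [continuous_iff_continuousAt]
  intro μ
  have := ProbabilityMeasure.tendsto_measure_of_isClopen_of_tendsto (μ := μ) (μs := id) (L := 𝓝 μ) tendsto_id
    (isClopen_discrete {x})
  exact (NNReal.continuous_coe.tendsto _).comp this

theorem pm_nhds (O : Set (ProbabilityMeasure X)) (hO : IsOpen O) (ν : ProbabilityMeasure X) (hν : ν ∈ O) :
    ∃ S : Finset X, ∃ η > 0, ∀ μ : ProbabilityMeasure X, (∀ x ∈ S, |pm μ x - pm ν x| < η) → μ ∈ O := by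
  classical
  by_contra hcon
  push Not at hcon
  obtain ⟨e, he⟩ := exists_injective_nat X
  -- finite exhausting sets
  have hS : ∀ n : ℕ, (e ⁻¹' Set.Iic n).Finite := fun n =>
    (Set.finite_Iic n).preimage he.injOn
  choose μ hμ1 hμ2 using fun n : ℕ => hcon (hS n).toFinset (1 / ((n : ℝ) + 1)) (by positivity)
  have hlim : Tendsto μ atTop (𝓝 ν) := by
    refine IsPiSystem.tendsto_probabilityMeasure_of_tendsto_of_mem (S := Set.range fun x : X => ({x} : Set X)) ?_ ?_ ?_ ?_
    · rintro _ ⟨x, rfl⟩ _ ⟨y, rfl⟩ h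
      obtain ⟨w, hw1, hw2⟩ := h
      simp only [Set.mem_singleton_iff] at hw1 hw2
      subst hw1; subst hw2
      exact ⟨w, by simp⟩
    · rintro _ ⟨x, rfl⟩; exact measurableSet_singleton x
    · intro u _ x hx
      exact ⟨{x}, ⟨x, rfl⟩, by simp [nhds_discrete], by simpa using hx⟩
    · rintro _ ⟨x, rfl⟩
      rw [← NNReal.tendsto_coe]
      change Tendsto (fun n => pm (μ n) x) atTop (𝓝 (pm ν x))
      rw [tendsto_iff_dist_tendsto_zero]
      refine squeeze_zero' (Eventually.of_forall fun _ => dist_nonneg) ?_ tendsto_one_div_add_atTop_nhds_zero_nat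
      filter_upwards [eventually_ge_atTop (e x)] with n hn
      rw [Real.dist_eq]
      exact (hμ1 n x (by simp [hn])).le
  have := hlim.eventually (hO.mem_nhds hν)
  obtain ⟨n, hn⟩ := this.exists
  exact hμ2 n hn

end topo

section topoB
variable [TopologicalSpace B] [DiscreteTopology B] [BorelSpace B]

/-- compact family of probability measures -/
def Kset (C : ℝ≥0) : Set (ProbabilityMeasure (B × (B → ℕ))) :=
  {μ | ∀ n : ℕ, μ ({x : B × (B → ℕ) | ∀ b, x.2 b ≤ n} : Set (B × (B → ℕ)))ᶜ ≤ C / (n + 1)}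

theorem box_finite (n : ℕ) : (({x : B × (B → ℕ) | ∀ b, x.2 b ≤ n} : Set (B × (B → ℕ)))).Finite := by
  have h : (({x : B × (B → ℕ) | ∀ b, x.2 b ≤ n} : Set (B × (B → ℕ)))) =
    (Set.univ : Set B) ×ˢ (Set.Iic (fun _ => n) : Set (B → ℕ)) := by
    ext x; simp [Pi.le_def]
  rw [h]
  exact Set.finite_univ.prod (Set.finite_Iic _)

theorem isCompact_Kset (C : ℝ≥0) : IsCompact (Kset (B := B) C) := by
  refine isCompact_setOfPred_probabilityMeasure_mass_eq_compl_isCompact_le (u := fun n : ℕ => C / (n + 1)) ?_ ?_ ?_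
  · rw [← NNReal.tendsto_coe]
    push_cast
    have := (tendsto_const_div_atTop_nhds_zero_nat (C : ℝ)).comp (tendsto_add_atTop_nat 1)
    refine this.congr fun n => ?_
    simp
  · intro n; exact (box_finite n).isCompact
  · exact Or.inl inferInstance

end topoB

/-! ### Part 6 -/

section poisson

theorem hasSum_pi {ι : Type*} [Fintype ι] [DecidableEq ι] (g : ι → ℕ → ℝ) (G : ι → ℝ) (h0 : ∀ i k, 0 ≤ g i k)
    (hg : ∀ i, HasSum (g i) (G i)) :
    HasSum (fun σ : ι → ℕ => ∏ i, g i (σ i)) (∏ i, G i) := by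
  have hbox : Tendsto (fun n : ℕ => Fintype.piFinset fun _ : ι => range n) atTop atTop := by
    refine tendsto_atTop_finset_of_monotone ?_ ?_
    · intro m n hmn
      exact Fintype.piFinset_subset _ _ fun _ => Finset.range_mono hmn
    · intro σ
      refine ⟨∑ i, σ i + 1, ?_⟩
      simp only [Fintype.mem_piFinset, mem_range]
      intro i
      have := Finset.single_le_sum (f := σ) (fun _ _ => Nat.zero_le _) (mem_univ i)
      omega
  have hs : ∀ n : ℕ, ∑ σ ∈ Fintype.piFinset (fun _ : ι => range n), ∏ i, g i (σ i) = ∏ i, ∑ k ∈ range n, g i k := by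
    intro n; rw [Finset.prod_univ_sum]
  have hnn : ∀ σ : ι → ℕ, 0 ≤ ∏ i, g i (σ i) := fun σ => Finset.prod_nonneg fun i _ => h0 i _
  have hsum : Summable (fun σ : ι → ℕ => ∏ i, g i (σ i)) := by
    refine summable_of_sum_le (c := ∏ i, G i) hnn fun u => ?_
    obtain ⟨n, hn⟩ := (hbox.eventually (eventually_ge_atTop u)).exists
    calc _ ≤ ∑ σ ∈ Fintype.piFinset (fun _ : ι => range n), ∏ i, g i (σ i) :=
          Finset.sum_le_sum_of_subset_of_nonneg hn fun _ _ _ => hnn _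
      _ = _ := hs n
      _ ≤ _ := Finset.prod_le_prod (fun i _ => Finset.sum_nonneg fun k _ => h0 i k) fun i _ =>
          sum_le_hasSum _ (fun k _ => h0 i k) (hg i)
  have h1 := (hsum.hasSum.comp hbox)
  have h2 : Tendsto (fun n : ℕ => ∏ i, ∑ k ∈ range n, g i k) atTop (𝓝 (∏ i, G i)) :=
    tendsto_finsetProd _ fun i _ => (hg i).tendsto_sum_nat
  have h3 : ∑' σ : ι → ℕ, ∏ i, g i (σ i) = ∏ i, G i := by
    refine tendsto_nhds_unique h1 (h2.congr fun n => ?_)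
    exact (hs n).symm
  rw [← h3]; exact hsum.hasSum

theorem hasSum_exp (r : ℝ) : HasSum (fun k : ℕ => r ^ k / (k.factorial : ℝ)) (Real.exp r) := by
  have := NormedSpace.expSeries_div_hasSum_exp (𝔸 := ℝ) r
  rwa [← Real.exp_eq_exp_ℝ] at this

theorem hasSum_B (F : B × (B → ℕ) → ℝ) (G : B → ℝ) (h : ∀ a, HasSum (fun σ => F (a, σ)) (G a)) :
    HasSum F (∑ a, G a) := by
  have h1 : ∀ a, HasSum (fun x : B × (B → ℕ) => if x.1 = a then F x else 0) (G a) := by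
    intro a
    have hinj : Function.Injective (fun σ : B → ℕ => (a, σ)) := Prod.mk_right_injective a
    rw [← hinj.hasSum_iff]
    · refine (h a).congr_fun ?_ |> fun h => h
      intro σ; simp
    · rintro ⟨a', σ⟩ hx
      have : a' ≠ a := fun h => hx ⟨σ, by rw [h]⟩
      simp [this]
  have := hasSum_sum (s := univ) fun a _ => h1 a
  simpa using this

theorem summable_pois (R : B → B → ℝ) (hR : ∀ a b, 0 ≤ R a b) :
    Summable fun x : B × (B → ℕ) => ∏ b, (R x.1 b ^ x.2 b / ((x.2 b).factorial : ℝ)) := by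
  refine (hasSum_B _ (fun a => ∏ b, Real.exp (R a b)) fun a => ?_).summable
  exact hasSum_pi (fun b k => R a b ^ k / (k.factorial : ℝ)) _ (fun b k => by have := hR a b; positivity) fun b => hasSum_exp _

/-- the point masses of `Qpoi` -/
noncomputable def qq (ϖ : B → ℝ) (ω : B → B → ℝ) (x : B × (B → ℕ)) : ℝ :=
  ϖ x.1 * ∏ b : B, Real.exp (-(ω x.1 b / ϖ x.1)) * (ω x.1 b / ϖ x.1) ^ (x.2 b) / (Nat.factorial (x.2 b))

theorem Qpoi_singleton [MeasurableSingletonClass B] (ϖ : B → ℝ) (ω : B → B → ℝ) (x : B × (B → ℕ)) :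
    Qpoi ϖ ω {x} = ENNReal.ofReal (qq ϖ ω x) := by
  unfold Qpoi
  exact Measure.sum_smul_dirac_singleton (f := fun x => ENNReal.ofReal (qq ϖ ω x))

variable (ϖ : B → ℝ) (ω : B → B → ℝ)

theorem qq_nonneg (hϖ : ∀ a, 0 ≤ ϖ a) (hω : ∀ a b, 0 ≤ ω a b) (x : B × (B → ℕ)) : 0 ≤ qq ϖ ω x := by
  unfold qq
  refine mul_nonneg (hϖ _) (Finset.prod_nonneg fun b _ => ?_)
  have := hϖ x.1
  have := hω x.1 b
  positivity

theorem hasSum_qq (hϖ : ∀ a, 0 ≤ ϖ a) (hω : ∀ a b, 0 ≤ ω a b) : HasSum (qq ϖ ω) (∑ a, ϖ a) := by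
  refine hasSum_B _ _ fun a => ?_
  unfold qq
  have : HasSum (fun σ : B → ℕ => ∏ b : B, Real.exp (-(ω a b / ϖ a)) * (ω a b / ϖ a) ^ (σ b) / (Nat.factorial (σ b) : ℝ)) (∏ b : B, 1) := by
    refine hasSum_pi (fun b k => Real.exp (-(ω a b / ϖ a)) * (ω a b / ϖ a) ^ k / (Nat.factorial k : ℝ)) _ ?_ ?_
    · intro b k
      have := hϖ a
      have := hω a b
      positivity
    · intro b
      have := (hasSum_exp (ω a b / ϖ a)).mul_left (Real.exp (-(ω a b / ϖ a)))
      rw [← Real.exp_add] at this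
      simpa [mul_div_assoc] using this
  simpa using this.mul_left (ϖ a)

theorem hasSum_qq_moment (hϖ : ∀ a, 0 < ϖ a) (hω : ∀ a b, 0 ≤ ω a b) (a b : B) :
    HasSum (fun σ : B → ℕ => (σ b : ℝ) * qq ϖ ω (a, σ)) (ω a b) := by
  unfold qq
  set r := fun b => ω a b / ϖ a with hr
  have hr0 : ∀ b, 0 ≤ r b := fun b => div_nonneg (hω a b) (hϖ a).le
  have key : HasSum (fun k : ℕ => (k : ℝ) * (Real.exp (-(r b)) * (r b) ^ k / (Nat.factorial k : ℝ))) (r b) := by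
    rw [← hasSum_nat_add_iff' 1]
    have h2 := (hasSum_exp (r b)).mul_left (Real.exp (-(r b)) * r b)
    have h3 : Real.exp (-(r b)) * r b * Real.exp (r b) = r b := by
      rw [mul_right_comm, ← Real.exp_add]; simp
    rw [h3] at h2
    simp only [range_one, sum_singleton, Nat.cast_zero, zero_mul, sub_zero]
    refine h2.congr_fun ?_ |> fun h => h
    intro k
    rw [Nat.factorial_succ]
    push_cast
    have : ((k : ℝ) + 1) ≠ 0 := by positivity
    have : (k.factorial : ℝ) ≠ 0 := by positivity
    field_simp
    ring
  have h1 : HasSum (fun σ : B → ℕ => ∏ c : B, ((if c = b then (σ c : ℝ) else 1) * (Real.exp (-(r c)) * (r c) ^ (σ c) / (Nat.factorial (σ c) : ℝ)))) (∏ c : B, (if c = b then r c else 1)) := by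
    refine hasSum_pi (fun c k => (if c = b then (k : ℝ) else 1) * (Real.exp (-(r c)) * (r c) ^ k / (Nat.factorial k : ℝ))) _ ?_ ?_
    · intro c k
      have := hr0 c
      split_ifs <;> positivity
    · intro c
      by_cases hc : c = b
      · subst hc; simpa using key
      · have := (hasSum_exp (r c)).mul_left (Real.exp (-(r c)))
        rw [← Real.exp_add] at this
        simpa [mul_div_assoc, hc] using this
  have h2 := h1.mul_left (ϖ a)
  simp only [Finset.prod_ite_eq', mem_univ, if_true] at h2
  have h3 : ϖ a * r b = ω a b := by
    simp only [hr]; have := (hϖ a).ne'; field_simp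
  rw [h3] at h2
  refine h2.congr_fun ?_ |> fun h => h
  intro σ
  rw [Finset.prod_mul_distrib, Finset.prod_ite_eq']
  simp only [mem_univ, if_true]
  ring

/-- the exponent function -/
def gg (h : B × (B → ℕ) → ℝ) (lam : B → B → ℝ) (κ : B → ℝ) (x : B × (B → ℕ)) : ℝ :=
  h x + κ x.1 + ∑ b, lam x.1 b * x.2 b

theorem exp_gg (h : B × (B → ℕ) → ℝ) (lam : B → B → ℝ) (κ : B → ℝ) (x : B × (B → ℕ)) :
    Real.exp (gg h lam κ x) = Real.exp (h x + κ x.1) * ∏ b, Real.exp (lam x.1 b) ^ x.2 b := by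
  unfold gg
  rw [Real.exp_add, Real.exp_sum]
  congr 1
  refine Finset.prod_congr rfl fun b _ => ?_
  rw [← Real.exp_nat_mul, mul_comm]

theorem qq_exp_le (hϖ : ∀ a, 0 ≤ ϖ a) (hϖ1 : ∀ a, ϖ a ≤ 1) (hω : ∀ a b, 0 ≤ ω a b) (R : B → B → ℝ) (hR : ∀ a b, ω a b / ϖ a ≤ R a b)
    (h : B × (B → ℕ) → ℝ) (lam : B → B → ℝ) (κ : B → ℝ) (H : ℝ) (hH : ∀ x, h x ≤ H) (x : B × (B → ℕ)) :
    qq ϖ ω x * Real.exp (gg h lam κ x) ≤ Real.exp (H + ∑ a, |κ a|) *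
      ∏ b, ((R x.1 b * Real.exp (lam x.1 b)) ^ x.2 b / ((x.2 b).factorial : ℝ)) := by
  have hr0 : ∀ b, 0 ≤ ω x.1 b / ϖ x.1 := fun b => div_nonneg (hω _ b) (hϖ _)
  have h1 : qq ϖ ω x ≤ ∏ b, (R x.1 b ^ x.2 b / ((x.2 b).factorial : ℝ)) := by
    unfold qq
    have h2 : ∏ b : B, Real.exp (-(ω x.1 b / ϖ x.1)) * (ω x.1 b / ϖ x.1) ^ (x.2 b) / (Nat.factorial (x.2 b))
        ≤ ∏ b, (R x.1 b ^ x.2 b / ((x.2 b).factorial : ℝ)) := by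
      refine Finset.prod_le_prod (fun b _ => ?_) fun b _ => ?_
      · have := hr0 b; positivity
      · have h4 := hr0 b
        gcongr
        calc _ ≤ 1 * R x.1 b ^ x.2 b := by
              gcongr
              · exact Real.exp_le_one_iff.2 (by linarith)
              · exact hR _ b
          _ = _ := one_mul _
    calc _ ≤ 1 * ∏ b, (R x.1 b ^ x.2 b / ((x.2 b).factorial : ℝ)) := by
          refine mul_le_mul (hϖ1 _) h2 (Finset.prod_nonneg fun b _ => ?_) zero_le_one
          have := hr0 b; positivity
      _ = _ := one_mul _
  rw [exp_gg]
  have h2 : Real.exp (h x + κ x.1) ≤ Real.exp (H + ∑ a, |κ a|) := by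
    apply Real.exp_le_exp.2
    have := Finset.single_le_sum (f := fun a => |κ a|) (fun a _ => abs_nonneg _) (mem_univ x.1)
    have := le_abs_self (κ x.1)
    have := hH x
    linarith
  have h3 : ∏ b, ((R x.1 b * Real.exp (lam x.1 b)) ^ x.2 b / ((x.2 b).factorial : ℝ)) =
     (∏ b, (R x.1 b ^ x.2 b / ((x.2 b).factorial : ℝ))) * ∏ b, Real.exp (lam x.1 b) ^ x.2 b := by
    rw [← Finset.prod_mul_distrib]
    refine Finset.prod_congr rfl fun b _ => ?_
    rw [mul_pow]; ring
  rw [h3]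
  have h4 : 0 ≤ ∏ b, Real.exp (lam x.1 b) ^ x.2 b := Finset.prod_nonneg fun b _ => by positivity
  have h5 : 0 ≤ ∏ b, (R x.1 b ^ x.2 b / ((x.2 b).factorial : ℝ)) := Finset.prod_nonneg fun b _ => by
    have := (hr0 b).trans (hR x.1 b); positivity
  calc qq ϖ ω x * (Real.exp (h x + κ x.1) * ∏ b, Real.exp (lam x.1 b) ^ x.2 b)
     ≤ (∏ b, (R x.1 b ^ x.2 b / ((x.2 b).factorial : ℝ))) * (Real.exp (H + ∑ a, |κ a|) * ∏ b, Real.exp (lam x.1 b) ^ x.2 b) := by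
        refine mul_le_mul h1 ?_ (by positivity) h5
        exact mul_le_mul_of_nonneg_right h2 h4
    _ = _ := by ring

theorem summable_qq_exp (hϖ : ∀ a, 0 ≤ ϖ a) (hϖ1 : ∀ a, ϖ a ≤ 1) (hω : ∀ a b, 0 ≤ ω a b)
    (h : B × (B → ℕ) → ℝ) (lam : B → B → ℝ) (κ : B → ℝ) (H : ℝ) (hH : ∀ x, h x ≤ H) :
    Summable fun x => qq ϖ ω x * Real.exp (gg h lam κ x) := by
  refine Summable.of_nonneg_of_le (fun x => mul_nonneg (qq_nonneg ϖ ω hϖ hω x) (Real.exp_nonneg _))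
    (qq_exp_le ϖ ω hϖ hϖ1 hω (fun a b => ω a b / ϖ a) (fun a b => le_rfl) h lam κ H hH) ?_
  refine (summable_pois (fun a b => ω a b / ϖ a * Real.exp (lam a b)) fun a b => ?_).mul_left _
  exact mul_nonneg (div_nonneg (hω _ _) (hϖ _)) (Real.exp_nonneg _)

theorem tendsto_qq_exp (ϖn : ℕ → B → ℝ) (ωn : ℕ → B → B → ℝ) (hϖn : ∀ n a, 0 ≤ ϖn n a) (hϖn1 : ∀ n a, ϖn n a ≤ 1)
    (hωn : ∀ n a b, 0 ≤ ωn n a b) (hϖ_lim : ∀ a, Tendsto (fun n => ϖn n a) atTop (𝓝 (ϖ a)))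
    (hω_lim : ∀ a b, Tendsto (fun n => ωn n a b) atTop (𝓝 (ω a b))) (hϖ_pos : ∀ a, 0 < ϖ a)
    (h : B × (B → ℕ) → ℝ) (lam : B → B → ℝ) (κ : B → ℝ) (H : ℝ) (hH : ∀ x, h x ≤ H) :
    Tendsto (fun n => ∑' x, qq (ϖn n) (ωn n) x * Real.exp (gg h lam κ x)) atTop
      (𝓝 (∑' x, qq ϖ ω x * Real.exp (gg h lam κ x))) := by
  have hω0 : ∀ a b, 0 ≤ ω a b := fun a b => ge_of_tendsto' (hω_lim a b) fun n => hωn n a b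
  have hdiv : ∀ a b, Tendsto (fun n => ωn n a b / ϖn n a) atTop (𝓝 (ω a b / ϖ a)) := fun a b =>
    (hω_lim a b).div (hϖ_lim a) (hϖ_pos a).ne'
  refine tendsto_tsum_of_dominated_convergence (bound := fun x => Real.exp (H + ∑ a, |κ a|) *
      ∏ b, (((ω x.1 b / ϖ x.1 + 1) * Real.exp (lam x.1 b)) ^ x.2 b / ((x.2 b).factorial : ℝ))) ?_ ?_ ?_
  · refine (summable_pois (fun a b => (ω a b / ϖ a + 1) * Real.exp (lam a b)) fun a b => ?_).mul_left _
    exact mul_nonneg (add_nonneg (div_nonneg (hω0 _ _) (hϖ_pos _).le) zero_le_one) (Real.exp_nonneg _)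
  · intro x
    refine Tendsto.mul_const _ ?_
    unfold qq
    refine (hϖ_lim _).mul (tendsto_finsetProd _ fun b _ => ?_)
    exact (((Real.continuous_exp.tendsto _).comp (hdiv _ _).neg).mul ((hdiv _ _).pow _)).div_const _
  · have : ∀ᶠ n in atTop, ∀ a b, ωn n a b / ϖn n a ≤ ω a b / ϖ a + 1 := by
      rw [eventually_all]; intro a
      rw [eventually_all]; intro b
      filter_upwards [(hdiv a b).eventually_lt_const (lt_add_one _)] with n hn using hn.le
    filter_upwards [this] with n hn x
    rw [Real.norm_of_nonneg (mul_nonneg (qq_nonneg _ _ (hϖn n) (hωn n) x) (Real.exp_nonneg _))]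
    exact qq_exp_le (ϖn n) (ωn n) (hϖn n) (hϖn1 n) (hωn n) (fun a b => ω a b / ϖ a + 1) hn h lam κ H hH x

end poisson

/-! ### Part 7 -/

section duality

/-- entropy integrand -/
noncomputable def ent (p q : ℝ) : ℝ := p * Real.log (p / q) - p + q

theorem young (p q g : ℝ) (hp : 0 ≤ p) (hq : 0 ≤ q) (hpq : q = 0 → p = 0) :
    g * p - (q * Real.exp g - q) ≤ ent p q := by
  unfold ent
  rcases hp.eq_or_lt with rfl | hp
  · simp; positivity
  have hq' : 0 < q := lt_of_le_of_ne hq fun h => hp.ne' (hpq h.symm)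
  have h1 := Real.add_one_le_exp (g - Real.log (p / q))
  rw [Real.exp_sub, Real.exp_log (by positivity)] at h1
  have h2 : p * (g - Real.log (p / q) + 1) ≤ p * (Real.exp g / (p / q)) := mul_le_mul_of_nonneg_left h1 hp.le
  have h3 : p * (Real.exp g / (p / q)) = q * Real.exp g := by field_simp
  rw [h3] at h2
  linarith

theorem ent_nonneg (p q : ℝ) (hp : 0 ≤ p) (hq : 0 ≤ q) (hpq : q = 0 → p = 0) : 0 ≤ ent p q := by
  have := young p q 0 hp hq hpq
  simpa using this

variable (ϖ : B → ℝ) (ω : B → B → ℝ)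

/-- consistency -/
def consis (p : B × (B → ℕ) → ℝ) : Prop :=
  (∀ a, HasSum (fun σ => p (a, σ)) (ϖ a)) ∧ ∀ a b, HasSum (fun σ : B → ℕ => (σ b : ℝ) * p (a, σ)) (ω a b)

/-- the dual functional -/
noncomputable def Lam (S : Finset (B × (B → ℕ))) (h : B × (B → ℕ) → ℝ) (lam : B → B → ℝ) (κ : B → ℝ) (p : B × (B → ℕ) → ℝ) : ℝ :=
  ∑ x ∈ S, h x * p x + ∑ a, ∑ b, lam a b * ω a b + ∑ a, κ a * ϖ a - (∑' x, qq ϖ ω x * Real.exp (gg h lam κ x) - 1)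

theorem bdd_of_supp (S : Finset (B × (B → ℕ))) (h : B × (B → ℕ) → ℝ) (hS : ∀ x ∉ S, h x = 0) :
    ∃ H, ∀ x, h x ≤ H := by
  refine ⟨∑ x ∈ S, |h x|, fun x => ?_⟩
  by_cases hx : x ∈ S
  · exact (le_abs_self _).trans (Finset.single_le_sum (f := fun x => |h x|) (fun a _ => abs_nonneg _) hx)
  · rw [hS x hx]; positivity

theorem hasSum_gg (S : Finset (B × (B → ℕ))) (h : B × (B → ℕ) → ℝ) (hS : ∀ x ∉ S, h x = 0) (lam : B → B → ℝ) (κ : B → ℝ)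
    (p : B × (B → ℕ) → ℝ) (hc : consis ϖ ω p) :
    HasSum (fun x => gg h lam κ x * p x) (∑ x ∈ S, h x * p x + ∑ a, κ a * ϖ a + ∑ a, ∑ b, lam a b * ω a b) := by
  have h1 : HasSum (fun x => h x * p x) (∑ x ∈ S, h x * p x) :=
    hasSum_sum_of_ne_finset_zero fun x hx => by rw [hS x hx, zero_mul]
  have h2 : HasSum (fun x : B × (B → ℕ) => κ x.1 * p x) (∑ a, κ a * ϖ a) :=
    hasSum_B _ _ fun a => (hc.1 a).mul_left _
  have h3 : HasSum (fun x : B × (B → ℕ) => ∑ b, lam x.1 b * (x.2 b * p x)) (∑ a, ∑ b, lam a b * ω a b) :=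
    hasSum_B _ _ fun a => hasSum_sum fun b _ => (hc.2 a b).mul_left _
  refine ((h1.add h2).add h3).congr_fun ?_ |> fun h => h
  intro x
  unfold gg
  rw [add_mul, add_mul, Finset.sum_mul]
  congr 1
  exact Finset.sum_congr rfl fun b _ => by ring

theorem Lam_le (hϖ : ∀ a, 0 < ϖ a) (hϖ1 : ∑ a, ϖ a = 1) (hω : ∀ a b, 0 ≤ ω a b)
    (S : Finset (B × (B → ℕ))) (h : B × (B → ℕ) → ℝ) (hS : ∀ x ∉ S, h x = 0) (lam : B → B → ℝ) (κ : B → ℝ)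
    (p : B × (B → ℕ) → ℝ) (hp : ∀ x, 0 ≤ p x) (hc : consis ϖ ω p) (hac : ∀ x, qq ϖ ω x = 0 → p x = 0)
    (hs : Summable fun x => ent (p x) (qq ϖ ω x)) :
    Lam ϖ ω S h lam κ p ≤ ∑' x, ent (p x) (qq ϖ ω x) := by
  obtain ⟨H, hH⟩ := bdd_of_supp S h hS
  have hle1 : ∀ a, ϖ a ≤ 1 := fun a => by
    rw [← hϖ1]; exact Finset.single_le_sum (f := ϖ) (fun a _ => (hϖ a).le) (mem_univ a)
  have h1 := hasSum_gg ϖ ω S h hS lam κ p hc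
  have h2 := (summable_qq_exp ϖ ω (fun a => (hϖ a).le) hle1 hω h lam κ H hH).hasSum
  have h3 := hasSum_qq ϖ ω (fun a => (hϖ a).le) hω
  rw [hϖ1] at h3
  have h4 := h1.sub (h2.sub h3)
  have h5 := hasSum_le (fun x => young (p x) (qq ϖ ω x) (gg h lam κ x) (hp x) (qq_nonneg ϖ ω (fun a => (hϖ a).le) hω x) (hac x)) h4 hs.hasSum
  unfold Lam
  linarith

theorem Lam_of_nonpos (hϖ : ∀ a, 0 < ϖ a) (hϖ1 : ∑ a, ϖ a = 1) (hω : ∀ a b, 0 ≤ ω a b)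
    (S : Finset (B × (B → ℕ))) (h : B × (B → ℕ) → ℝ) (hS : ∀ x ∉ S, h x = 0) (lam : B → B → ℝ) (κ : B → ℝ)
    (p : B × (B → ℕ) → ℝ) (hg : ∀ x, gg h lam κ x ≤ 0) :
    ∑ x ∈ S, h x * p x + ∑ a, ∑ b, lam a b * ω a b + ∑ a, κ a * ϖ a ≤ Lam ϖ ω S h lam κ p := by
  obtain ⟨H, hH⟩ := bdd_of_supp S h hS
  have hle1 : ∀ a, ϖ a ≤ 1 := fun a => by
    rw [← hϖ1]; exact Finset.single_le_sum (f := ϖ) (fun a _ => (hϖ a).le) (mem_univ a)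
  have h2 := (summable_qq_exp ϖ ω (fun a => (hϖ a).le) hle1 hω h lam κ H hH).hasSum
  have h3 := hasSum_qq ϖ ω (fun a => (hϖ a).le) hω
  rw [hϖ1] at h3
  have h5 := hasSum_le (fun x => mul_le_of_le_one_right (qq_nonneg ϖ ω (fun a => (hϖ a).le) hω x) (Real.exp_le_one_iff.2 (hg x))) h2 h3
  unfold Lam
  linarith

theorem Lam_fin (hϖ : ∀ a, 0 < ϖ a) (hϖ1 : ∑ a, ϖ a = 1) (hω : ∀ a b, 0 ≤ ω a b)
    (S : Finset (B × (B → ℕ))) (h : B × (B → ℕ) → ℝ) (hS : ∀ x ∉ S, h x = 0)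
    (p : B × (B → ℕ) → ℝ) :
    Lam ϖ ω S h 0 0 p = ∑ x ∈ S, (h x * p x - (qq ϖ ω x * Real.exp (h x) - qq ϖ ω x)) := by
  have h3 := hasSum_qq ϖ ω (fun a => (hϖ a).le) hω
  rw [hϖ1] at h3
  have h4 : HasSum (fun x => qq ϖ ω x * Real.exp (h x) - qq ϖ ω x) (∑ x ∈ S, (qq ϖ ω x * Real.exp (h x) - qq ϖ ω x)) :=
    hasSum_sum_of_ne_finset_zero fun x hx => by rw [hS x hx]; simp
  have h5 := (h3.add h4).tsum_eq
  have h6 : ∀ x, gg h 0 0 x = h x := fun x => by simp [gg]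
  unfold Lam
  simp only [h6]
  simp only [add_sub_cancel] at h5
  rw [h5, Finset.sum_sub_distrib]
  simp

theorem nonpos_of_mul_le (δ c : ℝ) (h : ∀ t : ℝ, 0 ≤ t → t * δ ≤ c) : δ ≤ 0 := by
  by_contra hcon
  push Not at hcon
  have h1 := h 0 le_rfl
  have := h ((c + 1) / δ) (by simp at h1; positivity)
  rw [div_mul_cancel₀ _ hcon.ne'] at this
  linarith

end duality

/-! ### Part 8 -/

section duality2
variable (ϖ : B → ℝ) (ω : B → B → ℝ)

theorem dual_type (hϖ : ∀ a, 0 < ϖ a) (hϖ1 : ∑ a, ϖ a = 1) (hω : ∀ a b, 0 ≤ ω a b)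
    (p : B × (B → ℕ) → ℝ) (c : ℝ)
    (hL : ∀ S h lam κ, (∀ x ∉ S, h x = 0) → Lam ϖ ω S h lam κ p ≤ c) (a : B) (T : Finset (B → ℕ)) :
    ∑ σ ∈ T, p (a, σ) ≤ ϖ a := by
  suffices h : ∑ σ ∈ T, p (a, σ) - ϖ a ≤ 0 by linarith
  refine nonpos_of_mul_le _ c fun t ht => ?_
  set S : Finset (B × (B → ℕ)) := T.map ⟨fun σ => (a, σ), Prod.mk_right_injective a⟩ with hS
  have hg : ∀ x, gg (fun x => if x ∈ S then t else 0) 0 (fun a' => if a' = a then -t else 0) x ≤ 0 := by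
    intro x
    unfold gg
    by_cases hx : x ∈ S
    · have : x.1 = a := by
        simp only [hS, Finset.mem_map] at hx
        obtain ⟨σ, _, rfl⟩ := hx; rfl
      simp [hx, this]
    · simp only [hx, if_false]
      split_ifs <;> simp [ht]
  have h1 := Lam_of_nonpos ϖ ω hϖ hϖ1 hω S (fun x => if x ∈ S then t else 0) (fun x hx => by simp [hx]) 0 _ p hg
  have h2 := h1.trans (hL S _ _ _ (fun x hx => by simp [hx]))
  refine le_trans (le_of_eq ?_) h2
  have : ∑ x ∈ S, (if x ∈ S then t else 0) * p x = ∑ x ∈ S, t * p x :=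
    Finset.sum_congr rfl fun x hx => by simp [hx]
  rw [this, hS, Finset.sum_map]
  simp [mul_sub, Finset.mul_sum]
  ring

theorem dual_mom_le (hϖ : ∀ a, 0 < ϖ a) (hϖ1 : ∑ a, ϖ a = 1) (hω : ∀ a b, 0 ≤ ω a b)
    (p : B × (B → ℕ) → ℝ) (c : ℝ)
    (hL : ∀ S h lam κ, (∀ x ∉ S, h x = 0) → Lam ϖ ω S h lam κ p ≤ c) (a b : B) (T : Finset (B → ℕ)) :
    ∑ σ ∈ T, (σ b : ℝ) * p (a, σ) ≤ ω a b := by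
  suffices h : ∑ σ ∈ T, (σ b : ℝ) * p (a, σ) - ω a b ≤ 0 by linarith
  refine nonpos_of_mul_le _ c fun t ht => ?_
  set S : Finset (B × (B → ℕ)) := T.map ⟨fun σ => (a, σ), Prod.mk_right_injective a⟩ with hS
  have hg : ∀ x, gg (fun x => if x ∈ S then t * x.2 b else 0) (fun a' b' => if a' = a ∧ b' = b then -t else 0) 0 x ≤ 0 := by
    intro x
    unfold gg
    by_cases hx : x ∈ S
    · have : x.1 = a := by
        simp only [hS, Finset.mem_map] at hx
        obtain ⟨σ, _, rfl⟩ := hx; rfl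
      simp [hx, this]
    · simp only [hx, if_false]
      have : ∑ b', (if x.1 = a ∧ b' = b then -t else 0) * (x.2 b' : ℝ) ≤ 0 := by
        refine Finset.sum_nonpos fun b' _ => ?_
        split_ifs <;> simp
        positivity
      simpa using this
  have h1 := Lam_of_nonpos ϖ ω hϖ hϖ1 hω S (fun x => if x ∈ S then t * x.2 b else 0) (fun x hx => by simp [hx]) _ 0 p hg
  have h2 := h1.trans (hL S _ _ _ (fun x hx => by simp [hx]))
  refine le_trans (le_of_eq ?_) h2
  have : ∑ x ∈ S, (if x ∈ S then t * (x.2 b : ℝ) else 0) * p x = ∑ x ∈ S, t * (x.2 b * p x) :=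
    Finset.sum_congr rfl fun x hx => by simp [hx]; ring
  rw [this, hS, Finset.sum_map]
  have h3 : ∑ a', ∑ b', (if a' = a ∧ b' = b then -t else 0) * ω a' b' = - t * ω a b := by
    rw [Finset.sum_eq_single a, Finset.sum_eq_single b]
    · simp
    · intro b' _ hb; simp [hb]
    · simp
    · intro a' _ ha; simp [ha]
    · simp
  rw [h3]
  simp [mul_sub, Finset.mul_sum]
  ring

theorem dual_mom_ge (hϖ : ∀ a, 0 < ϖ a) (hϖ1 : ∑ a, ϖ a = 1) (hω : ∀ a b, 0 ≤ ω a b)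
    (p : B × (B → ℕ) → ℝ) (hp : ∀ x, 0 ≤ p x) (c : ℝ)
    (hL : ∀ S h lam κ, (∀ x ∉ S, h x = 0) → Lam ϖ ω S h lam κ p ≤ c) (a b : B) (s : ℝ)
    (hs : HasSum (fun σ : B → ℕ => (σ b : ℝ) * p (a, σ)) s) :
    ω a b ≤ s := by
  suffices h : ω a b - s ≤ 0 by linarith
  refine nonpos_of_mul_le _ (c + 1) fun t ht => ?_
  have hle1 : ∀ a, ϖ a ≤ 1 := fun a => by
    rw [← hϖ1]; exact Finset.single_le_sum (f := ϖ) (fun a _ => (hϖ a).le) (mem_univ a)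
  set lam : B → B → ℝ := fun a' b' => if a' = a ∧ b' = b then t else 0 with hlam
  have hq := hasSum_qq ϖ ω (fun a => (hϖ a).le) hω
  rw [hϖ1] at hq
  have h2 := (summable_qq_exp ϖ ω (fun a => (hϖ a).le) hle1 hω 0 lam 0 0 (fun _ => le_rfl))
  have hf := (h2.sub hq.summable).hasSum
  set f : B × (B → ℕ) → ℝ := fun x => qq ϖ ω x * Real.exp (gg 0 lam 0 x) - qq ϖ ω x with hfdef
  obtain ⟨S, hSlt⟩ := (hf.eventually_const_lt (show (∑' x, f x) - 1 < _ from sub_one_lt _)).exists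
  have hg0 : ∀ x, gg 0 lam 0 x = if x.1 = a then t * x.2 b else 0 := by
    intro x
    simp only [gg, hlam, Pi.zero_apply]
    by_cases hx : x.1 = a
    · simp [hx]
    · simp [hx]
  set h : B × (B → ℕ) → ℝ := fun x => if x ∈ S ∧ x.1 = a then -t * x.2 b else 0 with hh
  have hg : ∀ x, gg h lam 0 x = if x ∈ S then 0 else gg 0 lam 0 x := by
    intro x
    have : gg h lam 0 x = h x + gg 0 lam 0 x := by simp [gg]
    rw [this, hg0, hh]
    by_cases hx : x.1 = a <;> by_cases hx' : x ∈ S <;> simp [hx, hx']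
  have h3 : HasSum (fun x => if x ∈ S then f x else 0) (∑ x ∈ S, f x) := by
    have := hasSum_sum_of_ne_finset_zero (f := fun x => if x ∈ S then f x else 0) (s := S) (L := SummationFilter.unconditional _) fun x hx => by simp [hx]
    rwa [Finset.sum_congr rfl fun x hx => by rw [if_pos hx]] at this
  have h4 := (hq.add (hf.sub h3)).tsum_eq
  have h5 : ∀ x, qq ϖ ω x * Real.exp (gg h lam 0 x) = qq ϖ ω x + (f x - if x ∈ S then f x else 0) := by
    intro x
    rw [hg, hfdef]
    by_cases hx : x ∈ S <;> simp [hx]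
  have h6 := hL S h lam 0 (fun x hx => by simp [hh, hx])
  unfold Lam at h6
  simp only [h5] at h6
  rw [h4] at h6
  have h7 : ∑ a', ∑ b', lam a' b' * ω a' b' = t * ω a b := by
    simp only [hlam]
    rw [Finset.sum_eq_single a, Finset.sum_eq_single b]
    · simp
    · intro b' _ hb; simp [hb]
    · simp
    · intro a' _ ha; simp [ha]
    · simp
  rw [h7] at h6
  have h8 : -(t * s) ≤ ∑ x ∈ S, h x * p x := by
    have e1 : HasSum (fun x : B × (B → ℕ) => if x.1 = a then -(t * (x.2 b * p x)) else 0) (∑ a', if a' = a then -(t * s) else 0) := by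
      refine hasSum_B _ _ fun a' => ?_
      by_cases ha : a' = a
      · subst ha; simpa using (hs.mul_left t).neg
      · simpa [ha] using hasSum_zero
    have e2 : HasSum (fun x => h x * p x) (∑ x ∈ S, h x * p x) :=
      hasSum_sum_of_ne_finset_zero fun x hx => by simp [hh, hx]
    refine le_trans (le_of_eq ?_) (hasSum_le ?_ e1 e2)
    · simp
    · intro x
      simp only [hh]
      have := mul_nonneg ht (mul_nonneg (Nat.cast_nonneg (α := ℝ) (x.2 b)) (hp x))
      by_cases hx : x.1 = a <;> by_cases hx' : x ∈ S <;> simp [hx, hx']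
      · exact le_of_eq (by ring)
      · exact this
  simp only [Pi.zero_apply, zero_mul, Finset.sum_const_zero] at h6
  linarith

theorem dual_ac (hϖ : ∀ a, 0 < ϖ a) (hϖ1 : ∑ a, ϖ a = 1) (hω : ∀ a b, 0 ≤ ω a b)
    (p : B × (B → ℕ) → ℝ) (hp : ∀ x, 0 ≤ p x) (c : ℝ)
    (hL : ∀ S h lam κ, (∀ x ∉ S, h x = 0) → Lam ϖ ω S h lam κ p ≤ c) (x : B × (B → ℕ)) (hx : qq ϖ ω x = 0) : p x = 0 := by
  refine le_antisymm ?_ (hp x)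
  refine nonpos_of_mul_le _ c fun t ht => ?_
  have h0 : ∀ y ∉ ({x} : Finset (B × (B → ℕ))), (fun y => if y = x then t else 0) y = 0 := fun y hy => by
    simp at hy; simp [hy]
  have := hL {x} (fun y => if y = x then t else 0) 0 0 h0
  rw [Lam_fin ϖ ω hϖ hϖ1 hω _ _ h0] at this
  simpa [hx] using this

theorem dual_ent (hϖ : ∀ a, 0 < ϖ a) (hϖ1 : ∑ a, ϖ a = 1) (hω : ∀ a b, 0 ≤ ω a b)
    (p : B × (B → ℕ) → ℝ) (hp : ∀ x, 0 ≤ p x) (c : ℝ)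
    (hL : ∀ S h lam κ, (∀ x ∉ S, h x = 0) → Lam ϖ ω S h lam κ p ≤ c) (hac : ∀ x, qq ϖ ω x = 0 → p x = 0) (S : Finset (B × (B → ℕ))) :
    ∑ x ∈ S, ent (p x) (qq ϖ ω x) ≤ c := by
  have h1 : ∀ t : ℝ, ∑ x ∈ S, ent (p x) (qq ϖ ω x) - Real.exp (-t) * ∑ x ∈ S, (if p x = 0 then qq ϖ ω x else 0) ≤ c := by
    intro t
    set h : B × (B → ℕ) → ℝ := fun x => if x ∈ S then (if p x = 0 then -t else Real.log (p x / qq ϖ ω x)) else 0 with hh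
    have h0 : ∀ x ∉ S, h x = 0 := fun x hx => by simp [hh, hx]
    have := hL S h 0 0 h0
    rw [Lam_fin ϖ ω hϖ hϖ1 hω _ _ h0] at this
    refine le_trans (le_of_eq ?_) this
    rw [Finset.mul_sum, ← Finset.sum_sub_distrib]
    refine Finset.sum_congr rfl fun x hx => ?_
    simp only [hh, hx, if_true, ent]
    by_cases hpx : p x = 0
    · simp [hpx]; ring
    · have hp' : 0 < p x := lt_of_le_of_ne (hp x) (Ne.symm hpx)
      have hq' : 0 < qq ϖ ω x := lt_of_le_of_ne (qq_nonneg ϖ ω (fun a => (hϖ a).le) hω x) fun h => hpx (hac x h.symm)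
      simp only [hpx, if_false, mul_zero, sub_zero]
      rw [Real.exp_log (by positivity)]
      field_simp
      ring
  have h2 : Tendsto (fun t : ℝ => ∑ x ∈ S, ent (p x) (qq ϖ ω x) - Real.exp (-t) * ∑ x ∈ S, (if p x = 0 then qq ϖ ω x else 0)) atTop
      (𝓝 (∑ x ∈ S, ent (p x) (qq ϖ ω x) - 0 * ∑ x ∈ S, (if p x = 0 then qq ϖ ω x else 0))) :=
    (Real.tendsto_exp_neg_atTop_nhds_zero.mul_const _).const_sub _
  have := le_of_tendsto' h2 h1
  simpa using this

theorem dual_all (hϖ : ∀ a, 0 < ϖ a) (hϖ1 : ∑ a, ϖ a = 1) (hω : ∀ a b, 0 ≤ ω a b)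
    (p : B × (B → ℕ) → ℝ) (hp : ∀ x, 0 ≤ p x) (hp1 : HasSum p 1) (c : ℝ)
    (hL : ∀ S h lam κ, (∀ x ∉ S, h x = 0) → Lam ϖ ω S h lam κ p ≤ c) :
    consis ϖ ω p ∧ (∀ x, qq ϖ ω x = 0 → p x = 0) ∧ (Summable fun x => ent (p x) (qq ϖ ω x)) ∧ ∑' x, ent (p x) (qq ϖ ω x) ≤ c := by
  have hac := dual_ac ϖ ω hϖ hϖ1 hω p hp c hL
  have hE := dual_ent ϖ ω hϖ hϖ1 hω p hp c hL hac
  have hent : ∀ x, 0 ≤ ent (p x) (qq ϖ ω x) := fun x => ent_nonneg _ _ (hp x) (qq_nonneg ϖ ω (fun a => (hϖ a).le) hω x) (hac x)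
  refine ⟨⟨?_, ?_⟩, hac, summable_of_sum_le hent hE, Real.tsum_le_of_sum_le hent hE⟩
  · have h1 := dual_type ϖ ω hϖ hϖ1 hω p c hL
    have hs : ∀ a, Summable fun σ => p (a, σ) := fun a => summable_of_sum_le (fun σ => hp _) (h1 a)
    have hle : ∀ a, ∑' σ, p (a, σ) ≤ ϖ a := fun a => Real.tsum_le_of_sum_le (fun σ => hp _) (h1 a)
    have h2 : ∑ a, ∑' σ, p (a, σ) = 1 := (hasSum_B p _ fun a => (hs a).hasSum).unique hp1
    have h3 := (Finset.sum_eq_sum_iff_of_le (s := univ) fun a _ => hle a).1 (by rw [h2, hϖ1])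
    intro a
    rw [← h3 a (mem_univ a)]
    exact (hs a).hasSum
  · intro a b
    have h1 := dual_mom_le ϖ ω hϖ hϖ1 hω p c hL a b
    have h0 : ∀ σ : B → ℕ, 0 ≤ (σ b : ℝ) * p (a, σ) := fun σ => mul_nonneg (Nat.cast_nonneg _) (hp _)
    have hs : Summable fun σ : B → ℕ => (σ b : ℝ) * p (a, σ) := summable_of_sum_le h0 h1
    have hle : ∑' σ : B → ℕ, (σ b : ℝ) * p (a, σ) ≤ ω a b := Real.tsum_le_of_sum_le h0 h1
    have := dual_mom_ge ϖ ω hϖ hϖ1 hω p hp c hL a b _ hs.hasSum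
    rw [le_antisymm this hle]
    exact hs.hasSum

end duality2

/-! ### Part 9 -/

section rate
variable [TopologicalSpace B] [DiscreteTopology B] [BorelSpace B]
variable (ϖ : B → ℝ) (ω : B → B → ℝ)

theorem cons_iff (hϖ : ∀ a, 0 < ϖ a) (hω : ∀ a b, 0 ≤ ω a b) (μ : ProbabilityMeasure (B × (B → ℕ))) :
    ((∀ a : B, (μ : Measure (B × (B → ℕ))) {x | x.1 = a} = ENNReal.ofReal (ϖ a)) ∧
      (∀ a b : B, (∑' σ : B → ℕ, (σ b : ℝ≥0∞) * (μ : Measure (B × (B → ℕ))) {(a, σ)})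
        = ENNReal.ofReal (ω a b))) ↔ consis ϖ ω (pm μ) := by
  have key : ∀ (f : (B → ℕ) → ℝ) (s : ℝ), (∀ σ, 0 ≤ f σ) → 0 ≤ s →
      (∑' σ, ENNReal.ofReal (f σ) = ENNReal.ofReal s ↔ HasSum f s) := by
    intro f s hf hs
    constructor
    · intro h
      have h1 : Summable f := by
        have h2 : ∑' σ, ENNReal.ofReal (f σ) ≠ ⊤ := by rw [h]; exact ENNReal.ofReal_ne_top
        have := ENNReal.summable_toReal h2
        refine this.congr fun σ => ?_
        rw [ENNReal.toReal_ofReal (hf σ)]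
      rw [← ENNReal.ofReal_tsum_of_nonneg hf h1] at h
      rw [ENNReal.ofReal_eq_ofReal_iff (tsum_nonneg hf) hs] at h
      rw [← h]; exact h1.hasSum
    · intro h
      rw [← ENNReal.ofReal_tsum_of_nonneg hf h.summable, h.tsum_eq]
  unfold consis
  refine and_congr (forall_congr' fun a => ?_) (forall_congr' fun a => forall_congr' fun b => ?_)
  · rw [← key _ _ (fun σ => pm_nonneg μ _) (hϖ a).le]
    have : (μ : Measure (B × (B → ℕ))) {x | x.1 = a} = ∑' σ, ENNReal.ofReal (pm μ (a, σ)) := by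
      have hset : ({x | x.1 = a} : Set (B × (B → ℕ))) = ⋃ σ : B → ℕ, {(a, σ)} := by
        ext x
        simp only [Set.mem_iUnion, Set.mem_singleton_iff, Set.mem_ofPred_eq]
        constructor
        · intro h; exact ⟨x.2, by rw [← h]⟩
        · rintro ⟨σ, rfl⟩; rfl
      rw [hset, measure_iUnion]
      · simp only [pm_ofReal]
      · intro σ τ h
        simp [Set.disjoint_singleton, h]
      · intro σ; exact measurableSet_singleton _
    rw [this]
  · rw [← key _ _ (fun σ => mul_nonneg (Nat.cast_nonneg _) (pm_nonneg μ _)) (hω a b)]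
    have : ∀ σ : B → ℕ, ENNReal.ofReal ((σ b : ℝ) * pm μ (a, σ)) = (σ b : ℝ≥0∞) * (μ : Measure (B × (B → ℕ))) {(a, σ)} := by
      intro σ
      rw [ENNReal.ofReal_mul (Nat.cast_nonneg _), pm_ofReal, ENNReal.ofReal_natCast]
    simp only [this]

theorem locRate_le_iff (hϖ : ∀ a, 0 < ϖ a) (hω : ∀ a b, 0 ≤ ω a b) (μ : ProbabilityMeasure (B × (B → ℕ))) (c : ℝ≥0) :
    locRate ϖ ω μ ≤ c ↔ consis ϖ ω (pm μ) ∧ (∀ x, qq ϖ ω x = 0 → pm μ x = 0) ∧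
      (Summable fun x => ent (pm μ x) (qq ϖ ω x)) ∧ ∑' x, ent (pm μ x) (qq ϖ ω x) ≤ c := by
  classical
  have hq := qq_nonneg ϖ ω (fun a => (hϖ a).le) hω
  have hacq : (∀ x : B × (B → ℕ), Qpoi ϖ ω {x} = 0 → (μ : Measure (B × (B → ℕ))) {x} = 0) ↔ (∀ x, qq ϖ ω x = 0 → pm μ x = 0) := by
    refine forall_congr' fun x => ?_
    rw [Qpoi_singleton, ← pm_ofReal, ENNReal.ofReal_eq_zero, ENNReal.ofReal_eq_zero]
    have h1 := hq x
    have h2 := pm_nonneg μ x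
    exact ⟨fun h h' => le_antisymm (h h'.le) h2, fun h h' => (h (le_antisymm h' h1)).le⟩
  unfold locRate
  by_cases hc : consis ϖ ω (pm μ)
  · have hc' := (cons_iff ϖ ω hϖ hω μ).2 hc
    rw [if_pos hc']
    unfold relEnt
    by_cases ha : ∀ x, qq ϖ ω x = 0 → pm μ x = 0
    · have ha' := hacq.2 ha
      rw [if_pos ha']
      have hent : ∀ x, 0 ≤ ent (pm μ x) (qq ϖ ω x) := fun x => ent_nonneg _ _ (pm_nonneg μ x) (hq x) (ha x)
      have h1 : ∀ x, (((μ : Measure (B × (B → ℕ))) {x}).toReal * Real.log (((μ : Measure (B × (B → ℕ))) {x}).toReal / (Qpoi ϖ ω {x}).toReal)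
      - ((μ : Measure (B × (B → ℕ))) {x}).toReal + (Qpoi ϖ ω {x}).toReal) = ent (pm μ x) (qq ϖ ω x) := by
        intro x
        rw [Qpoi_singleton, ENNReal.toReal_ofReal (hq x)]; rfl
      simp only [h1]
      constructor
      · intro h
        have h2 : ∑' x, ENNReal.ofReal (ent (pm μ x) (qq ϖ ω x)) ≠ ⊤ := ne_top_of_le_ne_top ENNReal.coe_ne_top h
        have h3 : Summable fun x => ent (pm μ x) (qq ϖ ω x) := by
          refine (ENNReal.summable_toReal h2).congr fun x => ?_
          rw [ENNReal.toReal_ofReal (hent x)]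
        refine ⟨hc, ha, h3, ?_⟩
        rw [← ENNReal.ofReal_tsum_of_nonneg hent h3] at h
        rw [← ENNReal.ofReal_coe_nnreal] at h
        exact (ENNReal.ofReal_le_ofReal_iff c.2).1 h
      · rintro ⟨-, -, h3, h4⟩
        rw [← ENNReal.ofReal_tsum_of_nonneg hent h3, ← ENNReal.ofReal_coe_nnreal]
        exact ENNReal.ofReal_le_ofReal h4
    · rw [if_neg (fun h => ha (hacq.1 h))]
      exact ⟨fun h => absurd h (by simp), fun h => absurd h.2.1 ha⟩
  · rw [if_neg (fun h => hc ((cons_iff ϖ ω hϖ hω μ).1 h))]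
    simp [hc]

theorem mem_Kset (μ : ProbabilityMeasure (B × (B → ℕ))) (s : ℝ) (C : ℝ≥0) (hs : HasSum (fun x => (∑ b, (x.2 b : ℝ)) * pm μ x) s)
    (hC : s ≤ C) : μ ∈ Kset (B := B) C := by
  intro n
  rw [← NNReal.coe_le_coe]
  have h1 := real_set_pm μ ({x : B × (B → ℕ) | ∀ b, x.2 b ≤ n} : Set (B × (B → ℕ)))ᶜ
  have h2 : ((μ ({x : B × (B → ℕ) | ∀ b, x.2 b ≤ n} : Set (B × (B → ℕ)))ᶜ : ℝ≥0) : ℝ) =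
    ((μ : Measure (B × (B → ℕ))) ({x : B × (B → ℕ) | ∀ b, x.2 b ≤ n} : Set (B × (B → ℕ)))ᶜ).toReal := rfl
  rw [h2, h1]
  have hpos : (0 : ℝ) < n + 1 := by positivity
  push_cast
  rw [le_div_iff₀ hpos, ← tsum_mul_right]
  refine le_trans ?_ hC
  refine hasSum_le ?_ (((summable_pm μ).indicator _).mul_right _).hasSum hs
  intro x
  have h0 := pm_nonneg μ x
  by_cases hx : x ∈ ({x : B × (B → ℕ) | ∀ b, x.2 b ≤ n} : Set (B × (B → ℕ)))ᶜ
  · rw [Set.indicator_of_mem hx]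
    simp only [Set.mem_compl_iff, Set.mem_ofPred_eq, not_forall, not_le] at hx
    obtain ⟨b, hb⟩ := hx
    have h3 : ((n : ℝ) + 1) ≤ x.2 b := by exact_mod_cast hb
    have h4 := Finset.single_le_sum (f := fun b => (x.2 b : ℝ)) (fun b _ => Nat.cast_nonneg _) (mem_univ b)
    rw [mul_comm]
    exact mul_le_mul_of_nonneg_right (h3.trans h4) h0
  · rw [Set.indicator_of_notMem hx, zero_mul]
    positivity

theorem cons_Kset (μ : ProbabilityMeasure (B × (B → ℕ))) (hc : consis ϖ ω (pm μ)) (C : ℝ≥0) (hC : ∑ a, ∑ b, ω a b ≤ C) :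
    μ ∈ Kset (B := B) C := by
  refine mem_Kset μ _ C ?_ hC
  have h3 : HasSum (fun x : B × (B → ℕ) => ∑ b, ((x.2 b : ℝ) * pm μ x)) (∑ a, ∑ b, ω a b) :=
    hasSum_B _ _ fun a => hasSum_sum fun b _ => (hc.2 a b)
  refine h3.congr_fun ?_ |> fun h => h
  intro x; rw [Finset.sum_mul]

theorem continuous_Lam (S : Finset (B × (B → ℕ))) (h : B × (B → ℕ) → ℝ) (lam : B → B → ℝ) (κ : B → ℝ) :
    Continuous fun μ : ProbabilityMeasure (B × (B → ℕ)) => Lam ϖ ω S h lam κ (pm μ) := by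
  unfold Lam
  refine Continuous.sub (Continuous.add (Continuous.add ?_ continuous_const) continuous_const) continuous_const
  exact continuous_finset_sum _ fun x _ => continuous_const.mul (continuous_pm x)

theorem hasSum_pm (μ : ProbabilityMeasure (B × (B → ℕ))) : HasSum (pm μ) 1 := by
  have := (summable_pm μ).hasSum
  rwa [tsum_pm] at this

theorem locRate_le_iff_Lam (hϖ : ∀ a, 0 < ϖ a) (hϖ1 : ∑ a, ϖ a = 1) (hω : ∀ a b, 0 ≤ ω a b) (μ : ProbabilityMeasure (B × (B → ℕ))) (c : ℝ≥0) :
    locRate ϖ ω μ ≤ c ↔ ∀ S h lam κ, (∀ x ∉ S, h x = 0) → Lam ϖ ω S h lam κ (pm μ) ≤ c := by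
  rw [locRate_le_iff ϖ ω hϖ hω]
  constructor
  · rintro ⟨h1, h2, h3, h4⟩ S h lam κ hS
    exact (Lam_le ϖ ω hϖ hϖ1 hω S h hS lam κ _ (pm_nonneg μ) h1 h2 h3).trans h4
  · intro hL
    exact dual_all ϖ ω hϖ hϖ1 hω _ (pm_nonneg μ) (hasSum_pm μ) c hL

theorem goodRate (hϖ : ∀ a, 0 < ϖ a) (hϖ1 : ∑ a, ϖ a = 1) (hω : ∀ a b, 0 ≤ ω a b) : GoodRate (locRate ϖ ω) := by
  intro c
  obtain ⟨C, hC⟩ : ∃ C : ℝ≥0, ∑ a, ∑ b, ω a b ≤ C := ⟨Real.toNNReal (∑ a, ∑ b, ω a b), Real.le_coe_toNNReal _⟩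
  refine (isCompact_Kset (B := B) C).of_isClosed_subset ?_ ?_
  · have : {x | locRate ϖ ω x ≤ (c : ℝ≥0∞)} = ⋂ (S : Finset (B × (B → ℕ))) (h : B × (B → ℕ) → ℝ) (lam : B → B → ℝ) (κ : B → ℝ)
        (_ : ∀ x ∉ S, h x = 0), {μ : ProbabilityMeasure (B × (B → ℕ)) | Lam ϖ ω S h lam κ (pm μ) ≤ c} := by
      ext μ
      simp only [Set.mem_iInter, Set.mem_ofPred_eq]
      exact locRate_le_iff_Lam ϖ ω hϖ hϖ1 hω μ c
    rw [this]
    refine isClosed_iInter fun S => isClosed_iInter fun h => isClosed_iInter fun lam => isClosed_iInter fun κ => isClosed_iInter fun _ => ?_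
    exact isClosed_le (continuous_Lam ϖ ω S h lam κ) continuous_const
  · intro μ hμ
    exact cons_Kset ϖ ω μ ((locRate_le_iff ϖ ω hϖ hω μ c).1 hμ).1 C hC

end rate

/-! ### Part 10 -/

section stirling

theorem fac_lower (j : ℕ) : Real.exp (-j) * (j : ℝ) ^ j ≤ (j.factorial : ℝ) := by
  have h := Real.pow_div_factorial_le_exp (j : ℝ) (Nat.cast_nonneg j) j
  have hf : (0 : ℝ) < j.factorial := by positivity
  rw [div_le_iff₀ hf] at h
  calc _ ≤ Real.exp (-j) * (Real.exp j * j.factorial) := by gcongr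
    _ = _ := by rw [← mul_assoc, ← Real.exp_add]; simp

theorem fac_upper_succ (j : ℕ) : ((j + 1).factorial : ℝ) ≤ Real.exp 1 * (j + 1) * (Real.exp (-((j : ℝ) + 1)) * ((j : ℝ) + 1) ^ (j + 1)) := by
  induction j with
  | zero => simp [← Real.exp_add]
  | succ j ih =>
    rw [Nat.factorial_succ]
    push_cast
    have h1 : Real.exp 1 * ((j : ℝ) + 1) ^ (j + 2) ≤ ((j : ℝ) + 2) ^ (j + 2) := by
      have hp1 : (0 : ℝ) < (j : ℝ) + 1 := by positivity
      have hp2 : (0 : ℝ) < (j : ℝ) + 2 := by positivity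
      have h := Real.one_sub_inv_le_log_of_pos (div_pos hp2 hp1)
      have h2 : 1 - (((j : ℝ) + 2) / ((j : ℝ) + 1))⁻¹ = 1 / ((j : ℝ) + 2) := by field_simp; ring
      rw [h2, div_le_iff₀ hp2] at h
      have h3 : Real.exp 1 ≤ (((j : ℝ) + 2) / ((j : ℝ) + 1)) ^ (j + 2) := by
        rw [← Real.exp_log (div_pos hp2 hp1), ← Real.exp_nat_mul]
        apply Real.exp_le_exp.2
        push_cast; linarith
      rw [div_pow, le_div_iff₀ (by positivity)] at h3
      exact h3
    calc ((j : ℝ) + 1 + 1) * ((j + 1).factorial : ℝ) ≤ ((j : ℝ) + 1 + 1) * (Real.exp 1 * (j + 1) * (Real.exp (-((j : ℝ) + 1)) * ((j : ℝ) + 1) ^ (j + 1))) := by gcongr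
      _ = Real.exp 1 * ((j : ℝ) + 1 + 1) * (Real.exp (-((j : ℝ) + 1 + 1)) * (Real.exp 1 * ((j : ℝ) + 1) ^ (j + 2))) := by
          have : Real.exp (-((j : ℝ) + 1)) = Real.exp (-((j : ℝ) + 1 + 1)) * Real.exp 1 := by
            rw [← Real.exp_add]; congr 1; ring
          rw [this]; ring
      _ ≤ Real.exp 1 * ((j : ℝ) + 1 + 1) * (Real.exp (-((j : ℝ) + 1 + 1)) * ((j : ℝ) + 1 + 1) ^ (j + 1 + 1)) := by
          have h3 : (j : ℝ) + 1 + 1 = j + 2 := by ring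
          rw [h3]; gcongr

theorem fac_upper (j : ℕ) : (j.factorial : ℝ) ≤ Real.exp 1 * (j + 1) * (Real.exp (-j) * (j : ℝ) ^ j) := by
  rcases j with _ | j
  · simp
  · refine (fac_upper_succ j).trans ?_
    push_cast
    gcongr
    linarith

theorem log_fac_lower (j : ℕ) : (j : ℝ) * Real.log j - j ≤ Real.log j.factorial := by
  rcases Nat.eq_zero_or_pos j with rfl | hj
  · simp
  have hj' : (0 : ℝ) < j := by exact_mod_cast hj
  have := Real.log_le_log (by positivity) (fac_lower j)
  rw [Real.log_mul (by positivity) (by positivity), Real.log_exp, Real.log_pow] at this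
  linarith

theorem log_fac_upper (j : ℕ) : Real.log j.factorial ≤ (j : ℝ) * Real.log j - j + (1 + Real.log (j + 1)) := by
  rcases Nat.eq_zero_or_pos j with rfl | hj
  · simp
  have hj' : (0 : ℝ) < j := by exact_mod_cast hj
  have := Real.log_le_log (by positivity) (fac_upper j)
  rw [Real.log_mul (by positivity) (by positivity), Real.log_mul (by positivity) (by positivity),
    Real.log_mul (by positivity) (by positivity), Real.log_exp, Real.log_exp, Real.log_pow] at this
  linarith

end stirling

section cheb
variable {V D : Type*} [Fintype V] [DecidableEq V] [Fintype D] [DecidableEq D]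

/-- polynomial prefactor -/
noncomputable def Pfac (k : B → B → ℕ) (N : B → ℕ) : ℝ :=
  (∏ a, ∏ b, (Real.exp 1 * (k a b + 1))) * ∏ a, (Real.exp 1 * (N a + 1))

theorem E_bound (α β : D → B) (N : B → ℕ) (hN : ∑ a, N a = Fintype.card V) (hpos : ∀ a, 0 < N a)
    (w : B × (B → ℕ) → ℝ) (hw : ∀ x, 0 ≤ w x)
    (hsum : Summable fun x => qq (fun a => (N a : ℝ) / Fintype.card V) (fun a b => (kk α β a b : ℝ) / Fintype.card V) x * w x) :
    (∑ zf ∈ stubConf V α N, ∏ v, w (prof β zf.1 zf.2 v)) ≤ #(stubConf V α N) * (Pfac (kk α β) N *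
      (∑' x, qq (fun a => (N a : ℝ) / Fintype.card V) (fun a b => (kk α β a b : ℝ) / Fintype.card V) x * w x) ^ Fintype.card V) := by
  have hposR : ∀ a, (0 : ℝ) < N a := fun a => by exact_mod_cast hpos a
  rcases isEmpty_or_nonempty B with hB | ⟨⟨a0⟩⟩
  · have h0 : Fintype.card V = 0 := by rw [← hN]; simp
    have : IsEmpty V := Fintype.card_eq_zero_iff.1 h0
    simp [h0, Pfac]
  set n := Fintype.card V with hn
  have hn0 : 0 < n := by
    rw [← hN]; exact lt_of_lt_of_le (hpos a0) (Finset.single_le_sum (f := N) (fun a _ => Nat.zero_le _) (mem_univ a0))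
  have hnR : (0 : ℝ) < n := by exact_mod_cast hn0
  set k := kk α β with hk
  set s : B → B → ℝ := fun a b => (k a b : ℝ) / N a with hs
  set p : B → ℝ := fun a => (N a : ℝ) / n * Real.exp (-∑ b, s a b) with hp
  have hqq : ∀ x, qq (fun a => (N a : ℝ) / n) (fun a b => (k a b : ℝ) / n) x * w x =
      p x.1 * (∏ b, (s x.1 b ^ x.2 b / (x.2 b).factorial)) * w x := by
    intro x
    unfold qq
    have e1 : ∀ b, ((k x.1 b : ℝ) / n) / ((N x.1 : ℝ) / n) = s x.1 b := fun b => by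
      have := hposR x.1
      simp only [hs]; field_simp
    simp only [e1, hp]
    rw [← Finset.sum_neg_distrib, Real.exp_sum]
    congr 1
    rw [mul_assoc, ← Finset.prod_mul_distrib]
    congr 1
    exact Finset.prod_congr rfl fun b _ => by ring
  simp only [hqq] at hsum ⊢
  have hs0 : ∀ a b, 0 ≤ s a b := fun a b => by simp only [hs]; positivity
  have hp0 : ∀ a, 0 < p a := fun a => by have := hposR a; simp only [hp]; positivity
  have key := gen_bound (V := V) α β N p s w (fun a => (hp0 a).le) hs0 hw hsum
  set Z := (∑' x : B × (B → ℕ), p x.1 * (∏ b, (s x.1 b ^ x.2 b / (x.2 b).factorial)) * w x) ^ n with hZ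
  have hZ0 : 0 ≤ Z := by
    refine pow_nonneg (tsum_nonneg fun x => mul_nonneg (mul_nonneg (hp0 _).le (Finset.prod_nonneg fun b _ => ?_)) (hw x)) _
    have := hs0 x.1 b; positivity
  set A := (∏ a, p a ^ N a) * (∏ a, ∏ b, s a b ^ kk α β a b) with hA
  have hA0 : 0 < A := by
    refine mul_pos (Finset.prod_pos fun a _ => pow_pos (hp0 a) _) (Finset.prod_pos fun a _ => Finset.prod_pos fun b _ => ?_)
    rcases Nat.eq_zero_or_pos (k a b) with h | h
    · rw [← hk, h]; simp
    · have : 0 < s a b := by have := hposR a; simp only [hs]; positivity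
      positivity
  have hcard := card_stubConf (V := V) α β N hN
  rw [← hk, ← hn] at hcard
  have hcardR : (#(stubConf V α N) : ℝ) * ∏ a, ((N a).factorial : ℝ) = (n.factorial : ℝ) * ∏ a, ∏ b, (N a : ℝ) ^ k a b := by
    exact_mod_cast hcard
  have hmain : (∏ a, ∏ b, ((k a b).factorial : ℝ)) ≤ A * (#(stubConf V α N) * Pfac k N) := by
    have hNf : 0 < ∏ a, ((N a).factorial : ℝ) := Finset.prod_pos fun a _ => by positivity
    refine le_of_mul_le_mul_right ?_ hNf
    have e0 : A * (#(stubConf V α N) * Pfac k N) * ∏ a, ((N a).factorial : ℝ) =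
        A * Pfac k N * (#(stubConf V α N) * ∏ a, ((N a).factorial : ℝ)) := by ring
    rw [e0, hcardR]
    have h1 : (∏ a, ∏ b, ((k a b).factorial : ℝ)) ≤ ∏ a, ∏ b, (Real.exp 1 * (k a b + 1) * (Real.exp (-(k a b : ℝ)) * (k a b : ℝ) ^ k a b)) :=
      Finset.prod_le_prod (fun a _ => by positivity) fun a _ => Finset.prod_le_prod (fun b _ => by positivity) fun b _ => fac_upper _
    have h2 : (∏ a, ((N a).factorial : ℝ)) ≤ ∏ a, (Real.exp 1 * (N a + 1) * (Real.exp (-(N a : ℝ)) * (N a : ℝ) ^ N a)) :=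
      Finset.prod_le_prod (fun a _ => by positivity) fun a _ => fac_upper _
    have e1 : A * ∏ a, ∏ b, (N a : ℝ) ^ k a b = (∏ a, ((N a : ℝ) ^ N a)) / (n : ℝ) ^ n * ∏ a, ∏ b, (Real.exp (-(k a b : ℝ)) * (k a b : ℝ) ^ k a b) := by
      have f1 : ∏ a, p a ^ N a = (∏ a, ((N a : ℝ) ^ N a)) / (n : ℝ) ^ n * ∏ a, ∏ b, Real.exp (-(k a b : ℝ)) := by
        have g1 : (n : ℝ) ^ n = ∏ a, (n : ℝ) ^ N a := by rw [Finset.prod_pow_eq_pow_sum, hN]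
        rw [g1, ← Finset.prod_div_distrib, ← Finset.prod_mul_distrib]
        refine Finset.prod_congr rfl fun a _ => ?_
        simp only [hp]
        rw [mul_pow, div_pow, ← Real.exp_nat_mul, ← Real.exp_sum]
        congr 2
        rw [← Finset.sum_neg_distrib, Finset.mul_sum]
        refine Finset.sum_congr rfl fun b _ => ?_
        have := hposR a
        simp only [hs]; field_simp
      rw [hA, f1]
      simp only [← hk]
      have f2 : (∏ a, ∏ b, s a b ^ k a b) * ∏ a, ∏ b, (N a : ℝ) ^ k a b = ∏ a, ∏ b, (k a b : ℝ) ^ k a b := by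
        simp only [← Finset.prod_mul_distrib, ← mul_pow]
        refine Finset.prod_congr rfl fun a _ => Finset.prod_congr rfl fun b _ => ?_
        have := hposR a
        simp only [hs]
        congr 1; field_simp
      rw [mul_assoc, f2]
      simp only [Finset.prod_mul_distrib]
      ring
    have e2 : A * Pfac k N * ((n.factorial : ℝ) * ∏ a, ∏ b, (N a : ℝ) ^ k a b) = Pfac k N * n.factorial * (A * ∏ a, ∏ b, (N a : ℝ) ^ k a b) := by ring
    rw [e2, e1]
    have hnf : Real.exp (-n) ≤ (n.factorial : ℝ) / (n : ℝ) ^ n := by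
      rw [le_div_iff₀ (by positivity)]; exact fac_lower n
    have hnexp : ∏ a, Real.exp (-(N a : ℝ)) = Real.exp (-n) := by
      rw [← Real.exp_sum, Finset.sum_neg_distrib, ← hN]; push_cast; rfl
    calc _ ≤ (∏ a, ∏ b, (Real.exp 1 * (k a b + 1) * (Real.exp (-(k a b : ℝ)) * (k a b : ℝ) ^ k a b))) *
          ∏ a, (Real.exp 1 * (N a + 1) * (Real.exp (-(N a : ℝ)) * (N a : ℝ) ^ N a)) :=
          mul_le_mul h1 h2 hNf.le (Finset.prod_nonneg fun a _ => Finset.prod_nonneg fun b _ => by positivity)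
      _ = Pfac k N * (∏ a, ((N a : ℝ) ^ N a)) * (∏ a, ∏ b, (Real.exp (-(k a b : ℝ)) * (k a b : ℝ) ^ k a b)) * Real.exp (-n) := by
          rw [← hnexp]
          unfold Pfac
          simp only [Finset.prod_mul_distrib]
          ring
      _ ≤ Pfac k N * (∏ a, ((N a : ℝ) ^ N a)) * (∏ a, ∏ b, (Real.exp (-(k a b : ℝ)) * (k a b : ℝ) ^ k a b)) * ((n.factorial : ℝ) / (n : ℝ) ^ n) := by
          refine mul_le_mul_of_nonneg_left hnf ?_
          unfold Pfac
          positivity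
      _ = _ := by ring
  have h3 : A * (∑ zf ∈ stubConf V α N, ∏ v, w (prof β zf.1 zf.2 v)) ≤ A * (#(stubConf V α N) * (Pfac k N * Z)) :=
    key.trans <| (mul_le_mul_of_nonneg_right hmain hZ0).trans (le_of_eq (by ring))
  exact le_of_mul_le_mul_left h3 hA0

theorem cheb (α β : D → B) (N : B → ℕ) (hN : ∑ a, N a = Fintype.card V) (hpos : ∀ a, 0 < N a)
    (S : Finset (B × (B → ℕ))) (h : B × (B → ℕ) → ℝ) (hS : ∀ x ∉ S, h x = 0) (lam : B → B → ℝ) (κ : B → ℝ) (θ : ℝ) :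
    (#{zf ∈ stubConf V α N | θ ≤ ∑ x ∈ S, h x * #{v | prof β zf.1 zf.2 v = x}} : ℝ) *
      Real.exp (θ + ∑ a, κ a * N a + ∑ a, ∑ b, lam a b * kk α β a b) ≤
    #(stubConf V α N) * (Pfac (kk α β) N *
      (∑' x, qq (fun a => (N a : ℝ) / Fintype.card V) (fun a b => (kk α β a b : ℝ) / Fintype.card V) x *
        Real.exp (gg h lam κ x)) ^ Fintype.card V) := by
  classical
  obtain ⟨H, hH⟩ := bdd_of_supp S h hS
  refine le_trans ?_ (E_bound (V := V) α β N hN hpos (fun x => Real.exp (gg h lam κ x)) (fun x => (Real.exp_nonneg _)) ?_)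
  · rw [← nsmul_eq_mul, ← Finset.sum_const]
    refine le_trans (Finset.sum_le_sum (g := fun zf : (V → B) × (D → V) => ∏ v, Real.exp (gg h lam κ (prof β zf.1 zf.2 v))) fun zf hzf => ?_)
      (Finset.sum_le_sum_of_subset_of_nonneg (Finset.filter_subset _ _) fun zf _ _ => Finset.prod_nonneg fun v _ => Real.exp_nonneg _)
    obtain ⟨hz, hθ⟩ := Finset.mem_filter.1 hzf
    obtain ⟨hz1, hz2⟩ := (Finset.mem_filter.1 hz).2
    rw [← Real.exp_sum]
    apply Real.exp_le_exp.2
    unfold gg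
    rw [Finset.sum_add_distrib, Finset.sum_add_distrib]
    have e1 : ∑ v, h (prof β zf.1 zf.2 v) = ∑ x ∈ S, h x * #{v | prof β zf.1 zf.2 v = x} := by
      have : ∀ v, h (prof β zf.1 zf.2 v) = ∑ x ∈ S, if prof β zf.1 zf.2 v = x then h x else 0 := by
        intro v
        rw [Finset.sum_ite_eq]
        split_ifs with hv
        · rfl
        · exact hS _ hv
      simp only [this]
      rw [Finset.sum_comm]
      refine Finset.sum_congr rfl fun x _ => ?_
      rw [← Finset.sum_filter, Finset.sum_const, nsmul_eq_mul, mul_comm]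
    have e2 : ∑ v, κ (prof β zf.1 zf.2 v).1 = ∑ a, κ a * N a := by
      rw [← Finset.sum_fiberwise univ zf.1]
      refine Finset.sum_congr rfl fun a _ => ?_
      rw [Finset.sum_congr rfl (g := fun _ => κ a), Finset.sum_const, hz1 a, nsmul_eq_mul, mul_comm]
      intro v hv
      rw [← (Finset.mem_filter.1 hv).2]; rfl
    have e3 : ∑ v, ∑ b, lam (prof β zf.1 zf.2 v).1 b * ((prof β zf.1 zf.2 v).2 b : ℝ) = ∑ a, ∑ b, lam a b * kk α β a b := by
      rw [← Finset.sum_fiberwise univ zf.1]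
      refine Finset.sum_congr rfl fun a _ => ?_
      rw [Finset.sum_comm]
      refine Finset.sum_congr rfl fun b _ => ?_
      rw [← prof_sum α β zf.1 zf.2 hz2 a b]
      push_cast
      rw [Finset.mul_sum]
      refine Finset.sum_congr rfl fun v hv => ?_
      rw [← (Finset.mem_filter.1 hv).2]; rfl
    rw [e1, e2, e3]
    linarith
  · refine summable_qq_exp _ _ (fun a => by positivity) (fun a => ?_) (fun a b => by positivity) h lam κ H hH
    refine div_le_one_of_le₀ ?_ (by positivity)
    rw [← hN]
    exact_mod_cast Finset.single_le_sum (f := N) (fun a _ => Nat.zero_le _) (mem_univ a)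

end cheb

/-! ### Part 11 -/

section fill

/-- total degree of a profile -/
def deg (x : B × (B → ℕ)) : ℕ := ∑ b, x.2 b

/-- the basic profiles -/
def Ebase (B : Type*) [Fintype B] [DecidableEq B] : Finset (B × (B → ℕ)) :=
  univ.image (fun a : B => (a, (0 : B → ℕ))) ∪ univ.image (fun ab : B × B => (ab.1, Pi.single ab.2 1))

theorem deg_zero (a : B) : deg (a, (0 : B → ℕ)) = 0 := by simp [deg]
theorem deg_single (a b : B) : deg (a, (Pi.single b 1 : B → ℕ)) = 1 := by
  simp [deg, Pi.single_apply]

theorem eq_zero_of_deg (x : B × (B → ℕ)) (h : deg x = 0) : x = (x.1, 0) := by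
  ext1
  · rfl
  · funext b
    simp only [deg, Finset.sum_eq_zero_iff, mem_univ, true_imp_iff] at h
    exact h b

theorem eq_single_of_deg (x : B × (B → ℕ)) (h : deg x = 1) : ∃ b, x = (x.1, Pi.single b 1) := by
  have h0 : ∃ b, x.2 b ≠ 0 := by
    by_contra hcon
    push Not at hcon
    simp [deg, hcon] at h
  obtain ⟨b, hb⟩ := h0
  refine ⟨b, ?_⟩
  ext1
  · rfl
  · funext b'
    unfold deg at h
    rw [← Finset.add_sum_erase _ _ (mem_univ b)] at h
    have h1 : x.2 b = 1 := by omega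
    have h2 : ∑ b ∈ univ.erase b, x.2 b = 0 := by omega
    by_cases hb' : b' = b
    · subst hb'; simp [h1]
    · simp only [Pi.single_apply, hb', if_false]
      exact (Finset.sum_eq_zero_iff.1 h2) b' (by simp [hb'])

theorem mem_Ebase (x : B × (B → ℕ)) : x ∈ Ebase B ↔ deg x ≤ 1 := by
  simp only [Ebase, Finset.mem_union, Finset.mem_image, mem_univ, true_and]
  constructor
  · rintro (⟨a, rfl⟩ | ⟨ab, rfl⟩)
    · rw [deg_zero]; omega
    · rw [deg_single]
  · intro h
    rcases Nat.le_one_iff_eq_zero_or_eq_one.1 h with h | h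
    · left; exact ⟨x.1, (eq_zero_of_deg x h).symm⟩
    · right; obtain ⟨b, hb⟩ := eq_single_of_deg x h; exact ⟨(x.1, b), hb.symm⟩

theorem sum_split {R : Type*} [AddCommMonoid R] (X : Finset (B × (B → ℕ))) (hX : Ebase B ⊆ X) (F : B × (B → ℕ) → R) (a : B) :
    ∑ x ∈ X with x.1 = a, F x = F (a, 0) + ∑ b, F (a, Pi.single b 1) + ∑ x ∈ X with x.1 = a ∧ 2 ≤ deg x, F x := by
  have h1 : X.filter (fun x => x.1 = a) = (insert (a, (0 : B → ℕ)) (univ.image fun b => (a, (Pi.single b 1 : B → ℕ)))) ∪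
      X.filter (fun x => x.1 = a ∧ 2 ≤ deg x) := by
    ext x
    simp only [Finset.mem_filter, Finset.mem_union, Finset.mem_insert, Finset.mem_image, mem_univ, true_and]
    constructor
    · rintro ⟨h1, h2⟩
      rcases le_or_gt 2 (deg x) with h | h
      · right; exact ⟨h1, h2, h⟩
      · left
        rcases Nat.le_one_iff_eq_zero_or_eq_one.1 (Nat.lt_succ_iff.1 h) with h | h
        · left; rw [← h2]; exact eq_zero_of_deg x h
        · right; obtain ⟨b, hb⟩ := eq_single_of_deg x h; exact ⟨b, by rw [← h2]; exact hb.symm⟩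
    · rintro ((rfl | ⟨b, rfl⟩) | ⟨h1, h2, h3⟩)
      · exact ⟨hX ((mem_Ebase _).2 (by rw [deg_zero]; omega)), rfl⟩
      · exact ⟨hX ((mem_Ebase _).2 (by rw [deg_single])), rfl⟩
      · exact ⟨h1, h2⟩
  rw [h1, Finset.sum_union, Finset.sum_insert, Finset.sum_image]
  · intro b _ b' _ h
    simp only [Prod.mk.injEq, true_and] at h
    have := congrFun h b
    by_contra hne
    simp [Pi.single_apply, hne] at this
  · simp only [Finset.mem_image, mem_univ, true_and, not_exists]
    intro b h
    have := congrArg deg h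
    rw [deg_zero, deg_single] at this
    omega
  · rw [Finset.disjoint_left]
    intro x hx hx'
    have h2 := (Finset.mem_filter.1 hx').2.2
    simp only [Finset.mem_insert, Finset.mem_image, mem_univ, true_and] at hx
    rcases hx with rfl | ⟨b, rfl⟩
    · rw [deg_zero] at h2; omega
    · rw [deg_single] at h2; omega

/-- mass put on `(a, e_b)` -/
def fillE {R : Type*} [CommRing R] (X : Finset (B × (B → ℕ))) (u : B × (B → ℕ) → R) (k : B → B → R) (a b : B) : R :=
  k a b - ∑ y ∈ X with y.1 = a ∧ 2 ≤ deg y, (y.2 b : R) * u y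

/-- fill in the basic profiles in order to satisfy the constraints -/
def fill {R : Type*} [CommRing R] (X : Finset (B × (B → ℕ))) (u : B × (B → ℕ) → R) (N : B → R) (k : B → B → R) (x : B × (B → ℕ)) : R :=
  if deg x = 0 then N x.1 - ∑ b, fillE X u k x.1 b - ∑ y ∈ X with y.1 = x.1 ∧ 2 ≤ deg y, u y
  else if deg x = 1 then ∑ b, (x.2 b : R) * fillE X u k x.1 b
  else u x

variable {R : Type*} [CommRing R] (X : Finset (B × (B → ℕ))) (u : B × (B → ℕ) → R) (N : B → R) (k : B → B → R)

theorem fill_zero (a : B) : fill X u N k (a, 0) = N a - ∑ b, fillE X u k a b - ∑ y ∈ X with y.1 = a ∧ 2 ≤ deg y, u y := by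
  unfold fill; rw [if_pos (deg_zero a)]

theorem fill_single (a b : B) : fill X u N k (a, Pi.single b 1) = fillE X u k a b := by
  unfold fill; rw [if_neg (by rw [deg_single]; omega), if_pos (deg_single a b)]
  simp [Pi.single_apply]

theorem fill_two (x : B × (B → ℕ)) (h : 2 ≤ deg x) : fill X u N k x = u x := by
  unfold fill; rw [if_neg (by omega), if_neg (by omega)]

theorem fill_N (hX : Ebase B ⊆ X) (a : B) : ∑ x ∈ X with x.1 = a, fill X u N k x = N a := by
  rw [sum_split X hX, fill_zero]
  simp only [fill_single]
  have e : ∑ x ∈ X with x.1 = a ∧ 2 ≤ deg x, fill X u N k x = ∑ x ∈ X with x.1 = a ∧ 2 ≤ deg x, u x :=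
    Finset.sum_congr rfl fun x hx => fill_two X u N k x (Finset.mem_filter.1 hx).2.2
  rw [e]
  ring

theorem fill_k (hX : Ebase B ⊆ X) (a b : B) : ∑ x ∈ X with x.1 = a, (x.2 b : R) * fill X u N k x = k a b := by
  rw [sum_split X hX]
  simp only [fill_single]
  rw [Finset.sum_congr rfl (s₂ := X.filter (fun x => x.1 = a ∧ 2 ≤ deg x)) (g := fun x => (x.2 b : R) * u x)]
  · simp [Pi.single_apply, fillE]
  · intro x hx; rw [fill_two X u N k x (Finset.mem_filter.1 hx).2.2]

end fill

/-! ### Part 12 -/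

section approx
variable (ϖ : B → ℝ) (ω : B → B → ℝ)

theorem qq_pos (hϖ : ∀ a, 0 < ϖ a) (hω : ∀ a b, 0 ≤ ω a b) (x : B × (B → ℕ)) (h : ∀ b, x.2 b ≠ 0 → 0 < ω x.1 b) : 0 < qq ϖ ω x := by
  unfold qq
  refine mul_pos (hϖ _) (Finset.prod_pos fun b _ => ?_)
  have h1 := hϖ x.1
  by_cases hb : x.2 b = 0
  · simp [hb]; positivity
  · have := h b hb
    positivity

theorem qq_zero (x : B × (B → ℕ)) (b : B) (hb : x.2 b ≠ 0) (h : ω x.1 b = 0) : qq ϖ ω x = 0 := by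
  unfold qq
  rw [Finset.prod_eq_zero (mem_univ b), mul_zero]
  simp [h, hb]

theorem hasSum_qq_a (hϖ : ∀ a, 0 ≤ ϖ a) (hω : ∀ a b, 0 ≤ ω a b) (a : B) : HasSum (fun σ => qq ϖ ω (a, σ)) (ϖ a) := by
  unfold qq
  have : HasSum (fun σ : B → ℕ => ∏ b : B, Real.exp (-(ω a b / ϖ a)) * (ω a b / ϖ a) ^ (σ b) / (Nat.factorial (σ b) : ℝ)) (∏ b : B, 1) := by
    refine hasSum_pi (fun b k => Real.exp (-(ω a b / ϖ a)) * (ω a b / ϖ a) ^ k / (Nat.factorial k : ℝ)) _ ?_ ?_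
    · intro b k
      have := hϖ a
      have := hω a b
      positivity
    · intro b
      have := (hasSum_exp (ω a b / ϖ a)).mul_left (Real.exp (-(ω a b / ϖ a)))
      rw [← Real.exp_add] at this
      simpa [mul_div_assoc] using this
  simpa using this.mul_left (ϖ a)

theorem consis_qq (hϖ : ∀ a, 0 < ϖ a) (hω : ∀ a b, 0 ≤ ω a b) : consis ϖ ω (qq ϖ ω) :=
  ⟨hasSum_qq_a ϖ ω (fun a => (hϖ a).le) hω, hasSum_qq_moment ϖ ω hϖ hω⟩

theorem consis_zero (p : B × (B → ℕ) → ℝ) (hp : ∀ x, 0 ≤ p x) (hc : consis ϖ ω p) (x : B × (B → ℕ)) (b : B)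
    (hb : x.2 b ≠ 0) (h : ω x.1 b = 0) : p x = 0 := by
  have h1 := hc.2 x.1 b
  rw [h] at h1
  have h2 := (hasSum_zero_iff_of_nonneg (fun σ : B → ℕ => mul_nonneg (Nat.cast_nonneg (σ b)) (hp (x.1, σ)))).1 h1
  have h3 := congrFun h2 x.2
  simp at h3
  rcases h3 with h3 | h3
  · exact absurd h3 hb
  · exact h3

theorem ent_self (q : ℝ) : ent q q = 0 := by
  unfold ent
  by_cases h : q = 0
  · simp [h]
  · simp [div_self h]

theorem ent_convex (p q ε : ℝ) (hp : 0 ≤ p) (hq : 0 ≤ q) (hpq : q = 0 → p = 0) (h0 : 0 ≤ ε) (h1 : ε ≤ 1) :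
    ent ((1 - ε) * p + ε * q) q ≤ (1 - ε) * ent p q := by
  set v := (1 - ε) * p + ε * q with hv
  have h1' : 0 ≤ 1 - ε := by linarith
  have hv0 : 0 ≤ v := by positivity
  rcases hv0.eq_or_lt with h | h
  · have e1 : (1 - ε) * p = 0 := by
      have a1 : 0 ≤ (1 - ε) * p := by positivity
      have a2 : 0 ≤ ε * q := by positivity
      linarith
    have e2 : (1 - ε) * (p * Real.log (p / q)) = 0 := by rw [← mul_assoc, e1, zero_mul]
    have e3 : ε * q = 0 := by linarith
    rw [← h]
    unfold ent
    simp
    nlinarith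
  · have hq' : 0 < q := by
      refine lt_of_le_of_ne hq fun h' => ?_
      rw [hv, hpq h'.symm, ← h'] at h
      simp at h
    have y1 := young p q (Real.log (v / q)) hp hq hpq
    have y2 := young q q (Real.log (v / q)) hq hq id
    rw [ent_self] at y2
    rw [Real.exp_log (by positivity)] at y1 y2
    have e : q * (v / q) = v := by field_simp
    rw [e] at y1 y2
    have : ent v q = (1 - ε) * (Real.log (v / q) * p - (v - q)) + ε * (Real.log (v / q) * q - (v - q)) := by
      unfold ent
      conv_lhs => enter [1,1,1]; rw [hv]
      ring
    rw [this]
    nlinarith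

theorem hasSum_two (F : B × (B → ℕ) → ℝ) (a : B) (s : ℝ) (h : HasSum (fun σ => F (a, σ)) s) :
    HasSum (fun x : B × (B → ℕ) => if x.1 = a ∧ 2 ≤ deg x then F x else 0) (s - (F (a, 0) + ∑ b, F (a, Pi.single b 1))) := by
  have h1 : HasSum (fun x : B × (B → ℕ) => if x.1 = a then F x else 0) s := by
    have : HasSum (fun x : B × (B → ℕ) => if x.1 = a then F x else 0) (∑ a', if a' = a then s else 0) := by
      refine hasSum_B _ _ fun a' => ?_
      by_cases ha : a' = a
      · subst ha; simpa using h
      · simpa [ha] using hasSum_zero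
    simpa using this
  have h2 : HasSum (fun x : B × (B → ℕ) => if x.1 = a ∧ ¬ 2 ≤ deg x then F x else 0) (∑ x ∈ Ebase B, if x.1 = a ∧ ¬ 2 ≤ deg x then F x else 0) :=
    hasSum_sum_of_ne_finset_zero fun x hx => by
      rw [mem_Ebase] at hx
      rw [if_neg]; rintro ⟨-, h⟩; omega
  have h3 : (∑ x ∈ Ebase B, if x.1 = a ∧ ¬ 2 ≤ deg x then F x else 0) = F (a, 0) + ∑ b, F (a, Pi.single b 1) := by
    have e := sum_split (Ebase B) subset_rfl F a
    rw [Finset.sum_filter (fun x : B × (B → ℕ) => x.1 = a ∧ 2 ≤ deg x), Finset.sum_eq_zero (s := Ebase B), add_zero, Finset.sum_filter] at e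
    · rw [← e]
      refine Finset.sum_congr rfl fun x hx => ?_
      rw [mem_Ebase] at hx
      have : ¬ 2 ≤ deg x := by omega
      simp [this]
    · intro x hx
      rw [mem_Ebase] at hx
      rw [if_neg]; rintro ⟨-, h⟩; omega
  rw [h3] at h2
  refine (h1.sub h2).congr_fun ?_ |> fun h => h
  intro x
  by_cases h1 : x.1 = a <;> by_cases h2 : 2 ≤ deg x <;> simp [h1, h2]

theorem tendsto_two (F : B × (B → ℕ) → ℝ) (a : B) (s : ℝ) (h : HasSum (fun σ => F (a, σ)) s) :
    Tendsto (fun X : Finset (B × (B → ℕ)) => ∑ x ∈ X with x.1 = a ∧ 2 ≤ deg x, F x) atTop (𝓝 (s - (F (a, 0) + ∑ b, F (a, Pi.single b 1)))) := by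
  have := hasSum_two F a s h
  simp only [Finset.sum_filter]
  simpa [HasSum] using this

theorem tendsto_fillE (u : B × (B → ℕ) → ℝ) (hc : consis ϖ ω u) (a b : B) :
    Tendsto (fun X : Finset (B × (B → ℕ)) => fillE X u ω a b) atTop (𝓝 (u (a, Pi.single b 1))) := by
  unfold fillE
  have := (tendsto_two (fun x => (x.2 b : ℝ) * u x) a _ (hc.2 a b)).const_sub (ω a b)
  simpa [Pi.single_apply] using this

theorem tendsto_fill (u : B × (B → ℕ) → ℝ) (hc : consis ϖ ω u) (x : B × (B → ℕ)) :
    Tendsto (fun X : Finset (B × (B → ℕ)) => fill X u ϖ ω x) atTop (𝓝 (u x)) := by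
  rcases le_or_gt 2 (deg x) with h | h
  · simp only [fill_two _ u ϖ ω x h]; exact tendsto_const_nhds
  · rcases Nat.le_one_iff_eq_zero_or_eq_one.1 (Nat.lt_succ_iff.1 h) with h | h
    · rw [eq_zero_of_deg x h]
      simp only [fill_zero]
      have h1 := (tendsto_two u x.1 _ (hc.1 x.1))
      have h2 := tendsto_finset_sum univ fun b (_ : b ∈ univ) => tendsto_fillE ϖ ω u hc x.1 b
      have h3 := (h2.const_sub (ϖ x.1)).sub h1
      refine h3.congr' ?_ |>.trans (le_of_eq ?_)
      · exact Eventually.of_forall fun X => rfl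
      · congr 1; ring
    · obtain ⟨b, hb⟩ := eq_single_of_deg x h
      rw [hb]
      simp only [fill_single]
      exact tendsto_fillE ϖ ω u hc x.1 b

theorem continuous_tlog (q : ℝ) : Continuous fun t : ℝ => t * Real.log (t / q) := by
  by_cases h : q = 0
  · simp [h]; exact continuous_const
  · have : (fun t : ℝ => t * Real.log (t / q)) = fun t => t * Real.log t - t * Real.log q := by
      funext t
      by_cases ht : t = 0
      · simp [ht]
      · rw [Real.log_div ht h]; ring
    rw [this]
    exact Real.continuous_mul_log.sub (continuous_id.mul continuous_const)

theorem approx (hϖ : ∀ a, 0 < ϖ a) (hϖ1 : ∑ a, ϖ a = 1) (hω : ∀ a b, 0 ≤ ω a b)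
    (p : B × (B → ℕ) → ℝ) (hp : ∀ x, 0 ≤ p x) (hc : consis ϖ ω p) (hac : ∀ x, qq ϖ ω x = 0 → p x = 0)
    (hs : Summable fun x => ent (p x) (qq ϖ ω x)) (δ : ℝ) (hδ : 0 < δ) (S0 : Finset (B × (B → ℕ))) (η : ℝ) (hη : 0 < η) :
    ∃ (X : Finset (B × (B → ℕ))) (u : B × (B → ℕ) → ℝ), Ebase B ⊆ X ∧ S0 ⊆ X ∧ (∀ x, 0 ≤ u x) ∧
      (∀ x b, x.2 b ≠ 0 → ω x.1 b = 0 → u x = 0) ∧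
      (∀ a, 0 < fill X u ϖ ω (a, 0)) ∧ (∀ a b, 0 < ω a b → 0 < fill X u ϖ ω (a, Pi.single b 1)) ∧
      (∀ x ∈ S0, |fill X u ϖ ω x - p x| < η) ∧
      ∑ x ∈ X, fill X u ϖ ω x * Real.log (fill X u ϖ ω x / qq ϖ ω x) < ∑' x, ent (p x) (qq ϖ ω x) + δ := by
  have hq := qq_nonneg ϖ ω (fun a => (hϖ a).le) hω
  have hcq := consis_qq ϖ ω hϖ hω
  have hple : ∀ (p : B × (B → ℕ) → ℝ), (∀ x, 0 ≤ p x) → consis ϖ ω p → HasSum p 1 := by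
    intro p hp hc
    have := hasSum_B p ϖ hc.1
    rwa [hϖ1] at this
  have hp1 := hple p hp hc
  have hq1 := hple _ hq hcq
  have hplt : ∀ x, p x ≤ 1 := fun x => le_hasSum hp1 x fun y _ => hp y
  have hqlt : ∀ x, qq ϖ ω x ≤ 1 := fun x => le_hasSum hq1 x fun y _ => hq y
  obtain ⟨ε, hε0, hε1, hεη⟩ : ∃ ε : ℝ, 0 < ε ∧ ε ≤ 1 ∧ ε < η / 2 :=
    ⟨min 1 (η / 4), by positivity, min_le_left _ _, (min_le_right _ _).trans_lt (by linarith)⟩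
  set u : B × (B → ℕ) → ℝ := fun x => (1 - ε) * p x + ε * qq ϖ ω x with hu
  have hu0 : ∀ x, 0 ≤ u x := fun x => add_nonneg (mul_nonneg (by linarith) (hp x)) (mul_nonneg hε0.le (hq x))
  have hcu : consis ϖ ω u := by
    refine ⟨fun a => ?_, fun a b => ?_⟩
    · have := ((hc.1 a).mul_left (1 - ε)).add ((hcq.1 a).mul_left ε)
      rwa [show (1 - ε) * ϖ a + ε * ϖ a = ϖ a by ring] at this
    · have := ((hc.2 a b).mul_left (1 - ε)).add ((hcq.2 a b).mul_left ε)
      rw [show (1 - ε) * ω a b + ε * ω a b = ω a b by ring] at this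
      refine this.congr_fun ?_ |> fun h => h
      intro σ; simp only [hu]; ring
  have hu1 := hple u hu0 hcu
  have hacu : ∀ x, qq ϖ ω x = 0 → u x = 0 := fun x hx => by simp [hu, hx, hac x hx]
  have hent0 : ∀ x, 0 ≤ ent (u x) (qq ϖ ω x) := fun x => ent_nonneg _ _ (hu0 x) (hq x) (hacu x)
  have hentle : ∀ x, ent (u x) (qq ϖ ω x) ≤ (1 - ε) * ent (p x) (qq ϖ ω x) := fun x =>
    ent_convex _ _ _ (hp x) (hq x) (hac x) hε0.le hε1
  have hentle' : ∀ x, ent (u x) (qq ϖ ω x) ≤ ent (p x) (qq ϖ ω x) := fun x => by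
    have := ent_nonneg _ _ (hp x) (hq x) (hac x)
    nlinarith [hentle x]
  have hsu : Summable fun x => ent (u x) (qq ϖ ω x) := Summable.of_nonneg_of_le hent0 hentle' hs
  have hle : ∑' x, ent (u x) (qq ϖ ω x) ≤ ∑' x, ent (p x) (qq ϖ ω x) := hsu.tsum_le_tsum hentle' hs
  have hlog : HasSum (fun x => u x * Real.log (u x / qq ϖ ω x)) (∑' x, ent (u x) (qq ϖ ω x)) := by
    have := (hsu.hasSum.add hu1).sub hq1
    rw [add_sub_cancel_right] at this
    refine this.congr_fun ?_ |> fun h => h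
    intro x; unfold ent; ring
  have hF : Tendsto (fun X : Finset (B × (B → ℕ)) => ∑ x ∈ X, u x * Real.log (u x / qq ϖ ω x) +
      ∑ x ∈ Ebase B, (fill X u ϖ ω x * Real.log (fill X u ϖ ω x / qq ϖ ω x) - u x * Real.log (u x / qq ϖ ω x))) atTop
      (𝓝 (∑' x, ent (u x) (qq ϖ ω x) + ∑ x ∈ Ebase B, (u x * Real.log (u x / qq ϖ ω x) - u x * Real.log (u x / qq ϖ ω x)))) := by
    refine Tendsto.add (by simpa [HasSum] using hlog) (tendsto_finset_sum _ fun x _ => Tendsto.sub_const ?_ _)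
    exact ((continuous_tlog (qq ϖ ω x)).tendsto _).comp (tendsto_fill ϖ ω u hcu x)
  simp only [sub_self, Finset.sum_const_zero, add_zero] at hF
  have ev1 := hF.eventually_lt_const (show ∑' x, ent (u x) (qq ϖ ω x) < ∑' x, ent (p x) (qq ϖ ω x) + δ by linarith)
  have ev2 : ∀ᶠ X : Finset (B × (B → ℕ)) in atTop, ∀ a, 0 < fill X u ϖ ω (a, 0) := by
    rw [eventually_all]; intro a
    refine (tendsto_fill ϖ ω u hcu (a, 0)).eventually_const_lt ?_
    have : 0 < qq ϖ ω (a, 0) := qq_pos ϖ ω hϖ hω _ fun b hb => absurd rfl hb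
    exact add_pos_of_nonneg_of_pos (mul_nonneg (by linarith) (hp _)) (mul_pos hε0 this)
  have ev3 : ∀ᶠ X : Finset (B × (B → ℕ)) in atTop, ∀ a b, 0 < ω a b → 0 < fill X u ϖ ω (a, Pi.single b 1) := by
    rw [eventually_all]; intro a
    rw [eventually_all]; intro b
    by_cases hab : 0 < ω a b
    · filter_upwards [(tendsto_fill ϖ ω u hcu (a, Pi.single b 1)).eventually_const_lt (u := 0) (by
        have : 0 < qq ϖ ω (a, Pi.single b 1) := qq_pos ϖ ω hϖ hω _ fun b' hb => by
          have : b' = b := by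
            by_contra hne
            simp [Pi.single_apply, hne] at hb
          subst this; exact hab
        exact add_pos_of_nonneg_of_pos (mul_nonneg (by linarith) (hp _)) (mul_pos hε0 this))] with X hX _ using hX
    · exact Eventually.of_forall fun X h => absurd h hab
  have ev4 : ∀ᶠ X : Finset (B × (B → ℕ)) in atTop, ∀ x ∈ S0, |fill X u ϖ ω x - p x| < η := by
    rw [Filter.eventually_all_finset]; intro x hx
    have h1 : Tendsto (fun X => |fill X u ϖ ω x - p x|) atTop (𝓝 |u x - p x|) := ((tendsto_fill ϖ ω u hcu x).sub_const _).abs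
    refine h1.eventually_lt_const ?_
    have : u x - p x = ε * (qq ϖ ω x - p x) := by simp only [hu]; ring
    rw [this, abs_mul, abs_of_pos hε0]
    have : |qq ϖ ω x - p x| ≤ 1 := by
      rw [abs_le]; constructor <;> linarith [hp x, hq x, hplt x, hqlt x]
    nlinarith
  obtain ⟨X, h1, h2, h3, h4, h5, h6⟩ := (ev1.and (ev2.and (ev3.and (ev4.and ((eventually_ge_atTop (Ebase B)).and (eventually_ge_atTop S0)))))).exists
  refine ⟨X, u, h5, h6, hu0, ?_, h2, h3, h4, ?_⟩
  · intro x b hb hx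
    exact consis_zero ϖ ω u hu0 hcu x b hb hx
  · refine lt_of_le_of_lt (le_of_eq ?_) h1
    rw [← Finset.sum_sdiff (f := fun x => u x * Real.log (u x / qq ϖ ω x)) h5, Finset.sum_sub_distrib,
      ← Finset.sum_sdiff h5]
    have : ∑ x ∈ X \ Ebase B, fill X u ϖ ω x * Real.log (fill X u ϖ ω x / qq ϖ ω x) = ∑ x ∈ X \ Ebase B, u x * Real.log (u x / qq ϖ ω x) := by
      refine Finset.sum_congr rfl fun x hx => ?_
      have h7 := (Finset.mem_sdiff.1 hx).2
      rw [mem_Ebase] at h7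
      rw [fill_two X u ϖ ω x (by omega)]
    rw [this]
    ring

end approx

/-! ### Part 13 -/

section rounding

theorem fill_div (X : Finset (B × (B → ℕ))) (u : B × (B → ℕ) → ℤ) (N : B → ℤ) (k : B → B → ℤ) (r : ℝ) (x : B × (B → ℕ)) :
    ((fill X u N k x : ℤ) : ℝ) / r = fill X (fun x => (u x : ℝ) / r) (fun a => (N a : ℝ) / r) (fun a b => (k a b : ℝ) / r) x := by
  have hE : ∀ a b, ((fillE X u k a b : ℤ) : ℝ) / r = fillE X (fun x => (u x : ℝ) / r) (fun a b => (k a b : ℝ) / r) a b := by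
    intro a b
    unfold fillE
    push_cast
    rw [sub_div, Finset.sum_div]
    simp only [mul_div_assoc]
  unfold fill
  split_ifs
  · push_cast
    rw [sub_div, sub_div, Finset.sum_div, Finset.sum_div]
    simp only [hE]
  · push_cast
    rw [Finset.sum_div]
    simp only [mul_div_assoc, hE]
  · rfl

theorem fill_tendsto (X : Finset (B × (B → ℕ))) (u : B × (B → ℕ) → ℝ) (N : B → ℝ) (k : B → B → ℝ)
    (un : ℕ → B × (B → ℕ) → ℝ) (Nn : ℕ → B → ℝ) (kn : ℕ → B → B → ℝ)
    (hu : ∀ x, Tendsto (fun n => un n x) atTop (𝓝 (u x)))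
    (hN : ∀ a, Tendsto (fun n => Nn n a) atTop (𝓝 (N a)))
    (hk : ∀ a b, Tendsto (fun n => kn n a b) atTop (𝓝 (k a b))) (x : B × (B → ℕ)) :
    Tendsto (fun n => fill X (un n) (Nn n) (kn n) x) atTop (𝓝 (fill X u N k x)) := by
  have hE : ∀ a b, Tendsto (fun n => fillE X (un n) (kn n) a b) atTop (𝓝 (fillE X u k a b)) := by
    intro a b
    unfold fillE
    exact (hk a b).sub (tendsto_finset_sum _ fun y _ => (hu y).const_mul _)
  unfold fill
  split_ifs
  · exact ((hN _).sub (tendsto_finset_sum _ fun b _ => hE _ _)).sub (tendsto_finset_sum _ fun y _ => hu y)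
  · exact tendsto_finset_sum _ fun b _ => (hE _ _).const_mul _
  · exact hu x

theorem rounding (ϖ : B → ℝ) (ω : B → B → ℝ) (hω : ∀ a b, 0 ≤ ω a b) (X : Finset (B × (B → ℕ))) (u : B × (B → ℕ) → ℝ)
    (hE : Ebase B ⊆ X) (hu0 : ∀ x, 0 ≤ u x) (huz : ∀ x b, x.2 b ≠ 0 → ω x.1 b = 0 → u x = 0)
    (hf0 : ∀ a, 0 < fill X u ϖ ω (a, 0)) (hf1 : ∀ a b, 0 < ω a b → 0 < fill X u ϖ ω (a, Pi.single b 1))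
    (N : ℕ → B → ℕ) (k : ℕ → B → B → ℕ)
    (hN : ∀ a, Tendsto (fun n : ℕ => (N n a : ℝ) / n) atTop (𝓝 (ϖ a)))
    (hk : ∀ a b, Tendsto (fun n : ℕ => (k n a b : ℝ) / n) atTop (𝓝 (ω a b))) :
    ∃ c : ℕ → B × (B → ℕ) → ℕ, (∀ᶠ n in atTop, (∀ a, ∑ x ∈ X with x.1 = a, c n x = N n a) ∧
        ∀ a b, ∑ x ∈ X with x.1 = a, x.2 b * c n x = k n a b) ∧
      ∀ x ∈ X, Tendsto (fun n => (c n x : ℝ) / n) atTop (𝓝 (fill X u ϖ ω x)) := by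
  set un : ℕ → B × (B → ℕ) → ℤ := fun n x => ⌊(n : ℝ) * u x⌋ with hun
  set f : ℕ → B × (B → ℕ) → ℤ := fun n x => fill X (un n) (fun a => (N n a : ℤ)) (fun a b => (k n a b : ℤ)) x with hf
  have hul : ∀ x, Tendsto (fun n : ℕ => (un n x : ℝ) / n) atTop (𝓝 (u x)) := by
    intro x
    have h1 := (tendsto_nat_floor_mul_div_atTop (hu0 x)).comp (tendsto_natCast_atTop_atTop (R := ℝ))
    refine h1.congr fun n => ?_
    simp only [Function.comp, hun]
    rw [← natCast_floor_eq_intCast_floor (mul_nonneg (Nat.cast_nonneg n) (hu0 x)), mul_comm]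
  have hfl : ∀ x, Tendsto (fun n : ℕ => (f n x : ℝ) / n) atTop (𝓝 (fill X u ϖ ω x)) := by
    intro x
    simp only [hf, fill_div]
    exact fill_tendsto X u ϖ ω _ _ _ hul (by simpa using hN) (by simpa using hk) x
  have hpos : ∀ x, 0 < fill X u ϖ ω x → ∀ᶠ n in atTop, 0 ≤ f n x := by
    intro x hx
    filter_upwards [(hfl x).eventually_const_lt hx, eventually_gt_atTop 0] with n hn hn0
    have hn0' : (0 : ℝ) < n := by exact_mod_cast hn0
    have h2 : (0 : ℝ) < f n x := by
      rw [lt_div_iff₀ hn0'] at hn; linarith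
    exact_mod_cast h2.le
  have hnn : ∀ x, ∀ᶠ n in atTop, 0 ≤ f n x := by
    intro x
    rcases le_or_gt 2 (deg x) with h | h
    · refine Eventually.of_forall fun n => ?_
      simp only [hf, fill_two _ _ _ _ x h, hun]
      exact Int.floor_nonneg.2 (mul_nonneg (Nat.cast_nonneg n) (hu0 x))
    · rcases Nat.le_one_iff_eq_zero_or_eq_one.1 (Nat.lt_succ_iff.1 h) with h | h
      · rw [eq_zero_of_deg x h]
        exact hpos _ (hf0 _)
      · obtain ⟨b, hb⟩ := eq_single_of_deg x h
        rw [hb]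
        rcases (hω x.1 b).lt_or_eq with hlt | heq
        · exact hpos _ (hf1 _ _ hlt)
        · refine Eventually.of_forall fun n => ?_
          simp only [hf, fill_single, fillE]
          rw [Finset.sum_eq_zero]
          · simp
          · intro y hy
            by_cases hyb : y.2 b = 0
            · simp [hyb]
            · have : u y = 0 := huz y b hyb (by rw [(Finset.mem_filter.1 hy).2.1]; exact heq.symm)
              simp [hun, this]
  have hall : ∀ᶠ n in atTop, ∀ x ∈ X, 0 ≤ f n x := (Filter.eventually_all_finset X).2 fun x _ => hnn x
  refine ⟨fun n x => (f n x).toNat, ?_, ?_⟩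
  · filter_upwards [hall] with n hn
    constructor
    · intro a
      have h1 := fill_N X (un n) (fun a => (N n a : ℤ)) (fun a b => (k n a b : ℤ)) hE a
      zify
      rw [← h1]
      refine Finset.sum_congr rfl fun x hx => ?_
      rw [Int.toNat_of_nonneg (hn x (Finset.mem_filter.1 hx).1)]
    · intro a b
      have h1 := fill_k X (un n) (fun a => (N n a : ℤ)) (fun a b => (k n a b : ℤ)) hE a b
      zify
      rw [← h1]
      refine Finset.sum_congr rfl fun x hx => ?_
      rw [Int.toNat_of_nonneg (hn x (Finset.mem_filter.1 hx).1)]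
  · intro x hx
    refine (hfl x).congr' ?_
    filter_upwards [hall] with n hn
    congr 1
    have := Int.toNat_of_nonneg (hn x hx)
    exact_mod_cast this.symm

end rounding

/-! ### Part 14 -/

section stirling

/-- the entropy functional arising from Stirling's formula -/
noncomputable def Phi (X : Finset (B × (B → ℕ))) (c : B × (B → ℕ) → ℝ) (N : B → ℝ) (k : B → B → ℝ) : ℝ :=
  ∑ a, ∑ b, (k a b * Real.log (k a b) - k a b - k a b * Real.log (N a)) + ∑ a, N a * Real.log (N a)
    - ∑ x ∈ X, c x * Real.log (c x) - ∑ x ∈ X, c x * ∑ b, Real.log ((x.2 b).factorial : ℝ)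

theorem tlog_div (t r : ℝ) (hr : 0 < r) : t * Real.log t = r * (t / r * Real.log (t / r)) + t * Real.log r := by
  by_cases ht : t = 0
  · simp [ht]
  · rw [Real.log_div ht hr.ne']; field_simp; ring

theorem Phi_scale (X : Finset (B × (B → ℕ))) (c : B × (B → ℕ) → ℝ) (N : B → ℝ) (k : B → B → ℝ) (hN : ∀ a, 0 < N a)
    (hcN : ∑ x ∈ X, c x = ∑ a, N a) (r : ℝ) (hr : 0 < r) :
    Phi X c N k = r * Phi X (fun x => c x / r) (fun a => N a / r) (fun a b => k a b / r) := by
  unfold Phi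
  have e1 : ∀ a b, (k a b * Real.log (k a b) - k a b - k a b * Real.log (N a)) =
      r * (k a b / r * Real.log (k a b / r) - k a b / r - k a b / r * Real.log (N a / r)) := by
    intro a b
    rw [tlog_div _ r hr, Real.log_div (hN a).ne' hr.ne']
    field_simp; ring
  have e2 : ∑ a, N a * Real.log (N a) = r * ∑ a, N a / r * Real.log (N a / r) + (∑ a, N a) * Real.log r := by
    rw [Finset.mul_sum, Finset.sum_mul, ← Finset.sum_add_distrib]
    exact Finset.sum_congr rfl fun a _ => tlog_div _ r hr
  have e3 : ∑ x ∈ X, c x * Real.log (c x) = r * ∑ x ∈ X, c x / r * Real.log (c x / r) + (∑ x ∈ X, c x) * Real.log r := by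
    rw [Finset.mul_sum, Finset.sum_mul, ← Finset.sum_add_distrib]
    exact Finset.sum_congr rfl fun a _ => tlog_div _ r hr
  have e4 : ∑ x ∈ X, c x * ∑ b, Real.log ((x.2 b).factorial : ℝ) = r * ∑ x ∈ X, c x / r * ∑ b, Real.log ((x.2 b).factorial : ℝ) := by
    rw [Finset.mul_sum]
    exact Finset.sum_congr rfl fun a _ => by field_simp
  rw [e2, e3, e4, hcN]
  simp only [e1]
  simp only [← Finset.mul_sum]
  ring

theorem typeClass_lower {V D : Type*} [Fintype V] [DecidableEq V] [Fintype D] [DecidableEq D]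
    (α β : D → B) (N : B → ℕ) (X : Finset (B × (B → ℕ))) (c : B × (B → ℕ) → ℕ)
    (hc : ∑ x ∈ X, c x = Fintype.card V) (hcN : ∀ a, ∑ x ∈ X with x.1 = a, c x = N a)
    (hck : ∀ a b, ∑ x ∈ X with x.1 = a, x.2 b * c x = kk α β a b)
    (hN : ∑ a, N a = Fintype.card V) (hpos : ∀ a, 0 < N a) (hV : 0 < Fintype.card V) :
    (#(stubConf V α N) : ℝ) * Real.exp (Fintype.card V * Phi X (fun x => (c x : ℝ) / Fintype.card V)
        (fun a => (N a : ℝ) / Fintype.card V) (fun a b => (kk α β a b : ℝ) / Fintype.card V)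
        - #X * (1 + Real.log (Fintype.card V + 1))) ≤
      #{zf ∈ stubConf V α N | (∀ v, prof β zf.1 zf.2 v ∈ X) ∧ ∀ x ∈ X, #{v | prof β zf.1 zf.2 v = x} = c x} := by
  set n := Fintype.card V with hn
  have hnR : (0 : ℝ) < n := by exact_mod_cast hV
  have h1 := card_stubConf (V := V) α β N hN
  have h2 := card_typeClass (V := V) α β N X c hc hcN hck
  rw [← Phi_scale X (fun x => (c x : ℝ)) (fun a => (N a : ℝ)) (fun a b => (kk α β a b : ℝ)) (fun a => by exact_mod_cast hpos a)
    (by exact_mod_cast hc.trans hN.symm) n hnR]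
  set S := #(stubConf V α N)
  set S' := #{zf ∈ stubConf V α N | (∀ v, prof β zf.1 zf.2 v ∈ X) ∧ ∀ x ∈ X, #{v | prof β zf.1 zf.2 v = x} = c x}
  have hS : 0 < S := by
    rcases Nat.eq_zero_or_pos S with h | h
    · rw [h, zero_mul] at h1
      have : 0 < n.factorial * ∏ a, ∏ b, N a ^ kk α β a b :=
        Nat.mul_pos (Nat.factorial_pos _) (Finset.prod_pos fun a _ => Finset.prod_pos fun b _ => Nat.pow_pos (hpos a))
      exact absurd h1 this.ne
    · exact h
  have hS' : 0 < S' := by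
    rcases Nat.eq_zero_or_pos S' with h | h
    · rw [h, zero_mul] at h2
      have : 0 < n.factorial * ∏ a, ∏ b, (kk α β a b).factorial :=
        Nat.mul_pos (Nat.factorial_pos _) (Finset.prod_pos fun a _ => Finset.prod_pos fun b _ => Nat.factorial_pos _)
      exact absurd h2 this.ne
    · exact h
  have hSR : (0 : ℝ) < S := by exact_mod_cast hS
  have hSR' : (0 : ℝ) < S' := by exact_mod_cast hS'
  have hfac : ∀ j : ℕ, (j.factorial : ℝ) ≠ 0 := fun j => by exact_mod_cast (Nat.factorial_pos j).ne'
  have hNne : ∀ a, (N a : ℝ) ≠ 0 := fun a => by exact_mod_cast (hpos a).ne'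
  have l1 : Real.log S + ∑ a, Real.log ((N a).factorial : ℝ) = Real.log (n.factorial : ℝ) + ∑ a, ∑ b, kk α β a b * Real.log (N a) := by
    have := congrArg (fun t : ℕ => Real.log (t : ℝ)) h1
    push_cast at this
    rw [Real.log_mul hSR.ne' (Finset.prod_ne_zero_iff.2 fun a _ => hfac _), Real.log_prod (fun a _ => hfac _),
      Real.log_mul (hfac _) (Finset.prod_ne_zero_iff.2 fun a _ => Finset.prod_ne_zero_iff.2 fun b _ => pow_ne_zero _ (hNne a)),
      Real.log_prod (fun a _ => Finset.prod_ne_zero_iff.2 fun b _ => pow_ne_zero _ (hNne a))] at this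
    rw [this]
    congr 1
    refine Finset.sum_congr rfl fun a _ => ?_
    rw [Real.log_prod (fun b _ => pow_ne_zero _ (hNne a))]
    simp only [Real.log_pow]
  have hpp : ∀ x : B × (B → ℕ), (∏ b, ((x.2 b).factorial : ℝ)) ≠ 0 := fun x => Finset.prod_ne_zero_iff.2 fun b _ => hfac _
  have l2 : Real.log S' + (∑ x ∈ X, Real.log ((c x).factorial : ℝ) + ∑ x ∈ X, c x * ∑ b, Real.log ((x.2 b).factorial : ℝ)) =
      Real.log (n.factorial : ℝ) + ∑ a, ∑ b, Real.log ((kk α β a b).factorial : ℝ) := by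
    have := congrArg (fun t : ℕ => Real.log (t : ℝ)) h2
    push_cast at this
    rw [Real.log_mul hSR'.ne' (mul_ne_zero (Finset.prod_ne_zero_iff.2 fun a _ => hfac _) (Finset.prod_ne_zero_iff.2 fun x _ => pow_ne_zero _ (hpp x))),
      Real.log_mul (Finset.prod_ne_zero_iff.2 fun a _ => hfac _) (Finset.prod_ne_zero_iff.2 fun x _ => pow_ne_zero _ (hpp x)),
      Real.log_prod (fun a _ => hfac _), Real.log_prod (fun x _ => pow_ne_zero _ (hpp x)),
      Real.log_mul (hfac _) (Finset.prod_ne_zero_iff.2 fun a _ => Finset.prod_ne_zero_iff.2 fun b _ => hfac _),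
      Real.log_prod (fun a _ => Finset.prod_ne_zero_iff.2 fun b _ => hfac _)] at this
    have e1 : ∀ x ∈ X, Real.log ((∏ b, ((x.2 b).factorial : ℝ)) ^ c x) = c x * ∑ b, Real.log ((x.2 b).factorial : ℝ) := by
      intro x _
      rw [Real.log_pow, Real.log_prod (fun b _ => hfac _)]
    have e2 : ∀ a ∈ (univ : Finset B), Real.log (∏ b, ((kk α β a b).factorial : ℝ)) = ∑ b, Real.log ((kk α β a b).factorial : ℝ) := by
      intro a _
      rw [Real.log_prod (fun b _ => hfac _)]
    rw [Finset.sum_congr rfl e1, Finset.sum_congr rfl e2] at this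
    exact this
  have b1 : ∑ a, ((N a : ℝ) * Real.log (N a) - N a) ≤ ∑ a, Real.log ((N a).factorial : ℝ) :=
    Finset.sum_le_sum fun a _ => log_fac_lower _
  have b2 : ∑ a, ∑ b, ((kk α β a b : ℝ) * Real.log (kk α β a b) - kk α β a b) ≤ ∑ a, ∑ b, Real.log ((kk α β a b).factorial : ℝ) :=
    Finset.sum_le_sum fun a _ => Finset.sum_le_sum fun b _ => log_fac_lower _
  have b3 : ∑ x ∈ X, Real.log ((c x).factorial : ℝ) ≤ ∑ x ∈ X, ((c x : ℝ) * Real.log (c x) - c x + (1 + Real.log (n + 1))) := by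
    refine Finset.sum_le_sum fun x hx => (log_fac_upper _).trans ?_
    have : c x ≤ n := hc ▸ Finset.single_le_sum (f := c) (fun _ _ => Nat.zero_le _) hx
    have : Real.log ((c x : ℝ) + 1) ≤ Real.log (n + 1) := Real.log_le_log (by positivity) (by
      have : (c x : ℝ) ≤ n := by exact_mod_cast this
      linarith)
    linarith
  have hcs : ∑ x ∈ X, (c x : ℝ) = n := by exact_mod_cast hc
  have hNs : ∑ a, (N a : ℝ) = n := by exact_mod_cast hN
  rw [← Real.log_le_log_iff (by positivity) hSR', Real.log_mul hSR.ne' (Real.exp_pos _).ne', Real.log_exp]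
  unfold Phi
  simp only [Finset.sum_add_distrib, Finset.sum_sub_distrib, Finset.sum_const, nsmul_eq_mul] at b1 b2 b3 ⊢
  linarith

theorem Phi_tendsto (X : Finset (B × (B → ℕ))) (ν : B × (B → ℕ) → ℝ) (ϖ : B → ℝ) (ω : B → B → ℝ) (hϖ : ∀ a, 0 < ϖ a)
    (cn : ℕ → B × (B → ℕ) → ℝ) (Nn : ℕ → B → ℝ) (kn : ℕ → B → B → ℝ)
    (hc : ∀ x ∈ X, Tendsto (fun n => cn n x) atTop (𝓝 (ν x)))
    (hN : ∀ a, Tendsto (fun n => Nn n a) atTop (𝓝 (ϖ a)))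
    (hk : ∀ a b, Tendsto (fun n => kn n a b) atTop (𝓝 (ω a b))) :
    Tendsto (fun n => Phi X (cn n) (Nn n) (kn n)) atTop (𝓝 (Phi X ν ϖ ω)) := by
  have hl : ∀ (f : ℕ → ℝ) (t : ℝ), Tendsto f atTop (𝓝 t) → Tendsto (fun n => f n * Real.log (f n)) atTop (𝓝 (t * Real.log t)) :=
    fun f t h => (Real.continuous_mul_log.tendsto t).comp h
  unfold Phi
  refine Tendsto.sub (Tendsto.sub (Tendsto.add ?_ ?_) ?_) ?_
  · refine tendsto_finset_sum _ fun a _ => tendsto_finset_sum _ fun b _ => ?_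
    exact ((hl _ _ (hk a b)).sub (hk a b)).sub ((hk a b).mul ((hN a).log (hϖ a).ne'))
  · exact tendsto_finset_sum _ fun a _ => hl _ _ (hN a)
  · exact tendsto_finset_sum _ fun x hx => hl _ _ (hc x hx)
  · exact tendsto_finset_sum _ fun x hx => (hc x hx).mul_const _

theorem sum_fib (X : Finset (B × (B → ℕ))) (F : B × (B → ℕ) → ℝ) : ∑ a, ∑ x ∈ X with x.1 = a, F x = ∑ x ∈ X, F x :=
  Finset.sum_fiberwise X (fun x => x.1) F

theorem Phi_eq (X : Finset (B × (B → ℕ))) (ν : B × (B → ℕ) → ℝ) (ϖ : B → ℝ) (ω : B → B → ℝ) (hϖ : ∀ a, 0 < ϖ a)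
    (hω : ∀ a b, 0 ≤ ω a b)
    (hνN : ∀ a, ∑ x ∈ X with x.1 = a, ν x = ϖ a) (hνk : ∀ a b, ∑ x ∈ X with x.1 = a, (x.2 b : ℝ) * ν x = ω a b)
    (hz : ∀ x ∈ X, ∀ b, x.2 b ≠ 0 → ω x.1 b = 0 → ν x = 0) :
    Phi X ν ϖ ω = - ∑ x ∈ X, ν x * Real.log (ν x / qq ϖ ω x) := by
  have key : ∀ x ∈ X, ν x * Real.log (ν x / qq ϖ ω x) = ν x * Real.log (ν x) - (Real.log (ϖ x.1) * ν x
      - (∑ b, ω x.1 b / ϖ x.1) * ν x + ∑ b, (Real.log (ω x.1 b) - Real.log (ϖ x.1)) * ((x.2 b : ℝ) * ν x)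
      - ν x * ∑ b, Real.log ((x.2 b).factorial : ℝ)) := by
    intro x hx
    by_cases h0 : ν x = 0
    · simp [h0]
    have hb : ∀ b, x.2 b ≠ 0 → 0 < ω x.1 b := fun b hb =>
      lt_of_le_of_ne (hω _ _) fun h => h0 (hz x hx b hb h.symm)
    have hq := qq_pos ϖ ω hϖ hω x hb
    rw [Real.log_div h0 hq.ne']
    have hϖx := hϖ x.1
    have hfac : ∀ j : ℕ, (j.factorial : ℝ) ≠ 0 := fun j => by exact_mod_cast (Nat.factorial_pos j).ne'
    have hp : ∀ b, (ω x.1 b / ϖ x.1) ^ (x.2 b) ≠ 0 := by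
      intro b
      by_cases h : x.2 b = 0
      · simp [h]
      · exact pow_ne_zero _ (div_pos (hb b h) hϖx).ne'
    have e : Real.log (qq ϖ ω x) = Real.log (ϖ x.1) + ∑ b, (-(ω x.1 b / ϖ x.1) + (x.2 b) * (Real.log (ω x.1 b) - Real.log (ϖ x.1))
        - Real.log ((x.2 b).factorial : ℝ)) := by
      unfold qq
      have hne : ∀ b, Real.exp (-(ω x.1 b / ϖ x.1)) * (ω x.1 b / ϖ x.1) ^ (x.2 b) / ((x.2 b).factorial : ℝ) ≠ 0 :=
        fun b => div_ne_zero (mul_ne_zero (Real.exp_pos _).ne' (hp b)) (hfac _)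
      rw [Real.log_mul hϖx.ne' (Finset.prod_ne_zero_iff.2 fun b _ => hne b), Real.log_prod (fun b _ => hne b)]
      congr 1
      refine Finset.sum_congr rfl fun b _ => ?_
      rw [Real.log_div (mul_ne_zero (Real.exp_pos _).ne' (hp b)) (hfac _), Real.log_mul (Real.exp_pos _).ne' (hp b), Real.log_exp,
        Real.log_pow]
      by_cases h : x.2 b = 0
      · simp [h]
      · rw [Real.log_div (hb b h).ne' hϖx.ne']
    rw [e, mul_sub, mul_add]
    simp only [Finset.sum_add_distrib, Finset.sum_sub_distrib, Finset.sum_neg_distrib]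
    have e2 : ∑ b, (Real.log (ω x.1 b) - Real.log (ϖ x.1)) * ((x.2 b : ℝ) * ν x) = ν x * ∑ b, (x.2 b : ℝ) * (Real.log (ω x.1 b) - Real.log (ϖ x.1)) := by
      rw [Finset.mul_sum]
      exact Finset.sum_congr rfl fun b _ => by ring
    rw [e2]; ring
  rw [Finset.sum_congr rfl key]
  simp only [Finset.sum_sub_distrib, Finset.sum_add_distrib]
  have s1 : ∑ x ∈ X, Real.log (ϖ x.1) * ν x = ∑ a, ϖ a * Real.log (ϖ a) := by
    rw [← sum_fib]
    refine Finset.sum_congr rfl fun a _ => ?_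
    rw [← hνN a, Finset.sum_mul]
    refine Finset.sum_congr rfl fun x hx => ?_
    rw [hνN a, (Finset.mem_filter.1 hx).2]; ring
  have s2 : ∑ x ∈ X, (∑ b, ω x.1 b / ϖ x.1) * ν x = ∑ a, ∑ b, ω a b := by
    rw [← sum_fib]
    refine Finset.sum_congr rfl fun a _ => ?_
    rw [Finset.sum_congr rfl (g := fun x => (∑ b, ω a b / ϖ a) * ν x) (fun x hx => by rw [(Finset.mem_filter.1 hx).2]),
      ← Finset.mul_sum, hνN a, Finset.sum_mul]
    refine Finset.sum_congr rfl fun b _ => ?_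
    have := hϖ a
    field_simp
  have s3 : ∑ x ∈ X, ∑ b, (Real.log (ω x.1 b) - Real.log (ϖ x.1)) * ((x.2 b : ℝ) * ν x) = ∑ a, ∑ b, (Real.log (ω a b) - Real.log (ϖ a)) * ω a b := by
    rw [← sum_fib]
    refine Finset.sum_congr rfl fun a _ => ?_
    rw [Finset.sum_comm]
    refine Finset.sum_congr rfl fun b _ => ?_
    rw [← hνk a b, Finset.mul_sum]
    refine Finset.sum_congr rfl fun x hx => ?_
    rw [(Finset.mem_filter.1 hx).2, hνk a b]
  rw [s1, s2, s3]
  unfold Phi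
  have s4 : ∑ a, ∑ b, (ω a b * Real.log (ω a b) - ω a b - ω a b * Real.log (ϖ a)) =
      ∑ a, ∑ b, (Real.log (ω a b) - Real.log (ϖ a)) * ω a b - ∑ a, ∑ b, ω a b := by
    rw [← Finset.sum_sub_distrib]
    refine Finset.sum_congr rfl fun a _ => ?_
    rw [← Finset.sum_sub_distrib]
    exact Finset.sum_congr rfl fun b _ => by ring
  rw [s4]; ring

end stirling

/-! ### Part 15 -/

section lower

theorem card_stub_eq (m : Sym2 B → ℕ) : Fintype.card (Stub m) = ∑ a, ∑ b, kk (stubα m) (stubβ m) a b := by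
  classical
  unfold kk
  rw [← Finset.card_univ, Finset.card_eq_sum_card_fiberwise (f := stubα m) (t := univ) (by intro x _; simp)]
  refine Finset.sum_congr rfl fun a _ => ?_
  rw [Finset.card_eq_sum_card_fiberwise (f := stubβ m) (t := univ) (by intro x _; simp)]
  refine Finset.sum_congr rfl fun b _ => ?_
  rw [Finset.filter_filter]

theorem prof_swap {V D : Type*} [DecidableEq V] [Fintype D] [DecidableEq D] (β : D → B) (z : V → B) (f : D → V) (d e : D)
    (h : β e = β d) (v : V) : prof β z (f ∘ Equiv.swap d e) v = prof β z f v := by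
  unfold prof
  ext1
  · rfl
  funext b
  simp only
  have hβ : ∀ x, β (Equiv.swap d e x) = β x := by
    intro x
    by_cases h1 : x = d
    · subst h1; simp [h]
    by_cases h2 : x = e
    · subst h2; simp [h]
    rw [Equiv.swap_apply_of_ne_of_ne h1 h2]
  refine Finset.card_bij (fun x _ => Equiv.swap d e x) ?_ ?_ ?_
  · intro x hx
    simp only [Finset.mem_filter, mem_univ, true_and, Function.comp] at hx ⊢
    exact ⟨hx.1, by rw [hβ]; exact hx.2⟩
  · intro x _ y _ hxy
    exact (Equiv.swap d e).injective hxy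
  · intro y hy
    simp only [Finset.mem_filter, mem_univ, true_and, Function.comp] at hy ⊢
    exact ⟨Equiv.swap d e y, ⟨by simpa using hy.1, by rw [hβ]; exact hy.2⟩, by simp⟩

theorem prof_count_close {V D : Type*} [Fintype V] [DecidableEq V] [Fintype D] [DecidableEq D] (β : D → B) (z : V → B) (f f' : D → V) (C : ℕ)
    (h : hammingDist f f' ≤ C) (x : B × (B → ℕ)) :
    |((#{v | prof β z f' v = x} : ℕ) : ℝ) - (#{v | prof β z f v = x} : ℕ)| ≤ 2 * C := by
  have h1 := prof_hamming β z f f' C h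
  have ha : #{v | prof β z f' v = x} ≤ #{v | prof β z f v = x} + #{v | prof β z f v ≠ prof β z f' v} := by
    refine (Finset.card_le_card ?_).trans (Finset.card_union_le _ _)
    intro v hv
    simp only [Finset.mem_filter, mem_univ, true_and, Finset.mem_union] at hv ⊢
    by_cases h : prof β z f v = prof β z f' v
    · left; rw [h, hv]
    · right; exact h
  have hb : #{v | prof β z f v = x} ≤ #{v | prof β z f' v = x} + #{v | prof β z f v ≠ prof β z f' v} := by
    refine (Finset.card_le_card ?_).trans (Finset.card_union_le _ _)
    intro v hv
    simp only [Finset.mem_filter, mem_univ, true_and, Finset.mem_union] at hv ⊢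
    by_cases h : prof β z f v = prof β z f' v
    · left; rw [← h, hv]
    · right; exact h
  have ha' : ((#{v | prof β z f' v = x} : ℕ) : ℝ) ≤ (#{v | prof β z f v = x} : ℕ) + 2 * C := by exact_mod_cast ha.trans (by omega)
  have hb' : ((#{v | prof β z f v = x} : ℕ) : ℝ) ≤ (#{v | prof β z f' v = x} : ℕ) + 2 * C := by exact_mod_cast hb.trans (by omega)
  rw [abs_le]; constructor <;> linarith

open Classical in
theorem lower_fin (n : ℕ) (hn : 0 < n) (N : B → ℕ) (m : Sym2 B → ℕ) (X : Finset (B × (B → ℕ))) (c : B × (B → ℕ) → ℕ)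
    (hcN : ∀ a, ∑ x ∈ X with x.1 = a, c x = N a)
    (hck : ∀ a b, ∑ x ∈ X with x.1 = a, x.2 b * c x = kk (stubα m) (stubβ m) a b)
    (hN : ∑ a, N a = n) (hpos : ∀ a, 0 < N a)
    (hbig : ∀ a b, N a + Fintype.card (Stub m) < N a * N b) (C : ℕ)
    (hC : C = 2 * (Fintype.card B ^ 2 * (X.sup deg * X.sup deg + 5 * X.sup deg + 2)))
    (A : TConf B n → Prop)
    (hA : ∀ cf : TConf B n, (∀ x ∈ X, |((#{v | (cf.1 v, nbr cf v) = x} : ℕ) : ℝ) - c x| ≤ 2 * C) → A cf) :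
    (#(stubConf (Fin n) (stubα m) N) : ℝ) * Real.exp (n * Phi X (fun x => (c x : ℝ) / n)
        (fun a => (N a : ℝ) / n) (fun a b => (kk (stubα m) (stubβ m) a b : ℝ) / n)
        - #X * (1 + Real.log (n + 1))) ≤
      2 * ((1 + Fintype.card (Stub m) * n) ^ C * (Nat.card {π // stubG m π} * #{cf : TConf B n | admP N m cf ∧ A cf})) := by
  have hc : ∑ x ∈ X, c x = Fintype.card (Fin n) := by
    rw [Fintype.card_fin, ← hN, ← Finset.sum_fiberwise X (fun x => x.1) c]
    exact Finset.sum_congr rfl fun a _ => hcN a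
  have h1 := typeClass_lower (V := Fin n) (stubα m) (stubβ m) N X c hc hcN hck (by simpa using hN) hpos (by simpa using hn)
  simp only [Fintype.card_fin] at h1
  refine h1.trans ?_
  set S := ({zf ∈ stubConf (Fin n) (stubα m) N | (∀ v, prof (stubβ m) zf.1 zf.2 v ∈ X) ∧ ∀ x ∈ X, #{v | prof (stubβ m) zf.1 zf.2 v = x} = c x} :
    Finset ((Fin n → B) × (Stub m → Fin n))) with hSdef
  have h2 := simple_lower (V := Fin n) (stubτ m) (stubτ_τ m) (stubτ_ne m) (stubα m) (stubβ m) (fun d => rfl) N hbig S (X.sup deg)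
    (Finset.filter_subset _ _) (by
      intro zf hzf d e he
      simp only [hSdef, Finset.mem_filter, stubConf, mem_univ, true_and] at hzf ⊢
      simp only [cls, Finset.mem_filter, mem_univ, true_and] at he
      simp only [prof_swap (stubβ m) zf.1 zf.2 d e he.2]
      refine ⟨⟨hzf.1.1, ?_⟩, hzf.2⟩
      intro x
      rw [Function.comp, hzf.1.2]
      by_cases h1 : x = d
      · subst h1; simp [he.1]
      by_cases h2 : x = e
      · subst h2; simp [he.1]
      rw [Equiv.swap_apply_of_ne_of_ne h1 h2]) (by
      intro zf hzf d
      simp only [hSdef, Finset.mem_filter] at hzf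
      have hx := hzf.2.1 (zf.2 d)
      have hle : deg (prof (stubβ m) zf.1 zf.2 (zf.2 d)) ≤ X.sup deg := Finset.le_sup (f := deg) hx
      have hle2 : (prof (stubβ m) zf.1 zf.2 (zf.2 d)).2 (stubβ m d) ≤ deg (prof (stubβ m) zf.1 zf.2 (zf.2 d)) := by
        unfold deg
        exact Finset.single_le_sum (f := fun b => (prof (stubβ m) zf.1 zf.2 (zf.2 d)).2 b) (fun _ _ => Nat.zero_le _) (mem_univ _)
      refine le_trans (Finset.card_le_card ?_) (hle2.trans hle)
      intro e he
      simp only [cls, Finset.mem_filter, mem_univ, true_and] at he ⊢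
      exact ⟨he.2, he.1.2⟩) C hC
  have h3 := link (V := Fin n) N m A
  have h4 : #{zf ∈ stubConf (Fin n) (stubα m) N | Function.Injective (FF (stubτ m) zf.2) ∧
        ∃ f, (zf.1, f) ∈ S ∧ hammingDist f zf.2 ≤ C} ≤ 
      #{zf ∈ stubConf (Fin n) (stubα m) N | Function.Injective (FF (stubτ m) zf.2) ∧ A (zf.1, edges (stubτ m) zf.2)} := by
    refine Finset.card_le_card fun zf hzf => ?_
    rw [Finset.mem_filter] at hzf ⊢
    obtain ⟨hst, hinj, f, hf, hd⟩ := hzf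
    refine ⟨hst, hinj, hA _ fun x hx => ?_⟩
    have hval : ∀ d, zf.1 (zf.2 d) = stubα m d := by
      simp only [stubConf, Finset.mem_filter, mem_univ, true_and] at hst
      exact hst.2
    simp only [nbr_edges (stubτ m) (stubτ_τ m) (stubα m) (stubβ m) (fun d => rfl) zf.1 zf.2 hval hinj]
    have hcx : #{v | prof (stubβ m) zf.1 f v = x} = c x := by
      simp only [hSdef, Finset.mem_filter] at hf
      exact hf.2.2 x hx
    rw [← hcx]
    exact prof_count_close (stubβ m) zf.1 f zf.2 C hd x
  rw [h3] at h4
  have h5 : #S ≤ 2 * ((1 + Fintype.card (Stub m) * n) ^ C * (Nat.card {π // stubG m π} * #{cf : TConf B n | admP N m cf ∧ A cf})) := by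
    refine h2.trans ?_
    rw [Fintype.card_fin]
    exact Nat.mul_le_mul le_rfl (Nat.mul_le_mul le_rfl (by convert h4))
  have h6 : ((#S : ℕ) : ℝ) ≤ 2 * ((1 + Fintype.card (Stub m) * n) ^ C * (Nat.card {π // stubG m π} * #{cf : TConf B n | admP N m cf ∧ A cf})) := by
    exact_mod_cast h5
  refine le_trans (le_of_eq ?_) h6
  congr 2
  rw [hSdef]
  ext zf
  simp only [Finset.mem_filter]

end lower

/-! ### Part 16 -/

section lowerasym

theorem log_small (K ε : ℝ) (hε : 0 < ε) : ∀ᶠ n : ℕ in atTop, K * (1 + Real.log (n + 1)) ≤ ε * n := by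
  have h1 : Tendsto (fun n : ℕ => (n : ℝ)) atTop atTop := tendsto_natCast_atTop_atTop
  have h2 : Tendsto (fun n : ℕ => (n : ℝ) + 1) atTop atTop := tendsto_atTop_add_const_right _ _ h1
  have h3 := (Real.tendsto_pow_log_div_mul_add_atTop 1 (-1) 1 one_ne_zero).comp h2
  have h4 : Tendsto (fun n : ℕ => (n : ℝ)⁻¹) atTop (𝓝 0) := tendsto_inv_atTop_zero.comp h1
  have h5 := (h4.add h3).const_mul K
  simp only [add_zero, mul_zero] at h5
  filter_upwards [h5.eventually_lt_const hε, eventually_gt_atTop 0] with n hn hn0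
  have hn0' : (0 : ℝ) < n := by exact_mod_cast hn0
  simp only [Function.comp, pow_one, one_mul] at hn
  have e : K * ((n : ℝ)⁻¹ + Real.log ((n : ℝ) + 1) / ((n : ℝ) + 1 + -1)) = K * (1 + Real.log (n + 1)) / n := by
    have : (n : ℝ) + 1 + -1 = n := by ring
    rw [this]; field_simp
  rw [e, div_lt_iff₀ hn0'] at hn
  exact hn.le

variable (ϖ : B → ℝ) (ω : B → B → ℝ) (hϖ : ∀ a, 0 < ϖ a) (hϖ1 : ∑ a, ϖ a = 1) (hω : ∀ a b, 0 ≤ ω a b)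
  (N : ℕ → B → ℕ) (m : ℕ → Sym2 B → ℕ) (hNs : ∀ n, ∑ a, N n a = n)
  (hN : ∀ a, Tendsto (fun n : ℕ => (N n a : ℝ) / n) atTop (𝓝 (ϖ a)))
  (hk : ∀ a b, Tendsto (fun n : ℕ => (kk (stubα (m n)) (stubβ (m n)) a b : ℝ) / n) atTop (𝓝 (ω a b)))

theorem stub_lim (ω : B → B → ℝ) (m : ℕ → Sym2 B → ℕ) (hk : ∀ a b, Tendsto (fun n : ℕ => (kk (stubα (m n)) (stubβ (m n)) a b : ℝ) / n) atTop (𝓝 (ω a b)))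
    : Tendsto (fun n : ℕ => (Fintype.card (Stub (m n)) : ℝ) / n) atTop (𝓝 (∑ a, ∑ b, ω a b)) := by
  have := tendsto_finset_sum univ fun a (_ : a ∈ univ) => tendsto_finset_sum univ fun b (_ : b ∈ univ) => hk a b
  refine this.congr fun n => ?_
  rw [card_stub_eq]
  push_cast
  rw [Finset.sum_div]
  simp only [Finset.sum_div]

theorem N_pos (ϖ : B → ℝ) (hϖ : ∀ a, 0 < ϖ a) (N : ℕ → B → ℕ) (hN : ∀ a, Tendsto (fun n : ℕ => (N n a : ℝ) / n) atTop (𝓝 (ϖ a)))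
    : ∀ᶠ n in atTop, ∀ a, 0 < N n a := by
  rw [eventually_all]; intro a
  filter_upwards [(hN a).eventually_const_lt (hϖ a)] with n hn
  rcases Nat.eq_zero_or_pos (N n a) with h | h
  · simp [h] at hn
  · exact h

theorem N_big (ϖ : B → ℝ) (ω : B → B → ℝ) (hϖ : ∀ a, 0 < ϖ a) (N : ℕ → B → ℕ) (m : ℕ → Sym2 B → ℕ) (hN : ∀ a, Tendsto (fun n : ℕ => (N n a : ℝ) / n) atTop (𝓝 (ϖ a))) (hk : ∀ a b, Tendsto (fun n : ℕ => (kk (stubα (m n)) (stubβ (m n)) a b : ℝ) / n) atTop (𝓝 (ω a b)))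
    : ∀ᶠ n in atTop, ∀ a b, N n a + Fintype.card (Stub (m n)) < N n a * N n b := by
  rw [eventually_all]; intro a
  rw [eventually_all]; intro b
  have h4 : Tendsto (fun n : ℕ => (n : ℝ)⁻¹) atTop (𝓝 0) := tendsto_inv_atTop_zero.comp tendsto_natCast_atTop_atTop
  have h1 := ((hN a).add (stub_lim ω m hk)).mul h4
  have h2 := (hN a).mul (hN b)
  rw [mul_zero] at h1
  filter_upwards [h1.eventually_lt h2 (mul_pos (hϖ a) (hϖ b)), eventually_gt_atTop 0] with n hn hn0
  have hn0' : (0 : ℝ) < n := by exact_mod_cast hn0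
  have e1 : ((N n a : ℝ) / n + (Fintype.card (Stub (m n)) : ℝ) / n) * (n : ℝ)⁻¹ = ((N n a : ℝ) + Fintype.card (Stub (m n))) / (n * n) := by
    field_simp
  have e2 : (N n a : ℝ) / n * ((N n b : ℝ) / n) = ((N n a : ℝ) * N n b) / (n * n) := by
    field_simp
  rw [e1, e2, div_lt_div_iff_of_pos_right (by positivity)] at hn
  exact_mod_cast hn

theorem poly_small (D : ℕ → ℕ) (Ω : ℝ) (hD : Tendsto (fun n : ℕ => (D n : ℝ) / n) atTop (𝓝 Ω)) (C : ℕ) (ε : ℝ) (hε : 0 < ε) :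
    ∀ᶠ n : ℕ in atTop, 2 * (1 + (D n : ℝ) * n) ^ C ≤ Real.exp (ε * n) := by
  set L : ℝ := |Ω| + 1 with hL
  have hL0 : 0 < L := by positivity
  have hl1 : 0 ≤ Real.log (1 + L) := Real.log_nonneg (by linarith)
  have hl2 : 0 ≤ Real.log 2 := Real.log_nonneg (by norm_num)
  filter_upwards [hD.eventually_lt_const (show Ω < L by rw [hL]; linarith [le_abs_self Ω]), eventually_gt_atTop 0,
    log_small (Real.log 2 + C * Real.log (1 + L) + 2 * C) ε hε] with n h1 hn0 h2
  have hn0' : (0 : ℝ) < n := by exact_mod_cast hn0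
  rw [div_lt_iff₀ hn0'] at h1
  have hle : 1 + (D n : ℝ) * n ≤ (1 + L) * ((n : ℝ) + 1) ^ 2 := by
    have : (D n : ℝ) * n ≤ L * n * n := by gcongr
    nlinarith [mul_pos hL0 hn0']
  have hln : 0 ≤ Real.log ((n : ℝ) + 1) := Real.log_nonneg (by linarith)
  rw [← Real.log_le_iff_le_exp (by positivity), Real.log_mul (by norm_num) (by positivity), Real.log_pow]
  have : Real.log (1 + (D n : ℝ) * n) ≤ Real.log (1 + L) + 2 * Real.log ((n : ℝ) + 1) := by
    refine (Real.log_le_log (by positivity) hle).trans (le_of_eq ?_)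
    rw [Real.log_mul (by positivity) (by positivity), Real.log_pow]; norm_num
  have h3 : (C : ℝ) * Real.log (1 + (D n : ℝ) * n) ≤ C * (Real.log (1 + L) + 2 * Real.log ((n : ℝ) + 1)) := by gcongr
  refine le_trans (add_le_add le_rfl h3) (le_trans ?_ h2)
  have hC0 : (0 : ℝ) ≤ C := Nat.cast_nonneg C
  have a1 : 0 ≤ Real.log 2 * Real.log ((n : ℝ) + 1) := mul_nonneg hl2 hln
  have a2 : 0 ≤ C * Real.log (1 + L) * Real.log ((n : ℝ) + 1) := mul_nonneg (mul_nonneg hC0 hl1) hln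
  nlinarith

open Classical in
theorem lower_asym (ϖ : B → ℝ) (ω : B → B → ℝ) (hϖ : ∀ a, 0 < ϖ a) (hϖ1 : ∑ a, ϖ a = 1) (hω : ∀ a b, 0 ≤ ω a b) (N : ℕ → B → ℕ) (m : ℕ → Sym2 B → ℕ) (hNs : ∀ n, ∑ a, N n a = n) (hN : ∀ a, Tendsto (fun n : ℕ => (N n a : ℝ) / n) atTop (𝓝 (ϖ a))) (hk : ∀ a b, Tendsto (fun n : ℕ => (kk (stubα (m n)) (stubβ (m n)) a b : ℝ) / n) atTop (𝓝 (ω a b)))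
    (p : B × (B → ℕ) → ℝ) (hp : ∀ x, 0 ≤ p x) (hc : consis ϖ ω p) (hac : ∀ x, qq ϖ ω x = 0 → p x = 0)
    (hs : Summable fun x => ent (p x) (qq ϖ ω x)) (δ : ℝ) (hδ : 0 < δ) (S0 : Finset (B × (B → ℕ))) (η : ℝ) (hη : 0 < η) :
    ∀ᶠ n : ℕ in atTop, (#(stubConf (Fin n) (stubα (m n)) (N n)) : ℝ) * Real.exp (-(n * (∑' x, ent (p x) (qq ϖ ω x) + δ))) ≤
      Nat.card {π // stubG (m n) π} * #{cf : TConf B n | admP (N n) (m n) cf ∧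
        ∀ x ∈ S0, |((#{v | (cf.1 v, nbr cf v) = x} : ℕ) : ℝ) / n - p x| < η} := by
  obtain ⟨X, u, hE, hS0, hu0, huz, hf0, hf1, hclose, hent⟩ := approx ϖ ω hϖ hϖ1 hω p hp hc hac hs (δ / 4) (by linarith) S0 (η / 2) (by linarith)
  obtain ⟨c, hceq, hclim⟩ := rounding ϖ ω hω X u hE hu0 huz hf0 hf1 N (fun n => kk (stubα (m n)) (stubβ (m n))) hN hk
  set J := ∑' x, ent (p x) (qq ϖ ω x) with hJ
  set ν := fill X u ϖ ω with hν
  have hz : ∀ x ∈ X, ∀ b, x.2 b ≠ 0 → ω x.1 b = 0 → ν x = 0 := by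
    intro x _ b hb hωb
    rcases le_or_gt 2 (deg x) with h | h
    · rw [hν, fill_two _ _ _ _ x h]; exact huz x b hb hωb
    · rcases Nat.le_one_iff_eq_zero_or_eq_one.1 (Nat.lt_succ_iff.1 h) with h | h
      · rw [eq_zero_of_deg x h] at hb; exact absurd rfl hb
      · obtain ⟨b', hb'⟩ := eq_single_of_deg x h
        rw [hb'] at hb
        have hbb : b = b' := by
          by_contra hne; simp [Pi.single_apply, hne] at hb
        subst hbb
        rw [hb', hν, fill_single]
        unfold fillE
        rw [hωb, Finset.sum_eq_zero, sub_zero]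
        intro y hy
        by_cases hyb : y.2 b = 0
        · simp [hyb]
        · rw [huz y b hyb (by rw [(Finset.mem_filter.1 hy).2.1]; exact hωb), mul_zero]
  have hPhi := Phi_tendsto X ν ϖ ω hϖ (fun n x => (c n x : ℝ) / n) (fun n a => (N n a : ℝ) / n)
    (fun n a b => (kk (stubα (m n)) (stubβ (m n)) a b : ℝ) / n) hclim hN hk
  rw [Phi_eq X ν ϖ ω hϖ hω (fill_N X u ϖ ω hE) (fill_k X u ϖ ω hE) hz] at hPhi
  obtain ⟨C, hC⟩ : ∃ C, C = 2 * (Fintype.card B ^ 2 * (X.sup deg * X.sup deg + 5 * X.sup deg + 2)) := ⟨_, rfl⟩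
  have evc : ∀ᶠ n : ℕ in atTop, ∀ x ∈ S0, |(c n x : ℝ) / n - p x| < η / 2 := by
    refine (Filter.eventually_all_finset S0).2 fun x hx => ?_
    exact (((hclim x (hS0 hx)).sub_const (p x)).abs).eventually_lt_const (hclose x hx)
  have evC : ∀ᶠ n : ℕ in atTop, 2 * (C : ℝ) / n < η / 2 := by
    have h4 : Tendsto (fun n : ℕ => (n : ℝ)⁻¹) atTop (𝓝 0) := tendsto_inv_atTop_zero.comp tendsto_natCast_atTop_atTop
    have := h4.const_mul (2 * (C : ℝ))
    rw [mul_zero] at this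
    exact this.eventually_lt_const (by linarith)
  filter_upwards [hceq, N_pos ϖ hϖ N hN, N_big ϖ ω hϖ N m hN hk, eventually_gt_atTop 0,
    hPhi.eventually_const_lt (show -(J + δ / 4) < _ by linarith), evc, evC, log_small (#X) (δ / 4) (by linarith),
    poly_small _ _ (stub_lim ω m hk) C (δ / 4) (by linarith)] with n h1 h2 h3 hn h5 h6 h7 h8 h9
  have hn0 : (0 : ℝ) < n := by exact_mod_cast hn
  have key := lower_fin n hn (N n) (m n) X (c n) h1.1 h1.2 (hNs n) h2 h3 C hC
    (fun cf => ∀ x ∈ S0, |((#{v | (cf.1 v, nbr cf v) = x} : ℕ) : ℝ) / n - p x| < η) (by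
      intro cf hcf x hx
      have a1 := h6 x hx
      have a2 := hcf x (hS0 hx)
      have a3 : |((#{v | (cf.1 v, nbr cf v) = x} : ℕ) : ℝ) / n - (c n x : ℝ) / n| ≤ 2 * C / n := by
        rw [← sub_div, abs_div, abs_of_pos hn0]; gcongr
      have := abs_sub_le (((#{v | (cf.1 v, nbr cf v) = x} : ℕ) : ℝ) / n) ((c n x : ℝ) / n) (p x)
      linarith)
  set R : ℝ := Nat.card {π // stubG (m n) π} * #{cf : TConf B n | admP (N n) (m n) cf ∧
        ∀ x ∈ S0, |((#{v | (cf.1 v, nbr cf v) = x} : ℕ) : ℝ) / n - p x| < η} with hR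
  set S : ℝ := (#(stubConf (Fin n) (stubα (m n)) (N n)) : ℝ) with hS
  have hS0' : 0 ≤ S := Nat.cast_nonneg _
  have hR0 : 0 ≤ R := by positivity
  have b1 : S * Real.exp (-(n * (J + δ / 2))) ≤ Real.exp (δ / 4 * n) * R := by
    refine le_trans (mul_le_mul_of_nonneg_left (Real.exp_le_exp.2 ?_) hS0') (key.trans ?_)
    · have : (n : ℝ) * -(J + δ / 4) ≤ n * Phi X (fun x => (c n x : ℝ) / n) (fun a => (N n a : ℝ) / n)
          (fun a b => (kk (stubα (m n)) (stubβ (m n)) a b : ℝ) / n) := by gcongr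
      linarith
    · rw [← mul_assoc]
      refine le_trans (le_of_eq ?_) (mul_le_mul_of_nonneg_right h9 hR0)
      rw [hR]
      congr 4
      ext cf
      simp only [Finset.mem_filter]
  have b2 : S * Real.exp (-(n * (J + δ))) = (S * Real.exp (-(n * (J + δ / 2)))) * Real.exp (-(n * (δ / 2))) := by
    rw [mul_assoc, ← Real.exp_add]; congr 2; ring
  rw [b2]
  calc _ ≤ (Real.exp (δ / 4 * n) * R) * Real.exp (-(n * (δ / 2))) := by gcongr
    _ = Real.exp (δ / 4 * n + -(n * (δ / 2))) * R := by rw [Real.exp_add]; ring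
    _ ≤ 1 * R := by
      gcongr
      rw [Real.exp_le_one_iff]
      nlinarith [mul_pos hδ hn0]
    _ = R := one_mul R

end lowerasym

/-! ### Part 17 -/

section upperasym

/-- empirical locality frequencies of a configuration -/
noncomputable def emp {n : ℕ} (cf : TConf B n) (x : B × (B → ℕ)) : ℝ := ((#{v | (cf.1 v, nbr cf v) = x} : ℕ) : ℝ) / n

variable (ϖ : B → ℝ) (ω : B → B → ℝ) (hϖ : ∀ a, 0 < ϖ a) (hϖ1 : ∑ a, ϖ a = 1) (hω : ∀ a b, 0 ≤ ω a b)
  (N : ℕ → B → ℕ) (m : ℕ → Sym2 B → ℕ) (hNs : ∀ n, ∑ a, N n a = n)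
  (hN : ∀ a, Tendsto (fun n : ℕ => (N n a : ℝ) / n) atTop (𝓝 (ϖ a)))
  (hk : ∀ a b, Tendsto (fun n : ℕ => (kk (stubα (m n)) (stubβ (m n)) a b : ℝ) / n) atTop (𝓝 (ω a b)))

theorem Pfac_pos (k : B → B → ℕ) (N : B → ℕ) : 0 < Pfac k N := by
  unfold Pfac
  refine mul_pos (Finset.prod_pos fun a _ => Finset.prod_pos fun b _ => ?_) (Finset.prod_pos fun a _ => ?_) <;>
  exact mul_pos (Real.exp_pos _) (by positivity)

theorem log_Pfac (k : B → B → ℕ) (N : B → ℕ) : Real.log (Pfac k N) = ∑ a, ∑ b, (1 + Real.log (k a b + 1)) + ∑ a, (1 + Real.log (N a + 1)) := by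
  unfold Pfac
  have h1 : ∀ j : ℕ, Real.exp 1 * ((j : ℝ) + 1) ≠ 0 := fun j => by positivity
  have h2 : ∀ j : ℕ, Real.log (Real.exp 1 * ((j : ℝ) + 1)) = 1 + Real.log (j + 1) := fun j => by
    rw [Real.log_mul (by positivity) (by positivity), Real.log_exp]
  rw [Real.log_mul (Finset.prod_ne_zero_iff.2 fun a _ => Finset.prod_ne_zero_iff.2 fun b _ => h1 _) (Finset.prod_ne_zero_iff.2 fun a _ => h1 _),
    Real.log_prod (fun a _ => Finset.prod_ne_zero_iff.2 fun b _ => h1 _), Real.log_prod (fun a _ => h1 _)]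
  simp only [h2]
  congr 1
  refine Finset.sum_congr rfl fun a _ => ?_
  rw [Real.log_prod (fun b _ => h1 _)]
  simp only [h2]

theorem lin_log (D : ℕ → ℕ) (Ω : ℝ) (hD : Tendsto (fun n : ℕ => (D n : ℝ) / n) atTop (𝓝 Ω)) (ε : ℝ) (hε : 0 < ε) :
    ∀ᶠ n : ℕ in atTop, 1 + Real.log ((D n : ℝ) + 1) ≤ ε * n := by
  set L : ℝ := |Ω| + 1 with hL
  have hL0 : 0 < L := by positivity
  have hl1 : 0 ≤ Real.log (1 + L) := Real.log_nonneg (by linarith)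
  filter_upwards [hD.eventually_lt_const (show Ω < L by rw [hL]; linarith [le_abs_self Ω]), eventually_gt_atTop 0,
    log_small (1 + Real.log (1 + L)) ε hε] with n h1 hn0 h2
  have hn0' : (0 : ℝ) < n := by exact_mod_cast hn0
  rw [div_lt_iff₀ hn0'] at h1
  have hln : 0 ≤ Real.log ((n : ℝ) + 1) := Real.log_nonneg (by linarith)
  have : Real.log ((D n : ℝ) + 1) ≤ Real.log (1 + L) + Real.log ((n : ℝ) + 1) := by
    rw [← Real.log_mul (by positivity) (by positivity)]
    refine Real.log_le_log (by positivity) ?_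
    nlinarith [mul_pos hL0 hn0']
  nlinarith [mul_nonneg hl1 hln]

theorem Pfac_small (ϖ : B → ℝ) (ω : B → B → ℝ) (N : ℕ → B → ℕ) (m : ℕ → Sym2 B → ℕ) (hN : ∀ a, Tendsto (fun n : ℕ => (N n a : ℝ) / n) atTop (𝓝 (ϖ a))) (hk : ∀ a b, Tendsto (fun n : ℕ => (kk (stubα (m n)) (stubβ (m n)) a b : ℝ) / n) atTop (𝓝 (ω a b)))
    (ε : ℝ) (hε : 0 < ε) : ∀ᶠ n : ℕ in atTop, Pfac (kk (stubα (m n)) (stubβ (m n))) (N n) ≤ Real.exp (ε * n) := by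
  set d : ℝ := (Fintype.card B : ℝ) * Fintype.card B + Fintype.card B + 1 with hd
  have hd0 : 0 < d := by positivity
  have e1 : ∀ᶠ n : ℕ in atTop, ∀ a b, 1 + Real.log ((kk (stubα (m n)) (stubβ (m n)) a b : ℝ) + 1) ≤ ε / d * n := by
    rw [eventually_all]; intro a
    rw [eventually_all]; intro b
    exact lin_log _ _ (hk a b) _ (by positivity)
  have e2 : ∀ᶠ n : ℕ in atTop, ∀ a, 1 + Real.log ((N n a : ℝ) + 1) ≤ ε / d * n := by
    rw [eventually_all]; intro a
    exact lin_log _ _ (hN a) _ (by positivity)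
  filter_upwards [e1, e2] with n h1 h2
  rw [← Real.log_le_iff_le_exp (Pfac_pos _ _), log_Pfac]
  have a1 := Finset.sum_le_sum fun a (_ : a ∈ (univ : Finset B)) => Finset.sum_le_sum fun b (_ : b ∈ (univ : Finset B)) => h1 a b
  have a2 := Finset.sum_le_sum fun a (_ : a ∈ (univ : Finset B)) => h2 a
  refine (add_le_add a1 a2).trans ?_
  simp only [Finset.sum_const, Finset.card_univ, nsmul_eq_mul]
  have e : (Fintype.card B : ℝ) * (Fintype.card B * (ε / d * n)) + Fintype.card B * (ε / d * n) = (d - 1) * (ε / d * n) := by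
    rw [hd]; ring
  rw [e]
  have : d * (ε / d * n) = ε * n := by field_simp
  have : 0 ≤ ε / d * n := by positivity
  linarith

open Classical in
theorem stub_le (ϖ : B → ℝ) (ω : B → B → ℝ) (hϖ : ∀ a, 0 < ϖ a) (hϖ1 : ∑ a, ϖ a = 1) (hω : ∀ a b, 0 ≤ ω a b) (N : ℕ → B → ℕ) (m : ℕ → Sym2 B → ℕ) (hNs : ∀ n, ∑ a, N n a = n) (hN : ∀ a, Tendsto (fun n : ℕ => (N n a : ℝ) / n) atTop (𝓝 (ϖ a))) (hk : ∀ a b, Tendsto (fun n : ℕ => (kk (stubα (m n)) (stubβ (m n)) a b : ℝ) / n) atTop (𝓝 (ω a b)))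
    (δ : ℝ) (hδ : 0 < δ) :
    ∀ᶠ n : ℕ in atTop, (#(stubConf (Fin n) (stubα (m n)) (N n)) : ℝ) ≤
      Real.exp (n * δ) * (Nat.card {π // stubG (m n) π} * #{cf : TConf B n | admP (N n) (m n) cf}) := by
  have h := lower_asym ϖ ω hϖ hϖ1 hω N m hNs hN hk (qq ϖ ω) (qq_nonneg ϖ ω (fun a => (hϖ a).le) hω) (consis_qq ϖ ω hϖ hω)
    (fun x h => h) (by simp only [ent_self]; exact summable_zero) δ hδ ∅ 1 one_pos
  filter_upwards [h] with n hn
  simp only [ent_self, tsum_zero, zero_add] at hn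
  have e : ({cf : TConf B n | admP (N n) (m n) cf ∧ ∀ x ∈ (∅ : Finset (B × (B → ℕ))), |((#{v | (cf.1 v, nbr cf v) = x} : ℕ) : ℝ) / n - qq ϖ ω x| < 1} : Finset (TConf B n))
      = ({cf : TConf B n | admP (N n) (m n) cf} : Finset (TConf B n)) := by
    ext cf; simp
  have hn' := mul_le_mul_of_nonneg_left hn (Real.exp_nonneg (n * δ))
  rw [mul_left_comm, ← Real.exp_add, add_neg_cancel, Real.exp_zero, mul_one] at hn'
  refine hn'.trans (le_of_eq ?_)
  congr 4

open Classical in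
theorem adm_le (n : ℕ) (N : B → ℕ) (m : Sym2 B → ℕ) :
    Nat.card {π // stubG m π} * #{cf : TConf B n | admP N m cf} ≤ #(stubConf (Fin n) (stubα m) N) := by
  have := link (V := Fin n) N m (fun _ => True)
  have h2 : #{zf ∈ stubConf (Fin n) (stubα m) N | Function.Injective (FF (stubτ m) zf.2) ∧ True} ≤ #(stubConf (Fin n) (stubα m) N) :=
    Finset.card_filter_le _ _
  refine le_trans (le_of_eq ?_) h2
  refine Eq.trans ?_ (this.symm.trans ?_)
  · congr 2
    ext cf; simp
  · congr 1
    ext zf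
    simp only [Finset.mem_filter]

open Classical in
theorem lower_final (ϖ : B → ℝ) (ω : B → B → ℝ) (hϖ : ∀ a, 0 < ϖ a) (hϖ1 : ∑ a, ϖ a = 1) (hω : ∀ a b, 0 ≤ ω a b) (N : ℕ → B → ℕ) (m : ℕ → Sym2 B → ℕ) (hNs : ∀ n, ∑ a, N n a = n) (hN : ∀ a, Tendsto (fun n : ℕ => (N n a : ℝ) / n) atTop (𝓝 (ϖ a))) (hk : ∀ a b, Tendsto (fun n : ℕ => (kk (stubα (m n)) (stubβ (m n)) a b : ℝ) / n) atTop (𝓝 (ω a b)))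
    (p : B × (B → ℕ) → ℝ) (hp : ∀ x, 0 ≤ p x) (hc : consis ϖ ω p) (hac : ∀ x, qq ϖ ω x = 0 → p x = 0)
    (hs : Summable fun x => ent (p x) (qq ϖ ω x)) (δ : ℝ) (hδ : 0 < δ) (S0 : Finset (B × (B → ℕ))) (η : ℝ) (hη : 0 < η) :
    ∀ᶠ n : ℕ in atTop, 0 < #{cf : TConf B n | admP (N n) (m n) cf} ∧
      (#{cf : TConf B n | admP (N n) (m n) cf} : ℝ) * Real.exp (-(n * (∑' x, ent (p x) (qq ϖ ω x) + δ))) ≤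
      #{cf : TConf B n | admP (N n) (m n) cf ∧ ∀ x ∈ S0, |emp cf x - p x| < η} := by
  have hposc : ∀ᶠ n : ℕ in atTop, 0 < #(stubConf (Fin n) (stubα (m n)) (N n)) := by
    filter_upwards [N_pos ϖ hϖ N hN] with n hn
    have h1 := card_stubConf (V := Fin n) (stubα (m n)) (stubβ (m n)) (N n) (by simpa using hNs n)
    rcases Nat.eq_zero_or_pos (#(stubConf (Fin n) (stubα (m n)) (N n))) with h | h
    · rw [h, zero_mul] at h1
      exact absurd h1 (Nat.mul_pos (Nat.factorial_pos _) (Finset.prod_pos fun a _ => Finset.prod_pos fun b _ => Nat.pow_pos (hn a))).ne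
    · exact h
  filter_upwards [lower_asym ϖ ω hϖ hϖ1 hω N m hNs hN hk p hp hc hac hs δ hδ S0 η hη,
    stub_le ϖ ω hϖ hϖ1 hω N m hNs hN hk 1 one_pos, hposc] with n h1 h2 h3
  have hG : (0 : ℝ) < Nat.card {π // stubG (m n) π} := by exact_mod_cast stubG_pos (m n)
  constructor
  · rcases Nat.eq_zero_or_pos (#{cf : TConf B n | admP (N n) (m n) cf}) with h | h
    · rw [h] at h2
      have : (0 : ℝ) < #(stubConf (Fin n) (stubα (m n)) (N n)) := by exact_mod_cast h3
      simp only [Nat.cast_zero, mul_zero] at h2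
      linarith
    · exact h
  · have h4 : ((Nat.card {π // stubG (m n) π} : ℕ) : ℝ) * #{cf : TConf B n | admP (N n) (m n) cf} ≤ #(stubConf (Fin n) (stubα (m n)) (N n)) := by
      exact_mod_cast adm_le n (N n) (m n)
    refine le_of_mul_le_mul_left (le_trans ?_ h1) hG
    rw [← mul_assoc]
    exact mul_le_mul_of_nonneg_right h4 (Real.exp_nonneg _)

open Classical in
theorem upper_stub (ϖ : B → ℝ) (ω : B → B → ℝ) (hϖ : ∀ a, 0 < ϖ a) (hω : ∀ a b, 0 ≤ ω a b) (N : ℕ → B → ℕ) (m : ℕ → Sym2 B → ℕ) (hNs : ∀ n, ∑ a, N n a = n) (hN : ∀ a, Tendsto (fun n : ℕ => (N n a : ℝ) / n) atTop (𝓝 (ϖ a))) (hk : ∀ a b, Tendsto (fun n : ℕ => (kk (stubα (m n)) (stubβ (m n)) a b : ℝ) / n) atTop (𝓝 (ω a b)))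
    (S : Finset (B × (B → ℕ))) (h : B × (B → ℕ) → ℝ) (hS : ∀ x ∉ S, h x = 0) (lam : B → B → ℝ) (κ : B → ℝ) (c δ : ℝ) (hδ : 0 < δ) :
    ∀ᶠ n : ℕ in atTop, ((Nat.card {π // stubG (m n) π} : ℕ) : ℝ) * #{cf : TConf B n | admP (N n) (m n) cf ∧ c ≤ Lam ϖ ω S h lam κ (emp cf)} ≤
      #(stubConf (Fin n) (stubα (m n)) (N n)) * Real.exp (-(n * (c - δ))) := by
  obtain ⟨H, hH⟩ := bdd_of_supp S h hS
  set Z := ∑' x, qq ϖ ω x * Real.exp (gg h lam κ x) with hZ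
  set Zn : ℕ → ℝ := fun n => ∑' x, qq (fun a => (N n a : ℝ) / n) (fun a b => (kk (stubα (m n)) (stubβ (m n)) a b : ℝ) / n) x * Real.exp (gg h lam κ x) with hZn
  have hZt : Tendsto Zn atTop (𝓝 Z) := by
    refine tendsto_qq_exp ϖ ω _ _ (fun n a => by positivity) (fun n a => ?_) (fun n a b => by positivity) hN hk hϖ h lam κ H hH
    refine div_le_one_of_le₀ ?_ (Nat.cast_nonneg n)
    have : N n a ≤ ∑ a, N n a := Finset.single_le_sum (f := N n) (fun _ _ => Nat.zero_le _) (mem_univ a)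
    rw [hNs] at this
    exact_mod_cast this
  have hlin : Tendsto (fun n : ℕ => ∑ a, κ a * ((N n a : ℝ) / n) + ∑ a, ∑ b, lam a b * ((kk (stubα (m n)) (stubβ (m n)) a b : ℝ) / n)) atTop
      (𝓝 (∑ a, κ a * ϖ a + ∑ a, ∑ b, lam a b * ω a b)) :=
    (tendsto_finset_sum _ fun a _ => (hN a).const_mul _).add
      (tendsto_finset_sum _ fun a _ => tendsto_finset_sum _ fun b _ => (hk a b).const_mul _)
  filter_upwards [hZt.eventually_lt_const (show Z < Z + δ / 3 by linarith), hlin.eventually_const_lt (show ∑ a, κ a * ϖ a + ∑ a, ∑ b, lam a b * ω a b - δ / 3 < _ by linarith),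
    Pfac_small ϖ ω N m hN hk (δ / 3) (by linarith), N_pos ϖ hϖ N hN, eventually_gt_atTop 0] with n h1 h2 h3 h4 hn
  have hn0 : (0 : ℝ) < n := by exact_mod_cast hn
  set lin := ∑ a, κ a * ((N n a : ℝ) / n) + ∑ a, ∑ b, lam a b * ((kk (stubα (m n)) (stubβ (m n)) a b : ℝ) / n) with hlindef
  set l0 := ∑ a, κ a * ϖ a + ∑ a, ∑ b, lam a b * ω a b with hl0
  set θ : ℝ := n * (c - l0 + (Z - 1)) with hθ
  have hch := cheb (V := Fin n) (stubα (m n)) (stubβ (m n)) (N n) (by simpa using hNs n) h4 S h hS lam κ θ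
  simp only [Fintype.card_fin] at hch
  have hlk := link (V := Fin n) (N n) (m n) (fun cf : TConf B n => c ≤ Lam ϖ ω S h lam κ (emp cf))
  set T : ℝ := ((#{zf ∈ stubConf (Fin n) (stubα (m n)) (N n) | θ ≤ ∑ x ∈ S, h x * #{v | prof (stubβ (m n)) zf.1 zf.2 v = x}} : ℕ) : ℝ) with hT
  have hle : ((Nat.card {π // stubG (m n) π} : ℕ) : ℝ) * #{cf : TConf B n | admP (N n) (m n) cf ∧ c ≤ Lam ϖ ω S h lam κ (emp cf)} ≤ T := by
    have h5 : Nat.card {π // stubG (m n) π} * #{cf : TConf B n | admP (N n) (m n) cf ∧ c ≤ Lam ϖ ω S h lam κ (emp cf)} ≤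
        #{zf ∈ stubConf (Fin n) (stubα (m n)) (N n) | θ ≤ ∑ x ∈ S, h x * #{v | prof (stubβ (m n)) zf.1 zf.2 v = x}} := by
      refine le_trans (le_of_eq ?_) (le_trans (le_of_eq hlk.symm) (Finset.card_le_card ?_))
      · congr!
      · intro zf hzf
        rw [Finset.mem_filter] at hzf ⊢
        obtain ⟨hst, hinj, hc⟩ := hzf
        refine ⟨hst, ?_⟩
        have hval : ∀ d, zf.1 (zf.2 d) = stubα (m n) d := by
          simp only [stubConf, Finset.mem_filter, mem_univ, true_and] at hst
          exact hst.2
        unfold Lam emp at hc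
        simp only [nbr_edges (stubτ (m n)) (stubτ_τ (m n)) (stubα (m n)) (stubβ (m n)) (fun d => rfl) zf.1 zf.2 hval hinj] at hc
        have e : ∑ x ∈ S, h x * (((#{v | prof (stubβ (m n)) zf.1 zf.2 v = x} : ℕ) : ℝ) / n) = (∑ x ∈ S, h x * ((#{v | prof (stubβ (m n)) zf.1 zf.2 v = x} : ℕ) : ℝ)) / n := by
          rw [Finset.sum_div]; exact Finset.sum_congr rfl fun x _ => by ring
        rw [e] at hc
        have h6 : c - l0 + (Z - 1) ≤ (∑ x ∈ S, h x * ((#{v | prof (stubβ (m n)) zf.1 zf.2 v = x} : ℕ) : ℝ)) / n := by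
          rw [hl0, hZ]; linarith
        rw [le_div_iff₀ hn0] at h6
        rw [hθ]; linarith
    rw [hT]
    exact_mod_cast h5
  refine hle.trans ?_
  have hZn0 : 0 ≤ Zn n := by
    refine tsum_nonneg fun x => mul_nonneg (qq_nonneg _ _ (fun a => by positivity) (fun a b => by positivity) x) (Real.exp_nonneg _)
  have hZp : Zn n ^ n ≤ Real.exp (n * (Z - 1 + δ / 3)) := by
    have : Zn n ≤ Real.exp (Z - 1 + δ / 3) := by
      have := Real.add_one_le_exp (Z - 1 + δ / 3)
      linarith
    calc Zn n ^ n ≤ Real.exp (Z - 1 + δ / 3) ^ n := by gcongr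
      _ = _ := by rw [← Real.exp_nat_mul]
  have hexp : θ + ∑ a, κ a * (N n a : ℝ) + ∑ a, ∑ b, lam a b * (kk (stubα (m n)) (stubβ (m n)) a b : ℝ) = θ + n * lin := by
    rw [hlindef, mul_add, Finset.mul_sum, Finset.mul_sum, ← add_assoc]
    congr 1
    · congr 1
      exact Finset.sum_congr rfl fun a _ => by field_simp
    · refine Finset.sum_congr rfl fun a _ => ?_
      rw [Finset.mul_sum]
      exact Finset.sum_congr rfl fun b _ => by field_simp
  rw [hexp] at hch
  set St : ℝ := ((#(stubConf (Fin n) (stubα (m n)) (N n)) : ℕ) : ℝ) with hSt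
  have hSt0 : 0 ≤ St := Nat.cast_nonneg _
  have h7 : T * Real.exp (θ + n * lin) ≤ St * (Real.exp (δ / 3 * n) * Real.exp (n * (Z - 1 + δ / 3))) := by
    refine hch.trans ?_
    refine mul_le_mul_of_nonneg_left ?_ hSt0
    exact mul_le_mul h3 hZp (pow_nonneg hZn0 n) (Real.exp_nonneg _)
  have h8 : T ≤ St * (Real.exp (δ / 3 * n) * Real.exp (n * (Z - 1 + δ / 3))) * Real.exp (-(θ + n * lin)) := by
    have := mul_le_mul_of_nonneg_right h7 (Real.exp_nonneg (-(θ + n * lin)))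
    rwa [mul_assoc T, ← Real.exp_add, add_neg_cancel, Real.exp_zero, mul_one] at this
  refine h8.trans ?_
  rw [mul_assoc]
  refine mul_le_mul_of_nonneg_left ?_ hSt0
  rw [← Real.exp_add, ← Real.exp_add, Real.exp_le_exp, hθ]
  have : (n : ℝ) * (l0 - δ / 3) ≤ n * lin := by gcongr
  linarith

open Classical in
theorem upper_final (ϖ : B → ℝ) (ω : B → B → ℝ) (hϖ : ∀ a, 0 < ϖ a) (hϖ1 : ∑ a, ϖ a = 1) (hω : ∀ a b, 0 ≤ ω a b) (N : ℕ → B → ℕ) (m : ℕ → Sym2 B → ℕ) (hNs : ∀ n, ∑ a, N n a = n) (hN : ∀ a, Tendsto (fun n : ℕ => (N n a : ℝ) / n) atTop (𝓝 (ϖ a))) (hk : ∀ a b, Tendsto (fun n : ℕ => (kk (stubα (m n)) (stubβ (m n)) a b : ℝ) / n) atTop (𝓝 (ω a b)))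
    (S : Finset (B × (B → ℕ))) (h : B × (B → ℕ) → ℝ) (hS : ∀ x ∉ S, h x = 0) (lam : B → B → ℝ) (κ : B → ℝ) (c δ : ℝ) (hδ : 0 < δ) :
    ∀ᶠ n : ℕ in atTop, (#{cf : TConf B n | admP (N n) (m n) cf ∧ c ≤ Lam ϖ ω S h lam κ (emp cf)} : ℝ) ≤
      #{cf : TConf B n | admP (N n) (m n) cf} * Real.exp (-(n * (c - δ))) := by
  filter_upwards [upper_stub ϖ ω hϖ hω N m hNs hN hk S h hS lam κ c (δ / 2) (by linarith),
    stub_le ϖ ω hϖ hϖ1 hω N m hNs hN hk (δ / 2) (by linarith)] with n h1 h2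
  have hG : (0 : ℝ) < Nat.card {π // stubG (m n) π} := by exact_mod_cast stubG_pos (m n)
  refine le_of_mul_le_mul_left (h1.trans ?_) hG
  refine (mul_le_mul_of_nonneg_right h2 (Real.exp_nonneg _)).trans (le_of_eq ?_)
  have : Real.exp (-(n * (c - δ))) = Real.exp (n * (δ / 2)) * Real.exp (-(n * (c - δ / 2))) := by
    rw [← Real.exp_add]; congr 1; ring
  rw [this]; ring

end upperasym

/-! ### Part 18 -/

section assembly

theorem exp_val_le (n : ℕ) (hn : 0 < n) (x : ℝ≥0∞) (t : ℝ) (h : x ≤ ENNReal.ofReal (Real.exp (n * t))) :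
    (((n : ℝ) : EReal))⁻¹ * ENNReal.log x ≤ (t : EReal) := by
  have hn' : (0 : ℝ) < n := by exact_mod_cast hn
  have h1 := ENNReal.log_monotone h
  rw [ENNReal.log_ofReal, if_neg (not_le.2 (Real.exp_pos _)), Real.log_exp] at h1
  have h2 : (((n : ℝ) : EReal))⁻¹ * ENNReal.log x ≤ (((n : ℝ) : EReal))⁻¹ * ((n * t : ℝ) : EReal) := by
    refine mul_le_mul_of_nonneg_left h1 ?_
    rw [← EReal.coe_inv]
    exact_mod_cast (inv_pos.2 hn').le
  refine h2.trans (le_of_eq ?_)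
  rw [← EReal.coe_inv, ← EReal.coe_mul, inv_mul_cancel_left₀ hn'.ne']

theorem le_exp_val (n : ℕ) (hn : 0 < n) (x : ℝ≥0∞) (t : ℝ) (h : ENNReal.ofReal (Real.exp (n * t)) ≤ x) :
    (t : EReal) ≤ (((n : ℝ) : EReal))⁻¹ * ENNReal.log x := by
  have hn' : (0 : ℝ) < n := by exact_mod_cast hn
  have h1 := ENNReal.log_monotone h
  rw [ENNReal.log_ofReal, if_neg (not_le.2 (Real.exp_pos _)), Real.log_exp] at h1
  have h2 : (((n : ℝ) : EReal))⁻¹ * ((n * t : ℝ) : EReal) ≤ (((n : ℝ) : EReal))⁻¹ * ENNReal.log x := by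
    refine mul_le_mul_of_nonneg_left h1 ?_
    rw [← EReal.coe_inv]
    exact_mod_cast (inv_pos.2 hn').le
  refine le_trans (le_of_eq ?_) h2
  rw [← EReal.coe_inv, ← EReal.coe_mul, inv_mul_cancel_left₀ hn'.ne']

open Classical in
theorem uniformOn_apply {n : ℕ} (s : Finset (TConf B n)) (A : Set (TConf B n)) :
    uniformOn s A = (s.card : ℝ≥0∞)⁻¹ * ((s.filter fun c => c ∈ A).card : ℝ≥0∞) := by
  unfold uniformOn
  rw [Measure.smul_apply, Measure.finset_sum_apply, smul_eq_mul]
  congr 1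
  rw [Finset.card_filter]
  push_cast
  refine Finset.sum_congr rfl fun c _ => ?_
  rw [Measure.dirac_apply' _ (show MeasurableSet A from trivial)]
  simp [Set.indicator]

open Classical in
theorem uniformOn_ofReal {n : ℕ} (s : Finset (TConf B n)) (A : Set (TConf B n)) (hs : 0 < s.card) :
    uniformOn s A = ENNReal.ofReal (((s.filter fun c => c ∈ A).card : ℝ) / s.card) := by
  rw [uniformOn_apply, ENNReal.ofReal_div_of_pos (by exact_mod_cast hs), mul_comm, ← div_eq_mul_inv]
  simp

open Classical in
theorem uniformOn_le_one {n : ℕ} (s : Finset (TConf B n)) (A : Set (TConf B n)) :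
    uniformOn s A ≤ 1 := by
  rw [uniformOn_apply, mul_comm, ← div_eq_mul_inv]
  refine ENNReal.div_le_of_le_mul ?_
  rw [one_mul]
  exact_mod_cast Finset.card_filter_le _ _

open Classical in
theorem admissible_eq (ϖ : B → ℝ) (ω : B → B → ℝ) (n : ℕ) (N : B → ℕ) (m : Sym2 B → ℕ) (hN : ∀ a, (N a : ℝ) = n * ϖ a)
    (hm : ∀ a b, (m s(a, b) : ℝ) = if a = b then n * ω a b / 2 else n * ω a b) :
    admissible ϖ ω n = univ.filter fun c => admP N m c := by
  ext c
  unfold admissible admP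
  simp only [Finset.mem_filter, Finset.mem_univ, true_and, ← hN, ← hm, Nat.cast_inj]
  refine and_congr Iff.rfl (and_congr ?_ ?_)
  · refine forall_congr' fun a => ?_
    congr!
  · constructor
    · intro h p
      induction p using Sym2.ind with | _ a b => 
      convert h a b
    · intro h a b
      convert h s(a, b)

theorem hasSum_emp {n : ℕ} (N : B → ℕ) (m : Sym2 B → ℕ) (c : TConf B n) (h : admP N m c) :
    HasSum (fun x => (∑ b, (x.2 b : ℝ)) * emp c x) (∑ a, ∑ b, (kk (stubα m) (stubβ m) a b : ℝ) / n) := by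
  obtain ⟨f, hf, hinj, he⟩ := exists_stub N m c h
  have hv : ∀ v, (c.1 v, nbr c v) = prof (stubβ m) c.1 f v := by
    intro v
    have := nbr_edges (stubτ m) (stubτ_τ m) (stubα m) (stubβ m) (fun _ => rfl) c.1 f hf hinj v
    rw [he] at this
    exact this
  have h1 : HasSum (fun x : B × (B → ℕ) => ∑ v : Fin n, if x = (c.1 v, nbr c v) then (∑ b, (nbr c v b : ℝ)) / n else 0)
      (∑ v : Fin n, (∑ b, (nbr c v b : ℝ)) / n) :=
    hasSum_sum fun v _ => hasSum_ite_eq (c.1 v, nbr c v) _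
  convert h1 using 1
  · ext x
    unfold emp
    rw [Finset.card_filter, ← mul_div_assoc]
    push_cast
    rw [Finset.mul_sum, Finset.sum_div]
    refine Finset.sum_congr rfl fun v _ => ?_
    by_cases hx : (c.1 v, nbr c v) = x
    · rw [if_pos hx, if_pos hx.symm, ← hx]; simp
    · rw [if_neg hx, if_neg (fun h => hx h.symm)]; simp
  · have h2 : ∀ a b, (kk (stubα m) (stubβ m) a b : ℝ) = ∑ v with c.1 v = a, (nbr c v b : ℝ) := by
      intro a b
      rw [← prof_sum (stubα m) (stubβ m) c.1 f hf a b]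
      push_cast
      refine Finset.sum_congr rfl fun v _ => ?_
      rw [← hv]
    simp only [h2, ← Finset.sum_div]
    congr 1
    rw [← Finset.sum_fiberwise (univ : Finset (Fin n)) c.1]
    refine Finset.sum_congr rfl fun a _ => ?_
    rw [Finset.sum_comm]

theorem pm_emp [TopologicalSpace B] [DiscreteTopology B] [BorelSpace B] {n : ℕ} (hn : 0 < n) (c : TConf B n) (μ : ProbabilityMeasure (B × (B → ℕ)))
    (hμ : (μ : Measure (B × (B → ℕ))) = (n : ℝ≥0∞)⁻¹ • ∑ v : Fin n, Measure.dirac (c.1 v, nbr c v)) : pm μ = emp c := by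
  ext x
  unfold pm emp
  rw [hμ, Measure.smul_apply, Measure.finset_sum_apply, smul_eq_mul, ENNReal.toReal_mul, ENNReal.toReal_inv, ENNReal.toReal_natCast,
    mul_comm, ← div_eq_mul_inv]
  congr 1
  rw [Finset.card_filter]
  simp only [Measure.dirac_apply' _ (MeasurableSet.singleton x), Set.indicator, Set.mem_singleton_iff, Pi.one_apply]
  rw [ENNReal.toReal_sum (by intros; split_ifs <;> simp)]
  push_cast
  refine Finset.sum_congr rfl fun v _ => ?_
  split_ifs <;> simp

end assembly

/-! ### Part 19 -/

section ldp
variable [TopologicalSpace B] [DiscreteTopology B] [BorelSpace B]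

open Classical in
theorem ldp_lower (ϖ : B → ℝ) (ω : B → B → ℝ) (hϖ : ∀ a, 0 < ϖ a) (hϖ1 : ∑ a, ϖ a = 1) (hω : ∀ a b, 0 ≤ ω a b)
    (N : ℕ → B → ℕ) (m : ℕ → Sym2 B → ℕ) (hNs : ∀ n, ∑ a, N n a = n)
    (hN : ∀ a, Tendsto (fun n : ℕ => (N n a : ℝ) / n) atTop (𝓝 (ϖ a)))
    (hk : ∀ a b, Tendsto (fun n : ℕ => (kk (stubα (m n)) (stubβ (m n)) a b : ℝ) / n) atTop (𝓝 (ω a b)))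
    (M : ∀ n : ℕ, TConf B n → ProbabilityMeasure (B × (B → ℕ)))
    (hM : ∀ n : ℕ, 0 < n → ∀ c : TConf B n, pm (M n c) = emp c)
    (O : Set (ProbabilityMeasure (B × (B → ℕ)))) (hO : IsOpen O) :
    -(⨅ x ∈ O, (locRate ϖ ω x : EReal))
      ≤ liminf (fun n : ℕ => ((n : ℝ)⁻¹ : EReal) * ENNReal.log (uniformOn (univ.filter fun c : TConf B n => admP (N n) (m n) c) (M n ⁻¹' O))) atTop := by
  rw [EReal.neg_le]
  refine le_iInf₂ fun μ hμ => ?_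
  rw [EReal.neg_le]
  by_cases htop : locRate ϖ ω μ = ⊤
  · rw [htop]; simp
  obtain ⟨c, hc⟩ : ∃ c : ℝ≥0, locRate ϖ ω μ = c := ⟨_, (ENNReal.coe_toNNReal htop).symm⟩
  obtain ⟨h1, h2, h3, h4⟩ := (locRate_le_iff ϖ ω hϖ hω μ c).1 hc.le
  obtain ⟨S, η, hη, hS⟩ := pm_nhds O hO μ hμ
  have hcc : ((locRate ϖ ω μ : ℝ≥0∞) : EReal) = ((c : ℝ) : EReal) := by rw [hc]; rfl
  rw [hcc, ← EReal.coe_neg]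
  refine EReal.ge_of_forall_gt_iff_ge.1 fun z hz => ?_
  have hz' : z < -(c : ℝ) := by exact_mod_cast hz
  refine le_liminf_of_le (by isBoundedDefault) ?_
  filter_upwards [eventually_gt_atTop 0, lower_final ϖ ω hϖ hϖ1 hω N m hNs hN hk (pm μ) (pm_nonneg μ) h1 h2 h3 (-(c : ℝ) - z) (by linarith) S η hη] with n hn hl
  refine le_exp_val n hn _ _ ?_
  rw [uniformOn_ofReal _ _ hl.1]
  refine ENNReal.ofReal_le_ofReal ?_
  have hpos : (0 : ℝ) < (#{cf : TConf B n | admP (N n) (m n) cf} : ℝ) := by exact_mod_cast hl.1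
  rw [le_div_iff₀ hpos, mul_comm]
  have hn' : (0 : ℝ) < n := by exact_mod_cast hn
  refine le_trans ?_ (hl.2.trans ?_)
  · refine mul_le_mul_of_nonneg_left (Real.exp_le_exp.2 ?_) hpos.le
    nlinarith
  · norm_cast
    refine Finset.card_le_card ?_
    intro cf hcf
    simp only [Finset.mem_filter, Finset.mem_univ, true_and] at hcf ⊢
    refine ⟨hcf.1, hS _ ?_⟩
    rw [hM n hn]
    exact hcf.2

open Classical in
theorem ldp_upper (ϖ : B → ℝ) (ω : B → B → ℝ) (hϖ : ∀ a, 0 < ϖ a) (hϖ1 : ∑ a, ϖ a = 1) (hω : ∀ a b, 0 ≤ ω a b)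
    (N : ℕ → B → ℕ) (m : ℕ → Sym2 B → ℕ) (hNs : ∀ n, ∑ a, N n a = n)
    (hN : ∀ a, Tendsto (fun n : ℕ => (N n a : ℝ) / n) atTop (𝓝 (ϖ a)))
    (hk : ∀ a b, Tendsto (fun n : ℕ => (kk (stubα (m n)) (stubβ (m n)) a b : ℝ) / n) atTop (𝓝 (ω a b)))
    (M : ∀ n : ℕ, TConf B n → ProbabilityMeasure (B × (B → ℕ)))
    (hM : ∀ n : ℕ, 0 < n → ∀ c : TConf B n, pm (M n c) = emp c)
    (F : Set (ProbabilityMeasure (B × (B → ℕ)))) (hF : IsClosed F) :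
    limsup (fun n : ℕ => ((n : ℝ)⁻¹ : EReal) * ENNReal.log (uniformOn (univ.filter fun c : TConf B n => admP (N n) (m n) c) (M n ⁻¹' F))) atTop
      ≤ -(⨅ x ∈ F, (locRate ϖ ω x : EReal)) := by
  refine EReal.le_of_forall_lt_iff_le.1 fun z hz => ?_
  obtain ⟨y, hy1, hy2⟩ := EReal.lt_iff_exists_real_btwn.1 hz
  have hyz : y < z := by exact_mod_cast hy2
  refine limsup_le_of_le (by isBoundedDefault) ?_
  by_cases hy0 : 0 < y
  · filter_upwards [eventually_gt_atTop 0] with n hn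
    refine exp_val_le n hn _ _ ?_
    refine (uniformOn_le_one _ _).trans ?_
    rw [← ENNReal.ofReal_one]
    refine ENNReal.ofReal_le_ofReal (Real.one_le_exp ?_)
    have := hy0.trans hyz
    positivity
  push Not at hy0
  obtain ⟨c, hc⟩ : ∃ c : ℝ≥0, (c : ℝ) = -y := ⟨⟨-y, by linarith⟩, rfl⟩
  have hlt : ∀ μ ∈ F, ∃ (S : Finset (B × (B → ℕ))) (h : B × (B → ℕ) → ℝ) (lam : B → B → ℝ) (κ : B → ℝ),
      (∀ x ∉ S, h x = 0) ∧ (c : ℝ) < Lam ϖ ω S h lam κ (pm μ) := by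
    intro μ hμ
    by_contra hcon
    push Not at hcon
    have h1 := (locRate_le_iff_Lam ϖ ω hϖ hϖ1 hω μ c).2 hcon
    have h2 : (⨅ x ∈ F, (locRate ϖ ω x : EReal)) ≤ ((c : ℝ) : EReal) := by
      refine (iInf₂_le μ hμ).trans ?_
      have : ((locRate ϖ ω μ : ℝ≥0∞) : EReal) ≤ (((c : ℝ≥0∞)) : EReal) := by exact_mod_cast h1
      exact this
    rw [hc, EReal.coe_neg, EReal.le_neg] at h2
    exact absurd hy1 (not_lt.2 h2)
  choose S h lam κ hS hL using hlt
  set C : ℝ≥0 := ⟨∑ a, ∑ b, ω a b + 1, by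
    have := Finset.sum_nonneg fun a (_ : a ∈ (univ : Finset B)) => Finset.sum_nonneg fun b (_ : b ∈ (univ : Finset B)) => hω a b
    linarith⟩ with hC
  have hcomp : IsCompact (Kset C ∩ F) := (isCompact_Kset C).inter_right hF
  obtain ⟨t, ht⟩ := hcomp.elim_finite_subcover (ι := {μ // μ ∈ F})
    (fun i => {ν | (c : ℝ) < Lam ϖ ω (S i.1 i.2) (h i.1 i.2) (lam i.1 i.2) (κ i.1 i.2) (pm ν)})
    (fun i => isOpen_lt continuous_const (continuous_Lam ϖ ω _ _ _ _))
    (fun μ hμ => Set.mem_iUnion.2 ⟨⟨μ, hμ.2⟩, hL μ hμ.2⟩)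
  have hsum : Tendsto (fun n : ℕ => ∑ a, ∑ b, (kk (stubα (m n)) (stubβ (m n)) a b : ℝ) / n) atTop (𝓝 (∑ a, ∑ b, ω a b)) :=
    tendsto_finset_sum _ fun a _ => tendsto_finset_sum _ fun b _ => hk a b
  have hδ : 0 < (z - y) / 2 := by linarith
  have hup : ∀ᶠ n : ℕ in atTop, ∀ i ∈ t, (#{cf : TConf B n | admP (N n) (m n) cf ∧ (c : ℝ) ≤ Lam ϖ ω (S i.1 i.2) (h i.1 i.2) (lam i.1 i.2) (κ i.1 i.2) (emp cf)} : ℝ) ≤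
      #{cf : TConf B n | admP (N n) (m n) cf} * Real.exp (-(n * (c - (z - y) / 2))) := by
    rw [eventually_all_finset]
    intro i _
    exact upper_final ϖ ω hϖ hϖ1 hω N m hNs hN hk _ _ (hS i.1 i.2) _ _ _ _ hδ
  have hq := lower_final ϖ ω hϖ hϖ1 hω N m hNs hN hk (qq ϖ ω) (qq_nonneg ϖ ω (fun a => (hϖ a).le) hω) (consis_qq ϖ ω hϖ hω) (fun _ h => h)
    (by simp only [ent_self]; exact summable_zero) 1 one_pos ∅ 1 one_pos
  filter_upwards [eventually_gt_atTop 0, hq, hup, log_small t.card _ hδ, hsum.eventually_lt_const (show ∑ a, ∑ b, ω a b < ∑ a, ∑ b, ω a b + 1 by linarith)]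
    with n hn hl hu hlog hs
  have hn' : (0 : ℝ) < n := by exact_mod_cast hn
  refine exp_val_le n hn _ _ ?_
  rw [uniformOn_ofReal _ _ hl.1]
  refine ENNReal.ofReal_le_ofReal ?_
  have hpos : (0 : ℝ) < (#{cf : TConf B n | admP (N n) (m n) cf} : ℝ) := by exact_mod_cast hl.1
  rw [div_le_iff₀ hpos]
  have hsub : ((univ.filter fun c : TConf B n => admP (N n) (m n) c).filter fun c => c ∈ M n ⁻¹' F) ⊆
      t.biUnion fun i => univ.filter fun cf : TConf B n => admP (N n) (m n) cf ∧ (c : ℝ) ≤ Lam ϖ ω (S i.1 i.2) (h i.1 i.2) (lam i.1 i.2) (κ i.1 i.2) (emp cf) := by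
    intro cf hcf
    simp only [Finset.mem_filter, Finset.mem_univ, true_and, Set.mem_preimage] at hcf
    have hK : M n cf ∈ Kset C := by
      refine mem_Kset _ _ C ?_ (show _ ≤ (∑ a, ∑ b, ω a b + 1 : ℝ) from hs.le)
      rw [hM n hn]
      exact hasSum_emp (N n) (m n) cf hcf.1
    obtain ⟨i, hi, hi2⟩ := Set.mem_iUnion₂.1 (ht ⟨hK, hcf.2⟩)
    rw [Finset.mem_biUnion]
    refine ⟨i, hi, Finset.mem_filter.2 ⟨Finset.mem_univ _, hcf.1, ?_⟩⟩
    have hi3 : (c : ℝ) < Lam ϖ ω (S i.1 i.2) (h i.1 i.2) (lam i.1 i.2) (κ i.1 i.2) (pm (M n cf)) := hi2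
    rw [hM n hn] at hi3
    exact hi3.le
  have hcard := (Finset.card_le_card hsub).trans Finset.card_biUnion_le
  have hcard' : (((univ.filter fun c : TConf B n => admP (N n) (m n) c).filter fun c => c ∈ M n ⁻¹' F).card : ℝ) ≤
      t.card * (#{cf : TConf B n | admP (N n) (m n) cf} * Real.exp (-(n * (c - (z - y) / 2)))) := by
    refine (Nat.cast_le (α := ℝ).2 hcard).trans ?_
    rw [Nat.cast_sum, ← nsmul_eq_mul]
    exact Finset.sum_le_card_nsmul _ _ _ hu
  have htc : (t.card : ℝ) ≤ Real.exp ((z - y) / 2 * n) := by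
    have h1 : 0 ≤ Real.log ((n : ℝ) + 1) := Real.log_nonneg (by linarith)
    have h2 : (t.card : ℝ) ≤ t.card * (1 + Real.log ((n : ℝ) + 1)) := le_mul_of_one_le_right (Nat.cast_nonneg _) (by linarith)
    have := Real.add_one_le_exp ((z - y) / 2 * n)
    linarith
  refine hcard'.trans ?_
  calc _ ≤ Real.exp ((z - y) / 2 * n) * (#{cf : TConf B n | admP (N n) (m n) cf} * Real.exp (-(n * (c - (z - y) / 2)))) :=
        mul_le_mul_of_nonneg_right htc (by positivity)
    _ = (Real.exp ((z - y) / 2 * n) * Real.exp (-(n * (c - (z - y) / 2)))) * #{cf : TConf B n | admP (N n) (m n) cf} := by ring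
    _ = _ := by
        rw [← Real.exp_add, hc]
        congr 2
        ring

end ldp

/-- LDP for the empirical locality measure of the typed random geometric
graph conditioned on its empirical type measure `ϖₙ` and empirical pair measure `ωₙ`,
where `ϖₙ → ϖ` (pointwise, with `ϖ > 0`) and `ωₙ → ω`.  The empirical locality measure
`M_X(a,σ) = (1/n)·#{v : Z(v) = a, σ_v = σ}` satisfies an LDP on `𝒫(B × ℕ^B)` with the
weak topology, at speed `n`, with good rate function `J`. -/
theorem typed_graph_locality_LDP [TopologicalSpace B]
    [DiscreteTopology B] [BorelSpace B]
    (ϖn : ℕ → B → ℝ) (ωn : ℕ → B → B → ℝ) (ϖ : B → ℝ) (ω : B → B → ℝ)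
    (hϖn_nonneg : ∀ n a, 0 ≤ ϖn n a) (hϖn_sum : ∀ n, (∑ a : B, ϖn n a) = 1)
    (hϖn_nat : ∀ (n : ℕ) (a : B), ∃ k : ℕ, (n : ℝ) * ϖn n a = k)
    (hωn_nonneg : ∀ n a b, 0 ≤ ωn n a b) (hωn_symm : ∀ n a b, ωn n a b = ωn n b a)
    (hωn_nat : ∀ (n : ℕ) (a b : B), ∃ k : ℕ,
      (n : ℝ) * ωn n a b / (1 + if a = b then 1 else 0) = k)
    (hϖ_lim : ∀ a, Tendsto (fun n => ϖn n a) atTop (𝓝 (ϖ a)))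
    (hω_lim : ∀ a b, Tendsto (fun n => ωn n a b) atTop (𝓝 (ω a b)))
    (hϖ_pos : ∀ a, 0 < ϖ a)
    (M : ∀ n : ℕ, TConf B n → ProbabilityMeasure (B × (B → ℕ)))
    (hM : ∀ n : ℕ, 0 < n → ∀ c : TConf B n,
      (M n c : Measure (B × (B → ℕ)))
        = (n : ℝ≥0∞)⁻¹ • ∑ v : Fin n, Measure.dirac (c.1 v, nbr c v)) :
    IsLDP (fun n F => uniformOn (admissible (ϖn n) (ωn n) n) (M n ⁻¹' F))
      (locRate ϖ ω) := by
  classical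
  have hϖ1 : ∑ a, ϖ a = 1 := by
    have h1 : Tendsto (fun n => ∑ a, ϖn n a) atTop (𝓝 (∑ a, ϖ a)) := tendsto_finset_sum _ fun a _ => hϖ_lim a
    simp only [hϖn_sum] at h1
    exact tendsto_nhds_unique h1 tendsto_const_nhds
  have hω : ∀ a b, 0 ≤ ω a b := fun a b => ge_of_tendsto' (hω_lim a b) fun n => hωn_nonneg n a b
  choose N hNeq using hϖn_nat
  choose K hK using hωn_nat
  obtain ⟨m, hm⟩ : ∃ m : ℕ → Sym2 B → ℕ, ∀ n p, m n p = K n (ori p).1 (ori p).2 := ⟨_, fun _ _ => rfl⟩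
  have hmeq : ∀ n a b, (m n s(a, b) : ℝ) = if a = b then n * ωn n a b / 2 else n * ωn n a b := by
    intro n a b
    rw [hm, ← hK]
    rcases Sym2.eq_iff.1 (ori_eq s(a, b)) with ⟨h1, h2⟩ | ⟨h1, h2⟩
    · rw [h1, h2]
      split_ifs with h
      · norm_num
      · norm_num
    · rw [h1, h2, hωn_symm n b a]
      by_cases h : a = b
      · rw [if_pos h, if_pos h.symm]; norm_num
      · rw [if_neg h, if_neg (fun h' => h h'.symm)]; norm_num
  have hNs : ∀ n, ∑ a, N n a = n := by
    intro n
    have h1 : (∑ a, (N n a : ℝ)) = n := by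
      simp only [← hNeq, ← Finset.mul_sum, hϖn_sum, mul_one]
    exact_mod_cast h1
  have hN : ∀ a, Tendsto (fun n : ℕ => (N n a : ℝ) / n) atTop (𝓝 (ϖ a)) := by
    intro a
    refine (hϖ_lim a).congr' ?_
    filter_upwards [eventually_gt_atTop 0] with n hn
    have hn' : (n : ℝ) ≠ 0 := by exact_mod_cast hn.ne'
    rw [← hNeq, mul_div_cancel_left₀ _ hn']
  have hk : ∀ a b, Tendsto (fun n : ℕ => (kk (stubα (m n)) (stubβ (m n)) a b : ℝ) / n) atTop (𝓝 (ω a b)) := by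
    intro a b
    refine (hω_lim a b).congr' ?_
    filter_upwards [eventually_gt_atTop 0] with n hn
    have hn' : (n : ℝ) ≠ 0 := by exact_mod_cast hn.ne'
    have h1 : (kk (stubα (m n)) (stubβ (m n)) a b : ℝ) = n * ωn n a b := by
      rw [kk_stub]
      have := hmeq n a b
      split_ifs at this ⊢ with h
      · push_cast
        rw [this]; ring
      · exact this
    rw [h1, mul_div_cancel_left₀ _ hn']
  have hM' : ∀ n : ℕ, 0 < n → ∀ c : TConf B n, pm (M n c) = emp c := fun n hn c => pm_emp hn c _ (hM n hn c)
  have hadm : ∀ n, admissible (ϖn n) (ωn n) n = univ.filter fun c => admP (N n) (m n) c :=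
    fun n => admissible_eq _ _ n _ _ (fun a => (hNeq n a).symm) (hmeq n)
  simp only [hadm]
  exact ⟨goodRate ϖ ω hϖ_pos hϖ1 hω, fun F hF => ldp_upper ϖ ω hϖ_pos hϖ1 hω N m hNs hN hk M hM' F hF,
    fun O hO => ldp_lower ϖ ω hϖ_pos hϖ1 hω N m hNs hN hk M hM' O hO⟩
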